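/- (Relaxation.) In the setting below, δ_dissip(t) → 0 as t → +∞. -/

import Mathlib

open Filter Topology Set MeasureTheory

noncomputable section

local notation "⟪" x ", " y "⟫" => @inner ℝ _ _ x y

abbrev Euc (n : ℕ) : Type := EuclideanSpace ℝ (Fin n)

variable {n : ℕ}

/-- Spatial partial derivative `u_r`. -/
def ur (u : ℝ → ℝ → Euc n) (r t : ℝ) : Euc n := deriv (fun s => u s t) r

/-- Second spatial partial derivative `u_rr`. -/
def urr (u : ℝ → ℝ → Euc n) (r t : ℝ) : Euc n := deriv (fun s => ur u s t) r

/-- Time partial derivative `u_t`. -/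
def ut (u : ℝ → ℝ → Euc n) (r t : ℝ) : Euc n := deriv (fun s => u r s) t

/-- Hessian (second differential) of the potential. -/
def hess (V : Euc n → ℝ) (x : Euc n) : Euc n →L[ℝ] Euc n := fderiv ℝ (gradient V) x

/-- Coercivity hypothesis. -/
def HCoerc (V : Euc n → ℝ) : Prop :=
  ∃ ε > (0:ℝ), ∃ R : ℝ, ∀ x : Euc n, R ≤ ‖x‖ → ε * ‖x‖ ^ 2 ≤ ⟪x, gradient V x⟫

/-- The set of nondegenerate minimum points of `V`. -/
def MinSet (V : Euc n → ℝ) : Set (Euc n) :=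
  {m | gradient V m = 0 ∧ ∀ v : Euc n, v ≠ 0 → 0 < ⟪v, hess V m v⟫}

/-- Data of the constants `λ_min`, `λ_max`, `d_Esc` from the paper, together with their
spectral characterizations. -/
structure EscData (n : ℕ) (V : Euc n → ℝ) where
  lmin : ℝ
  lmax : ℝ
  dEsc : ℝ
  lmin_pos : 0 < lmin
  dEsc_pos : 0 < dEsc
  lower : ∀ m ∈ MinSet V, ∀ v : Euc n, lmin * ‖v‖ ^ 2 ≤ ⟪v, hess V m v⟫
  upper : ∀ m ∈ MinSet V, ∀ v : Euc n, ⟪v, hess V m v⟫ ≤ lmax * ‖v‖ ^ 2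
  esc_lower : ∀ m ∈ MinSet V, ∀ x : Euc n, ‖x - m‖ ≤ dEsc →
    ∀ v : Euc n, lmin / 2 * ‖v‖ ^ 2 ≤ ⟪v, hess V x v⟫
  esc_upper : ∀ m ∈ MinSet V, ∀ x : Euc n, ‖x - m‖ ≤ dEsc →
    ∀ v : Euc n, ⟪v, hess V x v⟫ ≤ 2 * lmax * ‖v‖ ^ 2

/-- Radially symmetric solution of `u_t = -∇V(u) + ((d-1)/r) u_r + u_rr` with Neumann
boundary condition at the origin. -/
structure IsRadialSolution (d : ℕ) (V : Euc n → ℝ) (u : ℝ → ℝ → Euc n) : Prop where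
  diff_r : ∀ t > (0:ℝ), ∀ r : ℝ, DifferentiableAt ℝ (fun s => u s t) r
  diff_rr : ∀ t > (0:ℝ), ∀ r : ℝ, DifferentiableAt ℝ (fun s => ur u s t) r
  cont_rr : ∀ t > (0:ℝ), Continuous fun r => urr u r t
  diff_t : ∀ t > (0:ℝ), ∀ r : ℝ, DifferentiableAt ℝ (fun s => u r s) t
  cont_t : ∀ r : ℝ, ContinuousOn (fun s => ut u r s) (Ioi 0)
  bounded : ∃ C : ℝ, ∀ r t : ℝ, 0 ≤ r → 0 < t →
    ‖u r t‖ + ‖ur u r t‖ + ‖urr u r t‖ + ‖ut u r t‖ ≤ C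
  pde : ∀ r > (0:ℝ), ∀ t > (0:ℝ),
    ut u r t = -gradient V (u r t) + (((d : ℝ) - 1) / r) • ur u r t + urr u r t
  neumann : ∀ t > (0:ℝ), ur u 0 t = 0

/-- Profiles of fronts travelling at speed `c` connecting `um` to `up`
(nonconstant solutions of `φ'' = -cφ' + ∇V(φ)`). -/
def Phi (V : Euc n → ℝ) (c : ℝ) (um up : Euc n) : Set (ℝ → Euc n) :=
  {φ | (∃ ξ₁ ξ₂ : ℝ, φ ξ₁ ≠ φ ξ₂) ∧
    (∀ ξ : ℝ, DifferentiableAt ℝ φ ξ) ∧ (∀ ξ : ℝ, DifferentiableAt ℝ (deriv φ) ξ) ∧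
    (∀ ξ : ℝ, deriv (deriv φ) ξ = -(c • deriv φ ξ) + gradient V (φ ξ)) ∧
    Tendsto φ atBot (𝓝 um) ∧ Tendsto φ atTop (𝓝 up)}

/-- Fronts travelling at speed `c` invading the equilibrium `mp`. -/
def PhiInv (V : Euc n → ℝ) (c : ℝ) (mp : Euc n) : Set (ℝ → Euc n) :=
  ⋃ mm ∈ MinSet V, Phi V c mm mp

/-- Normalized front profiles. -/
def PhiNorm (V : Euc n → ℝ) (dEsc c : ℝ) (mm mp : Euc n) : Set (ℝ → Euc n) :=
  {φ | φ ∈ Phi V c mm mp ∧ ‖φ 0 - mp‖ = dEsc ∧ ∀ ξ > (0:ℝ), ‖φ ξ - mp‖ < dEsc}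

/-- Normalized front profiles invading `mp`. -/
def PhiNormInv (V : Euc n → ℝ) (dEsc c : ℝ) (mp : Euc n) : Set (ℝ → Euc n) :=
  ⋃ mm ∈ MinSet V, PhiNorm V dEsc c mm mp

/-- Every critical point of `V` is nondegenerate. -/
def HNonDeg (V : Euc n → ℝ) : Prop :=
  ∀ x : Euc n, gradient V x = 0 → ∀ v : Euc n, hess V x v = 0 → v = 0

/-- Every front travelling at a positive speed and invading a minimum point is bistable. -/
def HOnlyBist (V : Euc n → ℝ) : Prop :=
  ∀ mp ∈ MinSet V, ∀ um : Euc n, gradient V um = 0 →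
    ∀ c > (0:ℝ), (Phi V c um mp).Nonempty → um ∈ MinSet V

/-- The set of invading speeds has empty interior. -/
def HDiscVel (V : Euc n → ℝ) : Prop :=
  ∀ mp ∈ MinSet V, interior {c : ℝ | 0 ≤ c ∧ (PhiInv V c mp).Nonempty} = ∅

/-- The set of initial values of normalized invading fronts is totally disconnected. -/
def HDiscFront (V : Euc n → ℝ) (dEsc : ℝ) : Prop :=
  ∀ mp ∈ MinSet V, ∀ c > (0:ℝ),
    IsTotallyDisconnected
      {p : Euc n × Euc n | ∃ φ ∈ PhiNormInv V dEsc c mp, p = (φ 0, deriv φ 0)}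

/-- The generic hypotheses on the potential. -/
def HGen (V : Euc n → ℝ) (dEsc : ℝ) : Prop :=
  HNonDeg V ∧ HOnlyBist V ∧ HDiscVel V ∧ HDiscFront V dEsc

/-- The solution is stable at infinity, close to the minimum point `m`. -/
def StableAtInfinity (V : Euc n → ℝ) (u : ℝ → ℝ → Euc n) (m : Euc n) : Prop :=
  m ∈ MinSet V ∧
    Tendsto (fun t => limsup (fun r => ‖u r t - m‖) atTop) atTop (𝓝 0)

/-- Propagating terrace of bistable fronts connecting `mLoc` to `mFar`. -/
def IsTerrace (V : Euc n → ℝ) (mLoc mFar : Euc n) (T : ℝ → ℝ → Euc n) : Prop :=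
  ∃ (q : ℕ) (ms : ℕ → Euc n) (cs : ℕ → ℝ) (φs : ℕ → ℝ → Euc n) (rs : ℕ → ℝ → ℝ),
    ms 0 = mFar ∧ ms q = mLoc ∧ (∀ i, i ≤ q → ms i ∈ MinSet V) ∧
    (∀ i, i < q → V (ms (i + 1)) < V (ms i)) ∧
    (∀ i, 1 ≤ i → i ≤ q → 0 < cs i) ∧
    (∀ i, 1 ≤ i → i + 1 ≤ q → cs (i + 1) ≤ cs i) ∧
    (∀ i, 1 ≤ i → i ≤ q → φs i ∈ Phi V (cs i) (ms i) (ms (i - 1))) ∧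
    (∀ i, 1 ≤ i → i ≤ q →
      (∀ t : ℝ, 0 ≤ t → 0 ≤ rs i t) ∧ (∀ t : ℝ, DifferentiableAt ℝ (rs i) t) ∧
        Tendsto (deriv (rs i)) atTop (𝓝 (cs i))) ∧
    (∀ i, 1 ≤ i → i + 1 ≤ q → Tendsto (fun t => rs (i + 1) t - rs i t) atTop atTop) ∧
    (∀ r t : ℝ, 0 ≤ r → 0 ≤ t →
      T r t = ms 0 + ∑ i ∈ Finset.Icc 1 q, (φs i (r - rs i t) - ms (i - 1)))

/-- Hypothesis `(H_hom)` unbundled: `u` is close to `m` on a growing interval around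
`rHom t`, travelling at asymptotic speed `cHom`; closeness is measured in `H¹` norm. -/
def HHomWith (u : ℝ → ℝ → Euc n) (m : Euc n) (cHom : ℝ) (rHom : ℝ → ℝ) : Prop :=
  0 < cHom ∧ (∀ t : ℝ, DifferentiableAt ℝ rHom t) ∧
    Tendsto (deriv rHom) atTop (𝓝 cHom) ∧
    ∀ L > (0:ℝ),
      Tendsto
        (fun t => ∫ r in (-L)..L,
          (‖u (rHom t + r) t - m‖ ^ 2 + ‖ur u (rHom t + r) t‖ ^ 2))
        atTop (𝓝 0)

/-- The set whose supremum defines the Escape point `r_Esc(t)`. -/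
def rEscSet (u : ℝ → ℝ → Euc n) (m : Euc n) (dEsc : ℝ) (rHom : ℝ → ℝ) (t : ℝ) : Set ℝ :=
  {r | r ∈ Icc 0 (rHom t) ∧ ‖u r t - m‖ = dEsc}

/-- The Escape point `r_Esc(t)`. -/
def rEscF (u : ℝ → ℝ → Euc n) (m : Euc n) (dEsc : ℝ) (rHom : ℝ → ℝ) (t : ℝ) : ℝ :=
  sSup (rEscSet u m dEsc rHom t)

/-- The upper limit mean speed `c_Esc` of the Escape point. -/
def cEscV (u : ℝ → ℝ → Euc n) (m : Euc n) (dEsc : ℝ) (rHom : ℝ → ℝ) : ℝ :=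
  limsup (fun t => rEscF u m dEsc rHom t / t) atTop

/-- `q_hull`: minimal convexity of the lower quadratic hulls of `V` at minimum points. -/
def qHull (V : Euc n → ℝ) : ℝ :=
  sInf {q : ℝ | ∃ m ∈ MinSet V, ∃ x : Euc n, x ≠ m ∧ q = (V x - V m) / ‖x - m‖ ^ 2}

/-- The weight `w` of the energy in the firewall functionals. -/
def wV (V : Euc n → ℝ) : ℝ := 1 / max 1 (-(4 * qHull V))

/-- The decay rate `κ₀`. -/
def kappa0 (lmin : ℝ) : ℝ := min (1 / 2) (lmin / 8)

/-- The "small curvature" radius `r_sc`. -/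
def rsc (d : ℕ) (lmin : ℝ) : ℝ := max (2 * ((d : ℝ) - 1)) (8 * ((d : ℝ) - 1) / lmin)

/-- The weight function `T_ρ ψ₀`. -/
def Tpsi (d : ℕ) (lmin : ℝ) (ρ r : ℝ) : ℝ :=
  if r ≤ rsc d lmin then Real.exp (-(kappa0 lmin) * |r - ρ|) * (r / rsc d lmin) ^ (d - 1)
  else Real.exp (-(kappa0 lmin) * |r - ρ|)

/-- The firewall functional `F₀` in the laboratory frame. -/
def F0 (V : Euc n → ℝ) (d : ℕ) (lmin : ℝ) (u : ℝ → ℝ → Euc n) (ρ t : ℝ) : ℝ :=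
  ∫ r in Ioi (0:ℝ),
    Tpsi d lmin ρ r * (wV V * (‖ur u r t‖ ^ 2 / 2 + V (u r t)) + ‖u r t‖ ^ 2 / 2)

/-- The set `Σ₀(t)` where the solution Escapes at distance `dEsc` from the origin. -/
def Sigma0 (u : ℝ → ℝ → Euc n) (dEsc t : ℝ) : Set ℝ := {r | 0 ≤ r ∧ dEsc < ‖u r t‖}

/-- The firewall differential inequality in the laboratory frame. -/
def FireIneq (V : Euc n → ℝ) (d : ℕ) (lmin dEsc : ℝ) (u : ℝ → ℝ → Euc n) (ν K : ℝ) : Prop :=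
  ∀ ρ ≥ rsc d lmin, ∀ t > (0:ℝ),
    DifferentiableAt ℝ (fun s => F0 V d lmin u ρ s) t ∧
    deriv (fun s => F0 V d lmin u ρ s) t ≤
      -ν * F0 V d lmin u ρ t + K * ∫ r in Sigma0 u dEsc t, Tpsi d lmin ρ r

/-- The quantity `δ = d_Esc √(min(w/2,1/4)/(κ₀+1))`. -/
def deltaEsc (dEsc w κ₀ : ℝ) : ℝ := dEsc * Real.sqrt (min (w / 2) (1 / 4) / (κ₀ + 1))

/-- The length `L₀`. -/
def L0c (κ₀ ν K δ : ℝ) : ℝ := κ₀⁻¹ * Real.log (16 * K / (ν * δ ^ 2 * κ₀))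

/-- The no-escape speed `c_noesc`. -/
def cNoEsc (κ₀ K L₀ δ : ℝ) : ℝ := 8 * K * L₀ / (κ₀ * δ ^ 2)

/-- The no-escape hull `h`. -/
def hull (δ L₀ : ℝ) (x : ℝ) : EReal :=
  if x < 0 then ⊤
  else if x ≤ L₀ then ((δ ^ 2 / 2 * (1 - x / (2 * L₀)) : ℝ) : EReal)
  else ((δ ^ 2 / 4 : ℝ) : EReal)

/-- The standing hypothesis that the firewall is below the two mirror hulls positioned
around `rHom t`. -/
def HullBound (V : Euc n → ℝ) (d : ℕ) (lmin : ℝ) (u : ℝ → ℝ → Euc n) (δ L₀ : ℝ)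
    (rHom : ℝ → ℝ) : Prop :=
  ∀ t ≥ (0:ℝ), rsc d lmin ≤ rHom t - 1 ∧
    ∀ r ≥ rsc d lmin, ((F0 V d lmin u r t : ℝ) : EReal) ≤
      max (hull δ L₀ (r - (rHom t - 1))) (hull δ L₀ (rHom t - r))

/-- The set whose infimum defines the escape point `r_esc(t)`. -/
def rescSet (V : Euc n → ℝ) (d : ℕ) (lmin : ℝ) (u : ℝ → ℝ → Euc n) (δ L₀ : ℝ)
    (rHom : ℝ → ℝ) (t : ℝ) : Set ℝ :=
  {rl | rl ∈ Icc (rsc d lmin) (rHom t) ∧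
    ∀ r ≥ rsc d lmin, ((F0 V d lmin u r t : ℝ) : EReal) ≤
      max (hull δ L₀ (r - rl)) (hull δ L₀ (rHom t - r))}

/-- The escape point `r_esc(t)`. -/
def rescF (V : Euc n → ℝ) (d : ℕ) (lmin : ℝ) (u : ℝ → ℝ → Euc n) (δ L₀ : ℝ)
    (rHom : ℝ → ℝ) (t : ℝ) : ℝ :=
  sInf (rescSet V d lmin u δ L₀ rHom t)

/-- `c̄`: upper limit of mean variations of a function over time intervals of length `s`. -/
def cbarF (f : ℝ → ℝ) : ℝ :=
  limsup (fun s => sSup {x : ℝ | ∃ t ≥ (0:ℝ), x = f (t + s) - f t} / s) atTop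

/-- `c̲`: lower limit of mean variations of a function over time intervals of length `s`. -/
def cunderF (f : ℝ → ℝ) : ℝ :=
  liminf (fun s => sInf {x : ℝ | ∃ t ≥ (0:ℝ), x = f (t + s) - f t} / s) atTop

/-- The decay rate `κ` in the travelling frame. -/
def kappaTF (lmin cno : ℝ) : ℝ := min (1 / 4) (lmin / (16 * (cno + 1)))

/-- The cut-off speed `c_cut` in the travelling frame. -/
def ccutTF (lmin lmax cno : ℝ) : ℝ := min (lmin / (8 * lmax)) (lmin / (8 * (cno + 1)))

/-- The energy weight `w'` in the travelling frame. -/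
def wTF (V : Euc n → ℝ) (cno : ℝ) : ℝ := min (wV V) (1 / (cno + 1) ^ 2)

/-- The weight function `χ` of the localized energy in the travelling frame. -/
def chiTF (d : ℕ) (lmin lmax cno c xcut r0 : ℝ) (ρ s : ℝ) : ℝ :=
  if ρ ≤ -r0 - c * s + rsc d lmin then
    Real.exp (c * ρ) * ((r0 + c * s + ρ) / rsc d lmin) ^ (d - 1)
  else if ρ ≤ xcut + ccutTF lmin lmax cno * s then Real.exp (c * ρ)
  else
    Real.exp ((c + kappaTF lmin cno) * (xcut + ccutTF lmin lmax cno * s) -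
      kappaTF lmin cno * ρ)

/-- The weight function `ψ` of the firewall in the travelling frame. -/
def psiTF (d : ℕ) (lmin lmax cno c xcut r0 : ℝ) (ρ s : ℝ) : ℝ :=
  if ρ ≤ -r0 - c * s + rsc d lmin then
    Real.exp ((c + kappaTF lmin cno) * ρ -
        kappaTF lmin cno * (xcut + ccutTF lmin lmax cno * s)) *
      ((r0 + c * s + ρ) / rsc d lmin) ^ (d - 1)
  else if ρ ≤ xcut + ccutTF lmin lmax cno * s then
    Real.exp ((c + kappaTF lmin cno) * ρ -
      kappaTF lmin cno * (xcut + ccutTF lmin lmax cno * s))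
  else
    Real.exp ((c + kappaTF lmin cno) * (xcut + ccutTF lmin lmax cno * s) -
      kappaTF lmin cno * ρ)

/-- The firewall functional `F(s)` in the travelling frame. -/
def FTF (V : Euc n → ℝ) (d : ℕ) (lmin lmax cno : ℝ) (u : ℝ → ℝ → Euc n)
    (t0 c xcut r0 : ℝ) (s : ℝ) : ℝ :=
  ∫ ρ in Ioi (-r0 - c * s),
    psiTF d lmin lmax cno c xcut r0 ρ s *
      (wTF V cno *
          (‖ur u (r0 + c * s + ρ) (t0 + s)‖ ^ 2 / 2 + V (u (r0 + c * s + ρ) (t0 + s))) +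
        ‖u (r0 + c * s + ρ) (t0 + s)‖ ^ 2 / 2)

/-- The set `Σ(s)` where the solution Escapes, in the travelling frame. -/
def SigmaTF (u : ℝ → ℝ → Euc n) (d : ℕ) (lmin dEsc : ℝ) (t0 c r0 : ℝ) (s : ℝ) : Set ℝ :=
  {ρ | -r0 - c * s + rsc d lmin ≤ ρ ∧ dEsc < ‖u (r0 + c * s + ρ) (t0 + s)‖}

/-- The weight function `ψ̃` in the standing frame. -/
def psiSF (d : ℕ) (κ cm cp : ℝ) (r t : ℝ) : ℝ :=
  if r ≤ cm * t then r ^ (d - 1) * Real.exp (-κ * (cm * t - r))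
  else if r ≤ cp * t then r ^ (d - 1)
  else r ^ (d - 1) * Real.exp (-κ * (r - cp * t))

/-- The firewall functional `F̃` in the standing frame. -/
def FSF (V : Euc n → ℝ) (d : ℕ) (κ cm cp : ℝ) (u : ℝ → ℝ → Euc n) (t : ℝ) : ℝ :=
  ∫ r in Ioi (0:ℝ),
    psiSF d κ cm cp r t * (wV V * (‖ur u r t‖ ^ 2 / 2 + V (u r t)) + ‖u r t‖ ^ 2 / 2)

/-- The quantity `δ_dissip(t)` measuring the dissipation around the escape point. -/
def deltaDissip (u : ℝ → ℝ → Euc n) (re : ℝ → ℝ) (cesc : ℝ) (t : ℝ) : ℝ :=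
  sInf {ε : ℝ | 0 < ε ∧
    (∫ τ in (-1:ℝ)..1, ∫ ρ in (-(1/ε))..(1/ε),
      ‖ut u (re (t + τ) + ρ) (t + τ) + cesc • ur u (re (t + τ) + ρ) (t + τ)‖ ^ 2) ≤ ε}

/-- `u` solves the radially symmetric system with initial datum `u₀`, in the sense of the
semi-flow on bounded continuous functions (classical for positive times). -/
def SolvesWithInit (d : ℕ) (V : Euc n → ℝ) (u : ℝ → ℝ → Euc n) (u₀ : ℝ → Euc n) : Prop :=
  (∀ r : ℝ, 0 ≤ r → u r 0 = u₀ r) ∧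
  (∀ t : ℝ, 0 ≤ t → ContinuousOn (fun r => u r t) (Ici 0) ∧ ∃ C, ∀ r : ℝ, 0 ≤ r → ‖u r t‖ ≤ C) ∧
  (∀ t : ℝ, 0 ≤ t → ∀ ε > (0:ℝ), ∃ δ > (0:ℝ), ∀ t' : ℝ, 0 ≤ t' → |t' - t| ≤ δ →
    ∀ r : ℝ, 0 ≤ r → ‖u r t' - u r t‖ ≤ ε) ∧
  (∀ t > (0:ℝ), ∀ r > (0:ℝ),
    DifferentiableAt ℝ (fun s => u s t) r ∧ DifferentiableAt ℝ (fun s => ur u s t) r) ∧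
  (∀ t > (0:ℝ), ∀ r : ℝ, 0 ≤ r → DifferentiableAt ℝ (fun s => u r s) t) ∧
  (∀ t > (0:ℝ), ∀ r > (0:ℝ),
    ut u r t = -gradient V (u r t) + (((d : ℝ) - 1) / r) • ur u r t + urr u r t) ∧
  (∀ t > (0:ℝ), DifferentiableAt ℝ (fun s => u s t) 0 ∧ ur u 0 t = 0)

/-! ### The potential -/

section Potential

variable {V : Euc n → ℝ}

lemma contDiff_gradient (hV : ContDiff ℝ 2 V) : ContDiff ℝ 1 (gradient V) := by
  have h : ContDiff ℝ 1 (fderiv ℝ V) := hV.fderiv_right (by norm_num)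
  exact (InnerProductSpace.toDual ℝ (Euc n)).symm.contDiff.comp h

lemma hasFDerivAt_gradient (hV : ContDiff ℝ 2 V) (x : Euc n) :
    HasFDerivAt (gradient V) (hess V x) x :=
  ((contDiff_gradient hV).differentiable (by norm_num) x).hasFDerivAt

lemma hasGradientAt_of_contDiff (hV : ContDiff ℝ 2 V) (x : Euc n) :
    HasGradientAt V (gradient V x) x :=
  (hV.differentiable (by norm_num) x).hasGradientAt

lemma hasDerivAt_comp_potential (hV : ContDiff ℝ 2 V) {f : ℝ → Euc n} {f' : Euc n} {t : ℝ}
    (hf : HasDerivAt f f' t) : HasDerivAt (fun s => V (f s)) ⟪gradient V (f t), f'⟫ t := by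
  have h := (hasGradientAt_of_contDiff hV (f t)).hasFDerivAt.comp_hasDerivAt t hf
  exact h.congr_deriv (by rw [InnerProductSpace.toDual_apply_apply])

lemma exists_lipschitz_gradient (hV : ContDiff ℝ 2 V) (C : ℝ) :
    ∃ Λ > (0:ℝ), ∀ x y : Euc n, ‖x‖ ≤ C → ‖y‖ ≤ C →
      ‖gradient V x - gradient V y‖ ≤ Λ * ‖x - y‖ := by
  have hc : Continuous (fun x => hess V x) :=
    (contDiff_gradient hV).continuous_fderiv (by norm_num)
  obtain ⟨Λ, hΛ⟩ := (isCompact_closedBall (0 : Euc n) C).exists_bound_of_continuousOn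
    hc.continuousOn
  refine ⟨max Λ 1, by positivity, fun x y hx hy => ?_⟩
  refine (convex_closedBall (0 : Euc n) C).norm_image_sub_le_of_norm_hasFDerivWithin_le
    (f := gradient V) (f' := fun x => hess V x)
    (fun z _ => (hasFDerivAt_gradient hV z).hasFDerivWithinAt)
    (fun z hz => (hΛ z hz).trans (le_max_left _ _)) ?_ ?_ <;> simpa

/-- A function whose gradient is quadratically bounded along a segment. -/
lemma potential_segment_le (hV : ContDiff ℝ 2 V) (m x : Euc n) (Λ : ℝ)
    (h : ∀ s ∈ Icc (0:ℝ) 1, ‖gradient V (m + s • (x - m))‖ ≤ Λ) :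
    |V x - V m| ≤ Λ * ‖x - m‖ := by
  have hd : ∀ s ∈ Icc (0:ℝ) 1, HasDerivWithinAt (fun s : ℝ => V (m + s • (x - m)))
      ⟪gradient V (m + s • (x - m)), x - m⟫ (Icc 0 1) s := by
    intro s _
    refine (hasDerivAt_comp_potential hV (f := fun s : ℝ => m + s • (x - m)) ?_).hasDerivWithinAt
    simpa using ((hasDerivAt_id s).smul_const (x - m)).const_add m
  have := norm_image_sub_le_of_norm_deriv_le_segment_01' (C := Λ * ‖x - m‖) hd ?_
  · simpa using this
  · intro s hs
    exact (norm_inner_le_norm _ _).trans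
      (mul_le_mul_of_nonneg_right (h s ⟨hs.1, hs.2.le⟩) (norm_nonneg _))

lemma potential_quadratic (hV : ContDiff ℝ 2 V) {m : Euc n} (hm : gradient V m = 0) {C Λ : ℝ}
    (hΛ0 : 0 ≤ Λ) (hmC : ‖m‖ ≤ C)
    (hΛ : ∀ x y : Euc n, ‖x‖ ≤ C → ‖y‖ ≤ C → ‖gradient V x - gradient V y‖ ≤ Λ * ‖x - y‖)
    {x : Euc n} (hx : ‖x‖ ≤ C) : |V x - V m| ≤ Λ * ‖x - m‖ ^ 2 := by
  have := potential_segment_le hV m x (Λ * ‖x - m‖) ?_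
  · calc _ ≤ _ := this
      _ = _ := by ring
  intro s hs
  have hz : ‖m + s • (x - m)‖ ≤ C := by
    have := (convex_closedBall (0 : Euc n) C).add_smul_sub_mem (x := m) (y := x)
      (by simpa) (by simpa) hs
    simpa using this
  have := hΛ _ m hz hmC
  rw [hm, sub_zero] at this
  refine this.trans ?_
  rw [add_sub_cancel_left, norm_smul, Real.norm_of_nonneg hs.1]
  have := norm_nonneg (x - m)
  have : s * ‖x - m‖ ≤ 1 * ‖x - m‖ := mul_le_mul_of_nonneg_right hs.2 this
  nlinarith

lemma inner_gradient_ge (hV : ContDiff ℝ 2 V) (D : EscData n V) (h0 : (0 : Euc n) ∈ MinSet V)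
    {x : Euc n} (hx : ‖x‖ ≤ D.dEsc) : D.lmin / 2 * ‖x‖ ^ 2 ≤ ⟪x, gradient V x⟫ := by
  have hd : ∀ s : ℝ, HasDerivAt (fun s : ℝ => ⟪x, gradient V (s • x)⟫ - s * (D.lmin / 2 * ‖x‖ ^ 2))
      (⟪x, hess V (s • x) x⟫ - D.lmin / 2 * ‖x‖ ^ 2) s := by
    intro s
    have h1 : HasDerivAt (fun s : ℝ => s • x) x s := by
      simpa using (hasDerivAt_id s).smul_const x
    have h2 := (hasFDerivAt_gradient hV (s • x)).comp_hasDerivAt s h1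
    have h3 := (hasDerivAt_const s x).inner ℝ h2
    have h4 := (hasDerivAt_id s).mul_const (D.lmin / 2 * ‖x‖ ^ 2)
    exact (h3.sub h4).congr_deriv (by rw [inner_zero_left, add_zero, one_mul])
  have hmono : MonotoneOn
      (fun s : ℝ => ⟪x, gradient V (s • x)⟫ - s * (D.lmin / 2 * ‖x‖ ^ 2)) (Icc 0 1) := by
    refine monotoneOn_of_deriv_nonneg (convex_Icc 0 1)
      (fun s _ => (hd s).continuousAt.continuousWithinAt)
      (fun s _ => (hd s).differentiableAt.differentiableWithinAt) ?_
    intro s hs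
    rw [interior_Icc] at hs
    rw [(hd s).deriv, sub_nonneg]
    refine D.esc_lower 0 h0 _ ?_ x
    rw [sub_zero, norm_smul, Real.norm_of_nonneg hs.1.le]
    nlinarith [norm_nonneg x, hs.2]
  have := hmono (left_mem_Icc.2 zero_le_one) (right_mem_Icc.2 zero_le_one) zero_le_one
  have hg : gradient V 0 = 0 := h0.1
  simp only [zero_smul, hg, inner_zero_right, zero_mul, sub_zero, one_smul, one_mul] at this
  linarith

lemma potential_nonneg_of_le (hV : ContDiff ℝ 2 V) (D : EscData n V)
    (h0 : (0 : Euc n) ∈ MinSet V) (hV0 : V 0 = 0) {x : Euc n} (hx : ‖x‖ ≤ D.dEsc) : 0 ≤ V x := by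
  have hd : ∀ s : ℝ, HasDerivAt (fun s : ℝ => V (s • x)) ⟪gradient V (s • x), x⟫ s := by
    intro s
    refine hasDerivAt_comp_potential hV (f := fun s : ℝ => s • x) ?_
    simpa using (hasDerivAt_id s).smul_const x
  have hmono : MonotoneOn (fun s : ℝ => V (s • x)) (Icc 0 1) := by
    refine monotoneOn_of_deriv_nonneg (convex_Icc 0 1)
      (fun s _ => (hd s).continuousAt.continuousWithinAt)
      (fun s _ => (hd s).differentiableAt.differentiableWithinAt) ?_
    intro s hs
    rw [interior_Icc] at hs
    rw [(hd s).deriv]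
    have hle : ‖s • x‖ ≤ D.dEsc := by
      rw [norm_smul, Real.norm_of_nonneg hs.1.le]
      nlinarith [norm_nonneg x, hs.2]
    have h1 := inner_gradient_ge hV D h0 hle
    have h2 : 0 ≤ s * ⟪gradient V (s • x), x⟫ := by
      have : ⟪s • x, gradient V (s • x)⟫ = s * ⟪gradient V (s • x), x⟫ := by
        rw [real_inner_smul_left, real_inner_comm]
      rw [← this]
      exact le_trans (by have := D.lmin_pos; positivity) h1
    exact nonneg_of_mul_nonneg_right h2 hs.1
  have := hmono (left_mem_Icc.2 zero_le_one) (right_mem_Icc.2 zero_le_one) zero_le_one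
  simpa [hV0] using this

lemma exists_potential_lower_bound (hV : ContDiff ℝ 2 V) (hc : HCoerc V) :
    ∃ A : ℝ, ∀ x : Euc n, A ≤ V x := by
  obtain ⟨ε, hε, R, hR⟩ := hc
  set R' := max R 1
  obtain ⟨A, hA⟩ := (isCompact_closedBall (0 : Euc n) R').exists_bound_of_continuousOn
    hV.continuous.continuousOn
  have hball : ∀ x : Euc n, ‖x‖ ≤ R' → -A ≤ V x := fun x hx => by
    have := hA x (by simpa using hx)
    rw [Real.norm_eq_abs] at this
    exact (abs_le.1 this).1
  refine ⟨-A, fun x => ?_⟩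
  by_cases hx : ‖x‖ ≤ R'
  · exact hball x hx
  push Not at hx
  have hR'1 : 1 ≤ R' := le_max_right _ _
  have hxpos : 0 < ‖x‖ := by linarith
  have hd : ∀ s : ℝ, HasDerivAt (fun s : ℝ => V (s • x)) ⟪gradient V (s • x), x⟫ s := by
    intro s
    refine hasDerivAt_comp_potential hV (f := fun s : ℝ => s • x) ?_
    simpa using (hasDerivAt_id s).smul_const x
  have hq : R' / ‖x‖ ≤ 1 := by rw [div_le_one hxpos]; exact hx.le
  have hq0 : 0 < R' / ‖x‖ := by positivity
  have hmono : MonotoneOn (fun s : ℝ => V (s • x)) (Icc (R' / ‖x‖) 1) := by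
    refine monotoneOn_of_deriv_nonneg (convex_Icc _ 1)
      (fun s _ => (hd s).continuousAt.continuousWithinAt)
      (fun s _ => (hd s).differentiableAt.differentiableWithinAt) ?_
    intro s hs
    rw [interior_Icc] at hs
    rw [(hd s).deriv]
    have hs0 : 0 < s := hq0.trans hs.1
    have hle : R ≤ ‖s • x‖ := by
      rw [norm_smul, Real.norm_of_nonneg hs0.le]
      have := hs.1
      rw [div_lt_iff₀ hxpos] at this
      exact (le_max_left _ _).trans this.le
    have h1 := hR _ hle
    have h2 : 0 ≤ s * ⟪gradient V (s • x), x⟫ := by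
      have : ⟪s • x, gradient V (s • x)⟫ = s * ⟪gradient V (s • x), x⟫ := by
        rw [real_inner_smul_left, real_inner_comm]
      rw [← this]
      exact le_trans (by positivity) h1
    exact nonneg_of_mul_nonneg_right h2 hs0
  have h1 := hmono (left_mem_Icc.2 hq) (right_mem_Icc.2 hq) hq
  simp only [one_smul] at h1
  refine (hball _ ?_).trans h1
  rw [norm_smul, Real.norm_of_nonneg hq0.le, div_mul_cancel₀ _ hxpos.ne']

lemma bddBelow_qHull (hV : ContDiff ℝ 2 V) (hc : HCoerc V) :
    BddBelow {q : ℝ | ∃ m ∈ MinSet V, ∃ x : Euc n, x ≠ m ∧ q = (V x - V m) / ‖x - m‖ ^ 2} := by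
  obtain ⟨A, hA⟩ := exists_potential_lower_bound hV hc
  obtain ⟨ε, hε, R, hR⟩ := hc
  set R' := max R 1
  have hR'1 : 1 ≤ R' := le_max_right _ _
  have hm : ∀ m ∈ MinSet V, ‖m‖ ≤ R' := by
    intro m hm
    by_contra h
    push Not at h
    have := hR m ((le_max_left _ _).trans h.le)
    rw [hm.1, inner_zero_right] at this
    have : 0 < ε * ‖m‖ ^ 2 := by
      have : 0 < ‖m‖ := by linarith
      positivity
    linarith
  obtain ⟨B, hB⟩ := (isCompact_closedBall (0 : Euc n) R').exists_bound_of_continuousOn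
    hV.continuous.continuousOn
  obtain ⟨Λ, hΛ0, hΛ⟩ := exists_lipschitz_gradient hV (R' + 1)
  refine ⟨min (-Λ) (-(|A| + B)), ?_⟩
  rintro q ⟨m, hmm, x, hx, rfl⟩
  have hpos : 0 < ‖x - m‖ := norm_pos_iff.2 (sub_ne_zero.2 hx)
  rw [le_div_iff₀ (by positivity)]
  have hmR := hm m hmm
  by_cases h : ‖x - m‖ ≤ 1
  · have hxR : ‖x‖ ≤ R' + 1 := by
      have : ‖x‖ ≤ ‖x - m‖ + ‖m‖ := by simpa using norm_add_le (x - m) m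
      linarith
    have h1 := potential_quadratic hV hmm.1 hΛ0.le (by linarith) hΛ hxR
    have h2 := (abs_le.1 h1).1
    have h3 : min (-Λ) (-(|A| + B)) ≤ -Λ := min_le_left _ _
    nlinarith [sq_nonneg ‖x - m‖]
  · push Not at h
    have h3 : min (-Λ) (-(|A| + B)) ≤ -(|A| + B) := min_le_right _ _
    have h4 := hB m (by simpa using hmR)
    rw [Real.norm_eq_abs] at h4
    have h5 := (abs_le.1 h4).2
    have h6 := hA x
    have h7 := neg_abs_le A
    have hB0 : 0 ≤ B := (abs_nonneg _).trans h4
    have h8 : 1 ≤ ‖x - m‖ ^ 2 := by nlinarith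
    have : 0 ≤ |A| := abs_nonneg A
    nlinarith

lemma wV_pos : 0 < wV V := by
  unfold wV
  have : (1:ℝ) ≤ max 1 (-(4 * qHull V)) := le_max_left _ _
  positivity

lemma wV_potential_add_nonneg (hV : ContDiff ℝ 2 V) (hc : HCoerc V)
    (h0 : (0 : Euc n) ∈ MinSet V) (hV0 : V 0 = 0) (x : Euc n) :
    0 ≤ wV V * V x + ‖x‖ ^ 2 / 4 := by
  have hM : (1:ℝ) ≤ max 1 (-(4 * qHull V)) := le_max_left _ _
  have hq : qHull V * ‖x‖ ^ 2 ≤ V x := by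
    by_cases hx : x = 0
    · simp [hx, hV0]
    have hpos : 0 < ‖x‖ := norm_pos_iff.2 hx
    have : qHull V ≤ (V x - V 0) / ‖x - 0‖ ^ 2 :=
      csInf_le (bddBelow_qHull hV hc) ⟨0, h0, x, hx, rfl⟩
    rw [sub_zero, hV0, sub_zero, le_div_iff₀ (by positivity)] at this
    exact this
  have h2 : -(4 * qHull V) ≤ max 1 (-(4 * qHull V)) := le_max_right _ _
  have h3 : -(max 1 (-(4 * qHull V)) / 4) * ‖x‖ ^ 2 ≤ V x := by
    refine le_trans ?_ hq
    exact mul_le_mul_of_nonneg_right (by linarith) (sq_nonneg _)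
  have h4 := mul_le_mul_of_nonneg_left h3 (wV_pos (V := V)).le
  have h5 : wV V * max 1 (-(4 * qHull V)) = 1 := by
    unfold wV; field_simp
  nlinarith

end Potential


/-! ### Regularity of bounded radial solutions -/

/-- A radial solution together with explicit bounds for the solution, its derivatives and the
Lipschitz constant of the gradient of the potential on the range of the solution. -/
structure SolBound (d : ℕ) (V : Euc n → ℝ) (u : ℝ → ℝ → Euc n) (C Λ : ℝ) : Prop where
  sol : IsRadialSolution d V u
  contDiff : ContDiff ℝ 2 V
  grad0 : gradient V 0 = 0
  pot0 : V 0 = 0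
  one_le_C : 1 ≤ C
  Λ_pos : 0 < Λ
  one_le_d : 1 ≤ d
  bu : ∀ r t : ℝ, 0 ≤ r → 0 < t → ‖u r t‖ ≤ C
  bur : ∀ r t : ℝ, 0 ≤ r → 0 < t → ‖ur u r t‖ ≤ C
  burr : ∀ r t : ℝ, 0 ≤ r → 0 < t → ‖urr u r t‖ ≤ C
  but : ∀ r t : ℝ, 0 ≤ r → 0 < t → ‖ut u r t‖ ≤ C
  lip : ∀ x y : Euc n, ‖x‖ ≤ C → ‖y‖ ≤ C → ‖gradient V x - gradient V y‖ ≤ Λ * ‖x - y‖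

lemma IsRadialSolution.exists_solBound {d : ℕ} {V : Euc n → ℝ} {u : ℝ → ℝ → Euc n}
    (hu : IsRadialSolution d V u) (hd : 1 ≤ d) (hV : ContDiff ℝ 2 V)
    (h0 : gradient V 0 = 0) (hV0 : V 0 = 0) : ∃ C Λ : ℝ, SolBound d V u C Λ := by
  obtain ⟨C, hC⟩ := hu.bounded
  obtain ⟨Λ, hΛ, hl⟩ := exists_lipschitz_gradient hV (max C 1)
  refine ⟨max C 1, Λ, hu, hV, h0, hV0, le_max_right _ _, hΛ, hd, ?_, ?_, ?_, ?_, hl⟩ <;>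
  · intro r t hr ht
    have := hC r t hr ht
    have h1 := norm_nonneg (u r t)
    have h2 := norm_nonneg (ur u r t)
    have h3 := norm_nonneg (urr u r t)
    have h4 := norm_nonneg (ut u r t)
    exact le_trans (by linarith) (le_max_left _ _)

namespace SolBound

variable {d : ℕ} {V : Euc n → ℝ} {u : ℝ → ℝ → Euc n} {C Λ : ℝ}

lemma C_pos (h : SolBound d V u C Λ) : 0 < C := zero_lt_one.trans_le h.one_le_C

lemma hasDerivAt_r (h : SolBound d V u C Λ) {t : ℝ} (ht : 0 < t) (r : ℝ) :
    HasDerivAt (fun s => u s t) (ur u r t) r := (h.sol.diff_r t ht r).hasDerivAt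

lemma hasDerivAt_rr (h : SolBound d V u C Λ) {t : ℝ} (ht : 0 < t) (r : ℝ) :
    HasDerivAt (fun s => ur u s t) (urr u r t) r := (h.sol.diff_rr t ht r).hasDerivAt

lemma hasDerivAt_t (h : SolBound d V u C Λ) {t : ℝ} (ht : 0 < t) (r : ℝ) :
    HasDerivAt (fun s => u r s) (ut u r t) t := (h.sol.diff_t t ht r).hasDerivAt

lemma continuous_u (h : SolBound d V u C Λ) {t : ℝ} (ht : 0 < t) :
    Continuous (fun r => u r t) :=
  continuous_iff_continuousAt.2 fun r => (h.hasDerivAt_r ht r).continuousAt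

lemma continuous_ur (h : SolBound d V u C Λ) {t : ℝ} (ht : 0 < t) :
    Continuous (fun r => ur u r t) :=
  continuous_iff_continuousAt.2 fun r => (h.hasDerivAt_rr ht r).continuousAt

lemma continuous_grad (h : SolBound d V u C Λ) : Continuous (gradient V) :=
  (contDiff_gradient h.contDiff).continuous

lemma continuous_pot (h : SolBound d V u C Λ) : Continuous V := h.contDiff.continuous

lemma ut_eq (h : SolBound d V u C Λ) {r t : ℝ} (hr : 0 < r) (ht : 0 < t) :
    ut u r t = -gradient V (u r t) + (((d : ℝ) - 1) / r) • ur u r t + urr u r t :=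
  h.sol.pde r hr t ht

lemma continuousOn_ut_r (h : SolBound d V u C Λ) {t : ℝ} (ht : 0 < t) :
    ContinuousOn (fun r => ut u r t) (Ioi 0) := by
  have : ContinuousOn (fun r => -gradient V (u r t) + (((d : ℝ) - 1) / r) • ur u r t + urr u r t)
      (Ioi 0) := by
    refine ((h.continuous_grad.comp (h.continuous_u ht)).neg.continuousOn.add ?_).add
      (h.sol.cont_rr t ht).continuousOn
    have h1 : ContinuousOn (fun r : ℝ => ((d : ℝ) - 1) / r) (Ioi 0) :=
      continuousOn_const.div continuousOn_id fun r hr => ne_of_gt hr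
    exact h1.smul (h.continuous_ur ht).continuousOn
  exact this.congr fun r hr => h.ut_eq hr ht

lemma continuousOn_u_t (h : SolBound d V u C Λ) (r : ℝ) :
    ContinuousOn (fun t => u r t) (Ioi 0) :=
  fun _ ht => (h.hasDerivAt_t ht r).continuousAt.continuousWithinAt

lemma lip_t (h : SolBound d V u C Λ) {r t t' : ℝ} (hr : 0 ≤ r) (ht : 0 < t) (ht' : 0 < t') :
    ‖u r t' - u r t‖ ≤ C * |t' - t| := by
  have := (convex_Ioi (0:ℝ)).norm_image_sub_le_of_norm_hasDerivWithin_le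
    (f := fun s => u r s) (f' := fun s => ut u r s) (C := C)
    (fun s hs => (h.hasDerivAt_t hs r).hasDerivWithinAt)
    (fun s hs => h.but r s hr hs) (mem_Ioi.2 ht) (mem_Ioi.2 ht')
  simpa using this

lemma lip_r (h : SolBound d V u C Λ) {r r' t : ℝ} (hr : 0 ≤ r) (hr' : 0 ≤ r') (ht : 0 < t) :
    ‖u r' t - u r t‖ ≤ C * |r' - r| := by
  have := (convex_Ici (0:ℝ)).norm_image_sub_le_of_norm_hasDerivWithin_le
    (f := fun s => u s t) (f' := fun s => ur u s t) (C := C)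
    (fun s _ => (h.hasDerivAt_r ht s).hasDerivWithinAt)
    (fun s hs => h.bur s t hs ht) (mem_Ici.2 hr) (mem_Ici.2 hr')
  simpa using this

lemma lip_ur (h : SolBound d V u C Λ) {r r' t : ℝ} (hr : 0 ≤ r) (hr' : 0 ≤ r') (ht : 0 < t) :
    ‖ur u r' t - ur u r t‖ ≤ C * |r' - r| := by
  have := (convex_Ici (0:ℝ)).norm_image_sub_le_of_norm_hasDerivWithin_le
    (f := fun s => ur u s t) (f' := fun s => urr u s t) (C := C)
    (fun s _ => (h.hasDerivAt_rr ht s).hasDerivWithinAt)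
    (fun s hs => h.burr s t hs ht) (mem_Ici.2 hr) (mem_Ici.2 hr')
  simpa using this

lemma taylor_u (h : SolBound d V u C Λ) {r r' t : ℝ} (hr : 0 ≤ r) (hr' : 0 ≤ r') (ht : 0 < t) :
    ‖u r' t - u r t - (r' - r) • ur u r t‖ ≤ C * |r' - r| ^ 2 := by
  have hsub : uIcc r r' ⊆ Ici 0 := fun x hx => (le_min hr hr').trans hx.1
  have := (convex_uIcc r r').norm_image_sub_le_of_norm_hasDerivWithin_le
    (f := fun s => u s t - s • ur u r t) (f' := fun s => ur u s t - ur u r t)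
    (C := C * |r' - r|)
    (fun s _ => by
      have h1 := (h.hasDerivAt_r ht s).sub ((hasDerivAt_id s).smul_const (ur u r t))
      exact (h1.congr_deriv (by rw [one_smul])).hasDerivWithinAt)
    (fun s hs => by
      refine (h.lip_ur hr (hsub hs) ht).trans ?_
      exact mul_le_mul_of_nonneg_left (abs_sub_left_of_mem_uIcc hs) h.C_pos.le)
    left_mem_uIcc right_mem_uIcc
  calc _ = ‖u r' t - r' • ur u r t - (u r t - r • ur u r t)‖ := by
        congr 1; rw [sub_smul]; abel
    _ ≤ _ := this
    _ = _ := by rw [Real.norm_eq_abs]; ring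

lemma ur_sub_le (h : SolBound d V u C Λ) {r t t' : ℝ} (hr : 0 ≤ r) (ht : 0 < t) (ht' : 0 < t') :
    ‖ur u r t' - ur u r t‖ ≤ 4 * C * √|t' - t| := by
  rcases eq_or_lt_of_le (abs_nonneg (t' - t)) with h0 | hpos
  · have : t' = t := by rw [eq_comm, abs_eq_zero, sub_eq_zero] at h0; exact h0
    simp [this]
  set η := √|t' - t|
  have hη : 0 < η := Real.sqrt_pos.2 hpos
  have hη2 : η ^ 2 = |t' - t| := Real.sq_sqrt hpos.le
  have h1 := h.taylor_u hr (add_nonneg hr hη.le) ht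
  have h2 := h.taylor_u hr (add_nonneg hr hη.le) ht'
  have h3 := h.lip_t hr ht ht'
  have h4 := h.lip_t (add_nonneg hr hη.le) ht ht'
  rw [add_sub_cancel_left, abs_of_pos hη] at h1 h2
  rw [← hη2] at h3 h4
  have key : η • (ur u r t' - ur u r t) =
      (u (r + η) t - u r t - η • ur u r t) - (u (r + η) t' - u r t' - η • ur u r t')
      + (u (r + η) t' - u (r + η) t) - (u r t' - u r t) := by
    rw [smul_sub]; abel
  have h5 : ‖η • (ur u r t' - ur u r t)‖ ≤ C * η ^ 2 + C * η ^ 2 + C * η ^ 2 + C * η ^ 2 := by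
    rw [key]
    exact (norm_sub_le _ _).trans (add_le_add ((norm_add_le _ _).trans
      (add_le_add ((norm_sub_le _ _).trans (add_le_add h1 h2)) h4)) h3)
  rw [norm_smul, Real.norm_of_nonneg hη.le] at h5
  refine le_of_mul_le_mul_left ?_ hη
  linarith [h5]

lemma continuousOn_ur_t (h : SolBound d V u C Λ) {r : ℝ} (hr : 0 ≤ r) :
    ContinuousOn (fun t => ur u r t) (Ioi 0) := by
  intro t ht
  rw [ContinuousWithinAt, tendsto_iff_norm_sub_tendsto_zero]
  have hlim : Tendsto (fun s => 4 * C * √|s - t|) (𝓝[Ioi 0] t) (𝓝 0) := by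
    have : Continuous (fun s : ℝ => 4 * C * √|s - t|) := by fun_prop
    have := this.tendsto t
    simp only [sub_self, abs_zero, Real.sqrt_zero, mul_zero] at this
    exact this.mono_left nhdsWithin_le_nhds
  refine squeeze_zero' (Eventually.of_forall fun _ => norm_nonneg _) ?_ hlim
  filter_upwards [self_mem_nhdsWithin] with s hs
  exact h.ur_sub_le hr ht hs

lemma pot_le (h : SolBound d V u C Λ) {x : Euc n} (hx : ‖x‖ ≤ C) : |V x| ≤ Λ * ‖x‖ ^ 2 := by
  simpa [h.pot0] using potential_quadratic h.contDiff h.grad0 h.Λ_pos.le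
    (by simpa using h.C_pos.le) h.lip hx

lemma grad_le (h : SolBound d V u C Λ) {x : Euc n} (hx : ‖x‖ ≤ C) : ‖gradient V x‖ ≤ Λ * ‖x‖ := by
  have := h.lip x 0 hx (by simpa using h.C_pos.le)
  simpa [h.grad0] using this

end SolBound


/-! ### Derivatives of weighted energies on a fixed interval -/

/-- A smooth weight together with its partial derivatives. -/
structure IsWeight (g gr gt : ℝ → ℝ → ℝ) : Prop where
  cont : Continuous fun p : ℝ × ℝ => g p.1 p.2
  cont_r : Continuous fun p : ℝ × ℝ => gr p.1 p.2
  cont_t : Continuous fun p : ℝ × ℝ => gt p.1 p.2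
  deriv_r : ∀ r t, HasDerivAt (fun s => g s t) (gr r t) r
  deriv_t : ∀ r t, HasDerivAt (fun s => g r s) (gt r t) t

namespace IsWeight

variable {g gr gt : ℝ → ℝ → ℝ}

lemma cont_left (hg : IsWeight g gr gt) (t : ℝ) : Continuous fun r => g r t :=
  hg.cont.comp (by fun_prop : Continuous fun r : ℝ => (r, t))

lemma cont_r_left (hg : IsWeight g gr gt) (t : ℝ) : Continuous fun r => gr r t :=
  hg.cont_r.comp (by fun_prop : Continuous fun r : ℝ => (r, t))

lemma cont_t_left (hg : IsWeight g gr gt) (t : ℝ) : Continuous fun r => gt r t :=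
  hg.cont_t.comp (by fun_prop : Continuous fun r : ℝ => (r, t))

lemma cont_right (hg : IsWeight g gr gt) (r : ℝ) : Continuous fun t => g r t :=
  hg.cont.comp (by fun_prop : Continuous fun t : ℝ => (r, t))

/-- Uniform bounds for a weight on a compact rectangle. -/
lemma exists_bound (hg : IsWeight g gr gt) (ℓ B t₁ t₂ : ℝ) :
    ∃ M > (0:ℝ), ∀ r ∈ Icc ℓ B, ∀ t ∈ Icc t₁ t₂, |g r t| ≤ M ∧ |gr r t| ≤ M ∧ |gt r t| ≤ M := by
  have hK : IsCompact (Icc ℓ B ×ˢ Icc t₁ t₂) := isCompact_Icc.prod isCompact_Icc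
  obtain ⟨M₁, h₁⟩ := hK.exists_bound_of_continuousOn hg.cont.continuousOn
  obtain ⟨M₂, h₂⟩ := hK.exists_bound_of_continuousOn hg.cont_r.continuousOn
  obtain ⟨M₃, h₃⟩ := hK.exists_bound_of_continuousOn hg.cont_t.continuousOn
  refine ⟨max (max M₁ M₂) (max M₃ 1), by positivity, fun r hr t ht => ⟨?_, ?_, ?_⟩⟩
  · exact (h₁ (r, t) ⟨hr, ht⟩).trans ((le_max_left _ _).trans (le_max_left _ _))
  · exact (h₂ (r, t) ⟨hr, ht⟩).trans ((le_max_right _ _).trans (le_max_left _ _))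
  · exact (h₃ (r, t) ⟨hr, ht⟩).trans ((le_max_left _ _).trans (le_max_right _ _))

end IsWeight

lemma tendsto_nhds_congr {α : Type*} {f : α → ℝ} {l : Filter α} {x y : ℝ}
    (hf : Tendsto f l (𝓝 x)) (hxy : x = y) : Tendsto f l (𝓝 y) := hxy ▸ hf

/-- The energy density. -/
def eDen (V : Euc n → ℝ) (u : ℝ → ℝ → Euc n) (r t : ℝ) : ℝ := ‖ur u r t‖ ^ 2 / 2 + V (u r t)

namespace SolBound

variable {d : ℕ} {V : Euc n → ℝ} {u : ℝ → ℝ → Euc n} {C Λ : ℝ}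

lemma continuous_eDen (h : SolBound d V u C Λ) {t : ℝ} (ht : 0 < t) :
    Continuous fun r => eDen V u r t := by
  unfold eDen
  exact (((h.continuous_ur ht).norm.pow 2).div_const 2).add
    (h.continuous_pot.comp (h.continuous_u ht))

lemma continuousOn_eDen_t (h : SolBound d V u C Λ) {r : ℝ} (hr : 0 ≤ r) :
    ContinuousOn (fun t => eDen V u r t) (Ioi 0) := by
  unfold eDen
  exact (((h.continuousOn_ur_t hr).norm.pow 2).div_const 2).add
    (h.continuous_pot.comp_continuousOn (h.continuousOn_u_t r))

lemma eDen_le (h : SolBound d V u C Λ) {r t : ℝ} (hr : 0 ≤ r) (ht : 0 < t) :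
    |eDen V u r t| ≤ ‖ur u r t‖ ^ 2 / 2 + Λ * ‖u r t‖ ^ 2 := by
  unfold eDen
  refine (abs_add_le _ _).trans (add_le_add ?_ (h.pot_le (h.bu r t hr ht)))
  rw [abs_of_nonneg (by positivity)]

lemma eDen_bdd (h : SolBound d V u C Λ) {r t : ℝ} (hr : 0 ≤ r) (ht : 0 < t) :
    |eDen V u r t| ≤ (1 + Λ) * C ^ 2 := by
  refine (h.eDen_le hr ht).trans ?_
  have h1 := h.bur r t hr ht
  have h2 := h.bu r t hr ht
  have h3 : ‖ur u r t‖ ^ 2 ≤ C ^ 2 := pow_le_pow_left₀ (norm_nonneg _) h1 2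
  have h4 : ‖u r t‖ ^ 2 ≤ C ^ 2 := pow_le_pow_left₀ (norm_nonneg _) h2 2
  nlinarith [h.Λ_pos, sq_nonneg C]

lemma continuousOn_urr_t (h : SolBound d V u C Λ) {r : ℝ} (hr : 0 < r) :
    ContinuousOn (fun t => urr u r t) (Ioi 0) := by
  have : ContinuousOn (fun t => ut u r t + gradient V (u r t) - (((d : ℝ) - 1) / r) • ur u r t)
      (Ioi 0) := by
    exact ((h.sol.cont_t r).add
      (h.continuous_grad.comp_continuousOn (h.continuousOn_u_t r))).sub
      ((h.continuousOn_ur_t hr.le).const_smul (((d : ℝ) - 1) / r))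
  refine this.congr fun t ht => ?_
  simp only [h.ut_eq hr ht]; abel

lemma integral_inner_deriv {f f' k k' : ℝ → Euc n} {g g' : ℝ → ℝ} {ℓ B : ℝ}
    (hf : ∀ r, HasDerivAt f (f' r) r) (hk : ∀ r, HasDerivAt k (k' r) r)
    (hg : ∀ r, HasDerivAt g (g' r) r) (cf' : Continuous f') (ck' : Continuous k')
    (cg' : Continuous g') :
    ∫ r in ℓ..B, g r * ⟪f r, k' r⟫ = g B * ⟪f B, k B⟫ - g ℓ * ⟪f ℓ, k ℓ⟫ -
      ∫ r in ℓ..B, (g' r * ⟪f r, k r⟫ + g r * ⟪f' r, k r⟫) := by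
  have cf : Continuous f := continuous_iff_continuousAt.2 fun r => (hf r).continuousAt
  have ck : Continuous k := continuous_iff_continuousAt.2 fun r => (hk r).continuousAt
  have cg : Continuous g := continuous_iff_continuousAt.2 fun r => (hg r).continuousAt
  have h1 : ∀ r ∈ uIcc ℓ B, HasDerivAt (fun r => g r * ⟪f r, k r⟫)
      ((g' r * ⟪f r, k r⟫ + g r * ⟪f' r, k r⟫) + g r * ⟪f r, k' r⟫) r := fun r _ =>
    ((hg r).mul ((hf r).inner ℝ (hk r))).congr_deriv (by ring)
  have c1 : Continuous fun r => g' r * ⟪f r, k r⟫ + g r * ⟪f' r, k r⟫ := by fun_prop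
  have c2 : Continuous fun r => g r * ⟪f r, k' r⟫ := by fun_prop
  have h2 := intervalIntegral.integral_eq_sub_of_hasDerivAt h1 ((c1.add c2).intervalIntegrable _ _)
  rw [intervalIntegral.integral_add (c1.intervalIntegrable _ _) (c2.intervalIntegrable _ _)] at h2
  linarith

/-- Expansion of the increment in time of a weighted energy. -/
lemma energy_increment (h : SolBound d V u C Λ) {g gr gt : ℝ → ℝ → ℝ} (hg : IsWeight g gr gt)
    (ℓ B : ℝ) {t t' : ℝ} (ht : 0 < t) (ht' : 0 < t') :
    (∫ r in ℓ..B, g r t' * eDen V u r t') - (∫ r in ℓ..B, g r t * eDen V u r t) =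
    (∫ r in ℓ..B, ((g r t' - g r t) * eDen V u r t' + g r t * (V (u r t') - V (u r t))
      - (gr r t * ⟪ur u r t' + ur u r t, u r t' - u r t⟫
        + g r t * ⟪urr u r t' + urr u r t, u r t' - u r t⟫) / 2)) +
    (g B t * ⟪ur u B t' + ur u B t, u B t' - u B t⟫
      - g ℓ t * ⟪ur u ℓ t' + ur u ℓ t, u ℓ t' - u ℓ t⟫) / 2 := by
  have key := integral_inner_deriv (ℓ := ℓ) (B := B)
    (f := fun r => ur u r t' + ur u r t) (f' := fun r => urr u r t' + urr u r t)
    (k := fun r => u r t' - u r t) (k' := fun r => ur u r t' - ur u r t)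
    (g := fun r => g r t) (g' := fun r => gr r t)
    (fun r => (h.hasDerivAt_rr ht' r).add (h.hasDerivAt_rr ht r))
    (fun r => (h.hasDerivAt_r ht' r).sub (h.hasDerivAt_r ht r))
    (fun r => hg.deriv_r r t)
    ((h.sol.cont_rr t' ht').add (h.sol.cont_rr t ht))
    ((h.continuous_ur ht').sub (h.continuous_ur ht))
    (hg.cont_r_left t)
  have a1 := h.continuous_u ht
  have a2 := h.continuous_u ht'
  have a3 := h.continuous_ur ht
  have a4 := h.continuous_ur ht'
  have a5 := h.sol.cont_rr t ht
  have a6 := h.sol.cont_rr t' ht'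
  have a7 := h.continuous_eDen ht
  have a8 := h.continuous_eDen ht'
  have a9 := hg.cont_left t
  have a10 := hg.cont_left t'
  have a11 := hg.cont_r_left t
  have a12 := h.continuous_pot
  have c1 : Continuous fun r => (g r t' - g r t) * eDen V u r t' +
      g r t * (V (u r t') - V (u r t)) := by fun_prop
  have c2 : Continuous fun r => (gr r t * ⟪ur u r t' + ur u r t, u r t' - u r t⟫
        + g r t * ⟪urr u r t' + urr u r t, u r t' - u r t⟫) := by fun_prop
  have c3 : Continuous fun r => g r t * ⟪ur u r t' + ur u r t, ur u r t' - ur u r t⟫ := by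
    fun_prop
  rw [intervalIntegral.integral_sub (c1.intervalIntegrable _ _)
    ((c2.div_const 2).intervalIntegrable _ _), intervalIntegral.integral_div]
  have c4 : Continuous fun r => g r t' * eDen V u r t' := a10.mul a8
  have c5 : Continuous fun r => g r t * eDen V u r t := a9.mul a7
  rw [← intervalIntegral.integral_sub (c4.intervalIntegrable _ _) (c5.intervalIntegrable _ _)]
  have e1 : ∀ r, g r t' * eDen V u r t' - g r t * eDen V u r t =
      ((g r t' - g r t) * eDen V u r t' + g r t * (V (u r t') - V (u r t))) +
      (g r t * ⟪ur u r t' + ur u r t, ur u r t' - ur u r t⟫) / 2 := by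
    intro r
    have : ⟪ur u r t' + ur u r t, ur u r t' - ur u r t⟫ = ‖ur u r t'‖ ^ 2 - ‖ur u r t‖ ^ 2 := by
      rw [inner_add_left, inner_sub_right, inner_sub_right, real_inner_self_eq_norm_sq,
        real_inner_self_eq_norm_sq, real_inner_comm (ur u r t) (ur u r t')]
      ring
    rw [this]; unfold eDen; ring
  simp_rw [e1]
  rw [intervalIntegral.integral_add (c1.intervalIntegrable _ _)
    ((c3.div_const 2).intervalIntegrable _ _), intervalIntegral.integral_div, key]
  ring

/-- The derivative in time of a weighted energy on a fixed interval. -/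
lemma hasDerivAt_energy (h : SolBound d V u C Λ) {g gr gt : ℝ → ℝ → ℝ} (hg : IsWeight g gr gt)
    {ℓ B : ℝ} (hℓ : 0 < ℓ) (hB : ℓ ≤ B) {t : ℝ} (ht : 0 < t) :
    HasDerivAt (fun t => ∫ r in ℓ..B, g r t * eDen V u r t)
      ((∫ r in ℓ..B, (gt r t * eDen V u r t - gr r t * ⟪ur u r t, ut u r t⟫
          - g r t * ‖ut u r t‖ ^ 2 + ((d : ℝ) - 1) / r * g r t * ⟪ur u r t, ut u r t⟫)) +
        (g B t * ⟪ur u B t, ut u B t⟫ - g ℓ t * ⟪ur u ℓ t, ut u ℓ t⟫)) t := by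
  rw [hasDerivAt_iff_tendsto_slope]
  have hnb : Ioo (t / 2) (t + 1) ∈ 𝓝 t := Ioo_mem_nhds (by linarith) (by linarith)
  obtain ⟨M, hM, hMb⟩ := hg.exists_bound ℓ B (t / 2) (t + 1)
  have hevt : ∀ᶠ t' in 𝓝[≠] t, t' ∈ Ioo (t / 2) (t + 1) ∧ t' ≠ t :=
    Filter.Eventually.and (mem_nhdsWithin_of_mem_nhds hnb) self_mem_nhdsWithin
  have htt : t ∈ Icc (t / 2) (t + 1) := ⟨by linarith, by linarith⟩
  -- limits of the elementary pieces
  have lu : ∀ r, Tendsto (fun t' => (t' - t)⁻¹ • (u r t' - u r t)) (𝓝[≠] t) (𝓝 (ut u r t)) :=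
    fun r => hasDerivAt_iff_tendsto_slope.1 (h.hasDerivAt_t ht r)
  have lV : ∀ r, Tendsto (fun t' => (t' - t)⁻¹ * (V (u r t') - V (u r t))) (𝓝[≠] t)
      (𝓝 ⟪gradient V (u r t), ut u r t⟫) := fun r =>
    hasDerivAt_iff_tendsto_slope.1 (hasDerivAt_comp_potential h.contDiff (h.hasDerivAt_t ht r))
  have lg : ∀ r, Tendsto (fun t' => (t' - t)⁻¹ * (g r t' - g r t)) (𝓝[≠] t) (𝓝 (gt r t)) :=
    fun r => hasDerivAt_iff_tendsto_slope.1 (hg.deriv_t r t)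
  have hIoi : Ioi (0:ℝ) ∈ 𝓝 t := Ioi_mem_nhds ht
  have lur : ∀ r, 0 < r → Tendsto (fun t' => ur u r t' + ur u r t) (𝓝[≠] t)
      (𝓝 (ur u r t + ur u r t)) := fun r hr =>
    (((h.continuousOn_ur_t hr.le).continuousAt hIoi).mono_left nhdsWithin_le_nhds).add
      tendsto_const_nhds
  have lurr : ∀ r, 0 < r → Tendsto (fun t' => urr u r t' + urr u r t) (𝓝[≠] t)
      (𝓝 (urr u r t + urr u r t)) := fun r hr =>
    (((h.continuousOn_urr_t hr).continuousAt hIoi).mono_left nhdsWithin_le_nhds).add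
      tendsto_const_nhds
  have le : ∀ r, 0 < r → Tendsto (fun t' => eDen V u r t') (𝓝[≠] t) (𝓝 (eDen V u r t)) :=
    fun r hr => ((h.continuousOn_eDen_t hr.le).continuousAt hIoi).mono_left nhdsWithin_le_nhds
  -- the integrand of the increment
  set q : ℝ → ℝ → ℝ := fun t' r => (t' - t)⁻¹ * ((g r t' - g r t) * eDen V u r t'
      + g r t * (V (u r t') - V (u r t))
      - (gr r t * ⟪ur u r t' + ur u r t, u r t' - u r t⟫
        + g r t * ⟪urr u r t' + urr u r t, u r t' - u r t⟫) / 2) with hq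
  set b : ℝ → ℝ → ℝ := fun t' r => (t' - t)⁻¹ *
      (g r t * ⟪ur u r t' + ur u r t, u r t' - u r t⟫) / 2 with hb
  have hslope : (fun t' => (∫ r in ℓ..B, q t' r) + (b t' B - b t' ℓ)) =ᶠ[𝓝[≠] t]
      slope (fun t => ∫ r in ℓ..B, g r t * eDen V u r t) t := by
    filter_upwards [hevt] with t' ht'
    have ht'0 : 0 < t' := by linarith [ht'.1.1]
    rw [slope_def_module, smul_eq_mul, h.energy_increment hg ℓ B ht ht'0, mul_add,
      ← intervalIntegral.integral_const_mul]
    simp only [hb]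
    ring
  refine Tendsto.congr' hslope (Tendsto.add ?_ (Tendsto.sub ?_ ?_))
  · refine intervalIntegral.tendsto_integral_filter_of_dominated_convergence
      (fun _ => M * ((1 + Λ) * C ^ 2) + M * (Λ * C * C) + (M * (2 * C * C) + M * (2 * C * C)) / 2)
      ?_ ?_ (by simp) ?_
    · filter_upwards [hevt] with t' ht'
      have ht'0 : 0 < t' := by linarith [ht'.1.1]
      have a1 := h.continuous_u ht
      have a2 := h.continuous_u ht'0
      have a3 := h.continuous_ur ht
      have a4 := h.continuous_ur ht'0
      have a5 := h.sol.cont_rr t ht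
      have a6 := h.sol.cont_rr t' ht'0
      have a8 := h.continuous_eDen ht'0
      have a9 := hg.cont_left t
      have a10 := hg.cont_left t'
      have a11 := hg.cont_r_left t
      have a12 := h.continuous_pot
      refine Continuous.aestronglyMeasurable ?_
      simp only [hq]
      fun_prop
    · filter_upwards [hevt] with t' ht'
      have ht'0 : 0 < t' := by linarith [ht'.1.1]
      refine Eventually.of_forall fun r hr => ?_
      rw [uIoc_of_le hB] at hr
      have hr0 : 0 ≤ r := hℓ.le.trans hr.1.le
      have hrI : r ∈ Icc ℓ B := ⟨hr.1.le, hr.2⟩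
      obtain ⟨m1, m2, _⟩ := hMb r hrI t htt
      have hpos : 0 < |t' - t| := abs_pos.2 (sub_ne_zero.2 ht'.2)
      have g1 : |g r t' - g r t| ≤ M * |t' - t| := by
        have := (convex_Icc (t / 2) (t + 1)).norm_image_sub_le_of_norm_hasDerivWithin_le
          (f := fun s => g r s) (f' := fun s => gt r s) (C := M)
          (fun s _ => (hg.deriv_t r s).hasDerivWithinAt)
          (fun s hs => (hMb r hrI s hs).2.2) htt (Ioo_subset_Icc_self ht'.1)
        simpa using this
      have e1 := h.eDen_bdd hr0 ht'0
      have u1 := h.lip_t hr0 ht ht'0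
      have v1 : |V (u r t') - V (u r t)| ≤ Λ * C * C * |t' - t| := by
        have := potential_segment_le h.contDiff (u r t) (u r t') (Λ * C) ?_
        · refine this.trans ?_
          have := mul_le_mul_of_nonneg_left u1 (mul_nonneg h.Λ_pos.le h.C_pos.le)
          linarith
        · intro s hs
          have hz : ‖u r t + s • (u r t' - u r t)‖ ≤ C := by
            have := (convex_closedBall (0 : Euc n) C).add_smul_sub_mem (x := u r t) (y := u r t')
              (by simpa using h.bu r t hr0 ht) (by simpa using h.bu r t' hr0 ht'0) hs
            simpa using this
          exact (h.grad_le hz).trans (mul_le_mul_of_nonneg_left hz h.Λ_pos.le)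
      have i1 : |⟪ur u r t' + ur u r t, u r t' - u r t⟫| ≤ 2 * C * C * |t' - t| := by
        refine (abs_real_inner_le_norm _ _).trans ?_
        have : ‖ur u r t' + ur u r t‖ ≤ 2 * C := (norm_add_le _ _).trans
          (by linarith [h.bur r t hr0 ht, h.bur r t' hr0 ht'0])
        calc _ ≤ (2 * C) * (C * |t' - t|) := mul_le_mul this u1 (norm_nonneg _)
              (by linarith [h.C_pos])
          _ = _ := by ring
      have i2 : |⟪urr u r t' + urr u r t, u r t' - u r t⟫| ≤ 2 * C * C * |t' - t| := by
        refine (abs_real_inner_le_norm _ _).trans ?_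
        have : ‖urr u r t' + urr u r t‖ ≤ 2 * C := (norm_add_le _ _).trans
          (by linarith [h.burr r t hr0 ht, h.burr r t' hr0 ht'0])
        calc _ ≤ (2 * C) * (C * |t' - t|) := mul_le_mul this u1 (norm_nonneg _)
              (by linarith [h.C_pos])
          _ = _ := by ring
      have hmul : ∀ x y X Y : ℝ, |x| ≤ X → |y| ≤ Y → |x * y| ≤ X * Y := fun x y X Y hx hy => by
        rw [abs_mul]; exact mul_le_mul hx hy (abs_nonneg _) ((abs_nonneg _).trans hx)
      have b1 := hmul _ _ _ _ g1 e1
      have b2 := hmul _ _ _ _ m1 v1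
      have b3 := hmul _ _ _ _ m2 i1
      have b4 := hmul _ _ _ _ m1 i2
      simp only [hq]
      rw [norm_mul, norm_inv, Real.norm_eq_abs, Real.norm_eq_abs, inv_mul_le_iff₀ hpos]
      rw [abs_le] at b1 b2 b3 b4 ⊢
      constructor <;> linarith [b1.1, b1.2, b2.1, b2.2, b3.1, b3.2, b4.1, b4.2]
    · refine Eventually.of_forall fun r hr => ?_
      rw [uIoc_of_le hB] at hr
      have hr0 : 0 < r := hℓ.trans hr.1
      have l1 := (lg r).mul (le r hr0)
      have l2 := (lV r).const_mul (g r t)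
      have l3 := ((lur r hr0).inner (lu r)).const_mul (gr r t)
      have l4 := ((lurr r hr0).inner (lu r)).const_mul (g r t)
      have l5 := (l1.add l2).sub ((l3.add l4).div_const 2)
      refine tendsto_nhds_congr (l5.congr fun t' => ?_) ?_
      · simp only [hq, real_inner_smul_right]; ring
      · have : urr u r t = ut u r t + gradient V (u r t) - (((d : ℝ) - 1) / r) • ur u r t := by
          rw [h.ut_eq hr0 ht]; abel
        rw [inner_add_left, inner_add_left, this, inner_sub_left, inner_add_left,
          real_inner_smul_left, real_inner_self_eq_norm_sq]
        ring
  · have l3 := (((lur B (hℓ.trans_le hB)).inner (lu B)).const_mul (g B t)).div_const 2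
    refine tendsto_nhds_congr (l3.congr fun t' => ?_) ?_
    · simp only [hb, real_inner_smul_right]; ring
    · rw [inner_add_left]; ring
  · have l3 := (((lur ℓ hℓ).inner (lu ℓ)).const_mul (g ℓ t)).div_const 2
    refine tendsto_nhds_congr (l3.congr fun t' => ?_) ?_
    · simp only [hb, real_inner_smul_right]; ring
    · rw [inner_add_left]; ring

end SolBound


/-! ### Weights in a travelling frame -/

/-- Parameters of a travelling frame: speed `a`, decay rate `κ`, relative speed `β` of the cut-off,
initial position `x` of the cut-off, position `ρ` of the frame at time `τ`. -/
structure Frame where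
  a : ℝ
  κ : ℝ
  β : ℝ
  x : ℝ
  ρ : ℝ
  τ : ℝ

namespace Frame

/-- The position of the cut-off relatively to the frame. -/
def cut (f : Frame) (t : ℝ) : ℝ := f.x + f.β * (t - f.τ)

/-- The position of the origin of the frame. -/
def orig (f : Frame) (t : ℝ) : ℝ := f.ρ + f.a * (t - f.τ)

/-- The signed distance to the cut-off. -/
def dist (f : Frame) (r t : ℝ) : ℝ := r - f.orig t - f.cut t

/-- The sigmoid attached to the cut-off. -/
def sig (f : Frame) (r t : ℝ) : ℝ :=
  Real.exp ((f.a + 2 * f.κ) * f.dist r t) / (1 + Real.exp ((f.a + 2 * f.κ) * f.dist r t))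

/-- The weights: `k = 0` for the energy and `k = κ` for the firewall. -/
def wt (f : Frame) (k r t : ℝ) : ℝ :=
  Real.exp (f.a * (r - f.orig t) + k * f.dist r t) /
    (1 + Real.exp ((f.a + 2 * f.κ) * f.dist r t))

lemma sig_nonneg (f : Frame) (r t : ℝ) : 0 ≤ f.sig r t := by unfold sig; positivity

lemma sig_le_one (f : Frame) (r t : ℝ) : f.sig r t ≤ 1 := by
  unfold sig
  rw [div_le_one (by positivity)]
  linarith

lemma wt_pos (f : Frame) (k r t : ℝ) : 0 < f.wt k r t := by unfold wt; positivity

lemma isWeight_wt (f : Frame) (k : ℝ) : IsWeight (f.wt k)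
    (fun r t => f.wt k r t * (f.a + k - (f.a + 2 * f.κ) * f.sig r t))
    (fun r t => f.wt k r t * (-f.a ^ 2 - (f.a + f.β) * k
      + (f.a + f.β) * ((f.a + 2 * f.κ) * f.sig r t))) := by
  have h1 : ∀ p : ℝ × ℝ, 1 + Real.exp ((f.a + 2 * f.κ) * f.dist p.1 p.2) ≠ 0 := fun p => by
    positivity
  have c1 : Continuous fun p : ℝ × ℝ => f.dist p.1 p.2 := by
    unfold dist orig cut; fun_prop
  have c2 : Continuous fun p : ℝ × ℝ => f.wt k p.1 p.2 := by
    unfold wt orig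
    exact Continuous.div (by fun_prop) (by fun_prop) h1
  have c3 : Continuous fun p : ℝ × ℝ => f.sig p.1 p.2 := by
    unfold sig
    exact Continuous.div (by fun_prop) (by fun_prop) h1
  refine ⟨c2, c2.mul (by fun_prop), c2.mul (by fun_prop), fun r t => ?_, fun r t => ?_⟩
  · have d1 : HasDerivAt (fun s => f.dist s t) 1 r := by
      unfold dist
      exact ((hasDerivAt_id r).sub_const _).sub_const _
    have d2 : HasDerivAt (fun s => f.a * (s - f.orig t) + k * f.dist s t) (f.a + k) r :=
      ((((hasDerivAt_id r).sub_const (f.orig t)).const_mul f.a).add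
        (d1.const_mul k)).congr_deriv (by ring)
    have d3 := ((d1.const_mul (f.a + 2 * f.κ)).exp).const_add 1
    have d4 := d2.exp.div d3 (h1 (r, t))
    refine d4.congr_deriv ?_
    unfold wt sig
    have := h1 (r, t)
    field_simp
  · have d1 : HasDerivAt (fun s => f.dist r s) (-(f.a + f.β)) t := by
      have : HasDerivAt (fun s : ℝ => r - (f.ρ + f.a * (s - f.τ)) - (f.x + f.β * (s - f.τ)))
          (-(f.a * 1) - f.β * 1) t :=
        (((((hasDerivAt_id t).sub_const f.τ).const_mul f.a).const_add f.ρ).const_sub r).sub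
          ((((hasDerivAt_id t).sub_const f.τ).const_mul f.β).const_add f.x)
      exact this.congr_deriv (by ring)
    have d0 : HasDerivAt (fun s => f.a * (r - f.orig s)) (-f.a ^ 2) t := by
      have : HasDerivAt (fun s : ℝ => f.a * (r - (f.ρ + f.a * (s - f.τ))))
          (f.a * -(f.a * 1)) t :=
        ((((((hasDerivAt_id t).sub_const f.τ).const_mul f.a).const_add f.ρ).const_sub r)).const_mul
          f.a
      exact this.congr_deriv (by ring)
    have d2 : HasDerivAt (fun s => f.a * (r - f.orig s) + k * f.dist r s)
        (-f.a ^ 2 - (f.a + f.β) * k) t :=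
      (d0.add (d1.const_mul k)).congr_deriv (by ring)
    have d3 := ((d1.const_mul (f.a + 2 * f.κ)).exp).const_add 1
    have d4 := d2.exp.div d3 (h1 (r, t))
    refine d4.congr_deriv ?_
    unfold wt sig
    have := h1 (r, t)
    field_simp
    ring

lemma wt_zero_mul_sig_le (f : Frame) (hκ : 0 ≤ f.κ) (ha : 0 ≤ f.a) (r t : ℝ) :
    f.wt 0 r t * f.sig r t ≤ f.wt f.κ r t := by
  have hs := f.sig_le_one r t
  have hw := f.wt_pos 0 r t
  rcases le_total 0 (f.dist r t) with hy | hy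
  · have : f.wt 0 r t ≤ f.wt f.κ r t := by
      unfold wt
      gcongr
    nlinarith
  · have : f.sig r t ≤ Real.exp (f.κ * f.dist r t) := by
      unfold sig
      rw [div_le_iff₀ (by positivity)]
      have h1 : Real.exp ((f.a + 2 * f.κ) * f.dist r t) ≤ Real.exp (f.κ * f.dist r t) := by
        apply Real.exp_le_exp.2; nlinarith
      have h2 := Real.exp_pos (f.κ * f.dist r t)
      have h3 := Real.exp_pos ((f.a + 2 * f.κ) * f.dist r t)
      nlinarith
    calc _ ≤ f.wt 0 r t * Real.exp (f.κ * f.dist r t) := by gcongr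
      _ = f.wt f.κ r t := by
        unfold wt
        rw [div_mul_eq_mul_div, ← Real.exp_add]
        congr 2; ring

lemma wt_le_exp_abs (f : Frame) {k : ℝ} (hk : 0 ≤ k) (hkκ : k ≤ f.κ) (ha : f.κ ≤ f.a) (r t : ℝ) :
    f.wt k r t ≤ Real.exp (f.a * f.cut t) * Real.exp (-f.κ * |f.dist r t|) := by
  have hκ : 0 ≤ f.κ := hk.trans hkκ
  have e : f.a * (r - f.orig t) = f.a * f.cut t + f.a * f.dist r t := by unfold dist; ring
  unfold wt
  rw [div_le_iff₀ (by positivity), ← Real.exp_add, e]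
  rcases le_total 0 (f.dist r t) with hy | hy
  · rw [abs_of_nonneg hy]
    calc _ ≤ Real.exp (f.a * f.cut t + -f.κ * f.dist r t)
          * Real.exp ((f.a + 2 * f.κ) * f.dist r t) := by
          rw [← Real.exp_add]; apply Real.exp_le_exp.2; nlinarith
      _ ≤ _ := by gcongr; linarith
  · rw [abs_of_nonpos hy]
    calc _ ≤ Real.exp (f.a * f.cut t + -f.κ * -f.dist r t) * 1 := by
          rw [mul_one]; apply Real.exp_le_exp.2; nlinarith
      _ ≤ _ := by
          gcongr
          linarith [Real.exp_pos ((f.a + 2 * f.κ) * f.dist r t)]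

lemma wt_le_exp (f : Frame) (k r t : ℝ) :
    f.wt k r t ≤ Real.exp (f.a * (r - f.orig t) + k * f.dist r t) := by
  unfold wt
  refine div_le_self (Real.exp_pos _).le ?_
  linarith [Real.exp_pos ((f.a + 2 * f.κ) * f.dist r t)]

end Frame

lemma integral_exp_neg_abs_le {κ : ℝ} (hκ : 0 < κ) {ℓ B : ℝ} (h : ℓ ≤ B) (X : ℝ) :
    ∫ r in ℓ..B, Real.exp (-κ * |r - X|) ≤ 2 / κ := by
  have hc : Continuous fun r : ℝ => Real.exp (-κ * |r - X|) := by fun_prop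
  have hIntg : ∀ a b : ℝ, IntervalIntegrable (fun r : ℝ => Real.exp (-κ * |r - X|)) volume a b :=
    fun a b => hc.intervalIntegrable a b
  have hle : ∫ r in ℓ..B, Real.exp (-κ * |r - X|) ≤
      ∫ r in (min ℓ X)..(max B X), Real.exp (-κ * |r - X|) := by
    refine intervalIntegral.integral_mono_interval (min_le_left _ _) h (le_max_left _ _)
      (Eventually.of_forall fun r => (Real.exp_pos _).le) (hIntg _ _)
  refine hle.trans ?_
  rw [← intervalIntegral.integral_add_adjacent_intervals (hIntg (min ℓ X) X) (hIntg X (max B X))]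
  have h1 : ∫ r in (min ℓ X)..X, Real.exp (-κ * |r - X|) ≤ 1 / κ := by
    have : ∫ r in (min ℓ X)..X, Real.exp (-κ * |r - X|) =
        ∫ r in (min ℓ X)..X, Real.exp (κ * (r - X)) := by
      refine intervalIntegral.integral_congr fun r hr => ?_
      rw [uIcc_of_le (min_le_right _ _)] at hr
      rw [abs_of_nonpos (by linarith [hr.2])]; congr 1; ring
    rw [this]
    have hd : ∀ r ∈ uIcc (min ℓ X) X, HasDerivAt (fun r => Real.exp (κ * (r - X)) / κ)
        (Real.exp (κ * (r - X))) r := fun r _ => by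
      have := ((((hasDerivAt_id r).sub_const X).const_mul κ).exp).div_const κ
      exact this.congr_deriv (by simp only [id]; field_simp)
    rw [intervalIntegral.integral_eq_sub_of_hasDerivAt hd
      (Continuous.intervalIntegrable (by fun_prop) _ _)]
    simp only [sub_self, mul_zero, Real.exp_zero]
    have := Real.exp_pos (κ * (min ℓ X - X))
    have : 0 < Real.exp (κ * (min ℓ X - X)) / κ := by positivity
    linarith
  have h2 : ∫ r in X..(max B X), Real.exp (-κ * |r - X|) ≤ 1 / κ := by
    have : ∫ r in X..(max B X), Real.exp (-κ * |r - X|) =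
        ∫ r in X..(max B X), Real.exp (-κ * (r - X)) := by
      refine intervalIntegral.integral_congr fun r hr => ?_
      rw [uIcc_of_le (le_max_right _ _)] at hr
      rw [abs_of_nonneg (by linarith [hr.1])]
    rw [this]
    have hd : ∀ r ∈ uIcc X (max B X), HasDerivAt (fun r => -(Real.exp (-κ * (r - X)) / κ))
        (Real.exp (-κ * (r - X))) r := fun r _ => by
      have := (((((hasDerivAt_id r).sub_const X).const_mul (-κ)).exp).div_const κ).neg
      exact this.congr_deriv (by simp only [id]; field_simp)
    rw [intervalIntegral.integral_eq_sub_of_hasDerivAt hd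
      (Continuous.intervalIntegrable (by fun_prop) _ _)]
    simp only [sub_self, mul_zero, Real.exp_zero]
    have : 0 < Real.exp (-κ * (max B X - X)) / κ := by positivity
    linarith
  calc _ ≤ 1 / κ + 1 / κ := add_le_add h1 h2
    _ = 2 / κ := by ring

/-- The integral of an increasing exponential, cut at the right of `Y`. -/
lemma integral_indicator_exp_le {A : ℝ} (hA : 0 < A) {ℓ B : ℝ} (h : ℓ ≤ B) (Y M : ℝ)
    {q : ℝ → ℝ} (hq : IntervalIntegrable q volume ℓ B)
    (hq1 : ∀ r ∈ Icc ℓ B, r ≤ Y → q r ≤ Real.exp (A * r + M))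
    (hq2 : ∀ r ∈ Icc ℓ B, Y < r → q r ≤ 0) :
    ∫ r in ℓ..B, q r ≤ Real.exp (A * Y + M) / A := by
  have hd : ∀ α β : ℝ, ∫ r in α..β, Real.exp (A * r + M) =
      Real.exp (A * β + M) / A - Real.exp (A * α + M) / A := fun α β => by
    have hd : ∀ r ∈ uIcc α β, HasDerivAt (fun r => Real.exp (A * r + M) / A)
        (Real.exp (A * r + M)) r := fun r _ => by
      have := ((((hasDerivAt_id r).const_mul A).add_const M).exp).div_const A
      exact this.congr_deriv (by simp only [id]; field_simp)
    rw [intervalIntegral.integral_eq_sub_of_hasDerivAt hd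
      (Continuous.intervalIntegrable (by fun_prop) _ _)]
  have hpos : ∀ x : ℝ, 0 < Real.exp (A * x + M) / A := fun x => by positivity
  rcases lt_or_ge Y ℓ with hY | hY
  · have : ∫ r in ℓ..B, q r ≤ ∫ r in ℓ..B, (0:ℝ) :=
      intervalIntegral.integral_mono_on h hq (by simp) fun r hr => hq2 r hr (hY.trans_le hr.1)
    rw [intervalIntegral.integral_zero] at this
    exact this.trans (hpos Y).le
  rcases le_or_gt B Y with hB | hB
  · have : ∫ r in ℓ..B, q r ≤ ∫ r in ℓ..B, Real.exp (A * r + M) :=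
      intervalIntegral.integral_mono_on h hq (Continuous.intervalIntegrable (by fun_prop) _ _)
        fun r hr => hq1 r hr (hr.2.trans hB)
    rw [hd] at this
    have h2 : Real.exp (A * B + M) / A ≤ Real.exp (A * Y + M) / A := by gcongr
    linarith [hpos ℓ]
  · have i1 : IntervalIntegrable q volume ℓ Y :=
      hq.mono_set (by rw [uIcc_of_le hY, uIcc_of_le h]; exact Icc_subset_Icc_right hB.le)
    have i2 : IntervalIntegrable q volume Y B :=
      hq.mono_set (by rw [uIcc_of_le hB.le, uIcc_of_le h]; exact Icc_subset_Icc_left hY)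
    rw [← intervalIntegral.integral_add_adjacent_intervals i1 i2]
    have h1 : ∫ r in ℓ..Y, q r ≤ ∫ r in ℓ..Y, Real.exp (A * r + M) :=
      intervalIntegral.integral_mono_on hY i1 (Continuous.intervalIntegrable (by fun_prop) _ _)
        fun r hr => hq1 r ⟨hr.1, hr.2.trans hB.le⟩ hr.2
    have h2 : ∫ r in Y..B, q r ≤ ∫ r in Y..B, (0:ℝ) :=
      intervalIntegral.integral_mono_on_of_le_Ioo hB.le i2 (by simp)
        fun r hr => hq2 r ⟨hY.trans hr.1.le, hr.2.le⟩ hr.1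
    rw [hd] at h1
    rw [intervalIntegral.integral_zero] at h2
    linarith [hpos ℓ]


/-! ### Localized energy and firewall in a travelling frame -/

namespace SolBound

variable {d : ℕ} {V : Euc n → ℝ} {u : ℝ → ℝ → Euc n} {C Λ : ℝ}

lemma continuousOn_weighted {g gr gt : ℝ → ℝ → ℝ} (hg : IsWeight g gr gt) {q : ℝ → ℝ → ℝ}
    {ℓ B M : ℝ} (hℓ : 0 < ℓ) (hB : ℓ ≤ B)
    (hr : ∀ t > (0:ℝ), ContinuousOn (fun r => q r t) (Ioi 0))
    (ht : ∀ r > (0:ℝ), ContinuousOn (fun t => q r t) (Ioi 0))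
    (hM : ∀ r > (0:ℝ), ∀ t > (0:ℝ), |q r t| ≤ M) :
    ContinuousOn (fun t => ∫ r in ℓ..B, g r t * q r t) (Ioi 0) := by
  intro t (ht0 : 0 < t)
  refine ContinuousAt.continuousWithinAt ?_
  have hnb : Ioo (t / 2) (t + 1) ∈ 𝓝 t := Ioo_mem_nhds (by linarith) (by linarith)
  obtain ⟨M', hM', hMb⟩ := hg.exists_bound ℓ B (t / 2) (t + 1)
  refine intervalIntegral.continuousAt_of_dominated_interval (bound := fun _ => M' * M)
    ?_ ?_ (by simp) ?_
  · filter_upwards [hnb] with t' ht'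
    have ht'0 : 0 < t' := by linarith [ht'.1]
    rw [uIoc_of_le hB]
    refine ContinuousOn.aestronglyMeasurable ?_ measurableSet_Ioc
    exact (hg.cont_left t').continuousOn.mul
      ((hr t' ht'0).mono fun r hr => hℓ.trans hr.1)
  · filter_upwards [hnb] with t' ht'
    have ht'0 : 0 < t' := by linarith [ht'.1]
    refine Eventually.of_forall fun r hr => ?_
    rw [uIoc_of_le hB] at hr
    rw [norm_mul]
    exact mul_le_mul (hMb r ⟨hr.1.le, hr.2⟩ t' ⟨ht'.1.le, ht'.2.le⟩).1
      (hM r (hℓ.trans hr.1) t' ht'0) (norm_nonneg _) hM'.le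
  · refine Eventually.of_forall fun r hr => ?_
    rw [uIoc_of_le hB] at hr
    exact (hg.cont_right r).continuousAt.mul ((ht r (hℓ.trans hr.1)).continuousAt
      (Ioi_mem_nhds ht0))

lemma hasDerivAt_mass (h : SolBound d V u C Λ) {g gr gt : ℝ → ℝ → ℝ} (hg : IsWeight g gr gt)
    {ℓ B : ℝ} (hℓ : 0 < ℓ) (hB : ℓ ≤ B) {t : ℝ} (ht : 0 < t) :
    HasDerivAt (fun t => ∫ r in ℓ..B, g r t * (‖u r t‖ ^ 2 / 2))
      (∫ r in ℓ..B, (gt r t * (‖u r t‖ ^ 2 / 2) + g r t * ⟪u r t, ut u r t⟫)) t := by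
  obtain ⟨M, hM, hMb⟩ := hg.exists_bound ℓ B (t / 2) (t + 1)
  have hnb : Ioo (t / 2) (t + 1) ∈ 𝓝 t := Ioo_mem_nhds (by linarith) (by linarith)
  refine (intervalIntegral.hasDerivAt_integral_of_dominated_loc_of_deriv_le
    (F := fun t r => g r t * (‖u r t‖ ^ 2 / 2))
    (F' := fun t r => gt r t * (‖u r t‖ ^ 2 / 2) + g r t * ⟪u r t, ut u r t⟫)
    (bound := fun _ => M * (C ^ 2 / 2) + M * (C * C)) hnb ?_ ?_ ?_ ?_ (by simp) ?_).2
  · filter_upwards [hnb] with t' ht'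
    have ht'0 : 0 < t' := by linarith [ht'.1]
    have := h.continuous_u ht'0
    have := hg.cont_left t'
    exact Continuous.aestronglyMeasurable (by fun_prop)
  · have := h.continuous_u ht
    have := hg.cont_left t
    exact Continuous.intervalIntegrable (by fun_prop) _ _
  · have c1 := h.continuous_u ht
    have c2 := hg.cont_left t
    have c3 := hg.cont_t_left t
    rw [uIoc_of_le hB]
    refine ContinuousOn.aestronglyMeasurable ?_ measurableSet_Ioc
    refine ContinuousOn.add (Continuous.continuousOn (by fun_prop)) ?_
    exact c2.continuousOn.mul (c1.continuousOn.inner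
      ((h.continuousOn_ut_r ht).mono fun r hr => hℓ.trans hr.1))
  · refine Eventually.of_forall fun r hr t' ht' => ?_
    have ht'0 : 0 < t' := by linarith [ht'.1]
    rw [uIoc_of_le hB] at hr
    have hr0 : 0 ≤ r := hℓ.le.trans hr.1.le
    obtain ⟨m1, _, m3⟩ := hMb r ⟨hr.1.le, hr.2⟩ t' ⟨ht'.1.le, ht'.2.le⟩
    have b1 := h.bu r t' hr0 ht'0
    have b2 := h.but r t' hr0 ht'0
    refine (norm_add_le _ _).trans (add_le_add ?_ ?_)
    · rw [norm_mul]
      refine mul_le_mul m3 ?_ (norm_nonneg _) hM.le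
      rw [Real.norm_of_nonneg (by positivity)]
      gcongr
    · rw [norm_mul]
      refine mul_le_mul m1 ?_ (norm_nonneg _) hM.le
      exact (norm_inner_le_norm _ _).trans (mul_le_mul b1 b2 (norm_nonneg _) h.C_pos.le)
  · refine Eventually.of_forall fun r hr t' ht' => ?_
    have ht'0 : 0 < t' := by linarith [ht'.1]
    have h1 := (h.hasDerivAt_t ht'0 r).norm_sq
    exact ((hg.deriv_t r t').mul (h1.div_const 2)).congr_deriv (by ring)

/-- The integral of the derivative of `g (|u_r|² / 2 - V(u))`. -/
lemma integral_deriv_lagrangian (h : SolBound d V u C Λ) {g gr gt : ℝ → ℝ → ℝ}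
    (hg : IsWeight g gr gt) {ℓ B : ℝ} (hℓ : 0 < ℓ) (hB : ℓ ≤ B) {t : ℝ} (ht : 0 < t) :
    ∫ r in ℓ..B, (gr r t * (‖ur u r t‖ ^ 2 / 2 - V (u r t)) + g r t * (⟪ur u r t, ut u r t⟫
      - ((d : ℝ) - 1) / r * ‖ur u r t‖ ^ 2)) =
    g B t * (‖ur u B t‖ ^ 2 / 2 - V (u B t)) - g ℓ t * (‖ur u ℓ t‖ ^ 2 / 2 - V (u ℓ t)) := by
  have hd : ∀ r ∈ uIcc ℓ B, HasDerivAt (fun r => g r t * (‖ur u r t‖ ^ 2 / 2 - V (u r t)))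
      (gr r t * (‖ur u r t‖ ^ 2 / 2 - V (u r t)) + g r t *
        (⟪ur u r t, urr u r t⟫ - ⟪gradient V (u r t), ur u r t⟫)) r := fun r _ => by
    have h1 := (h.hasDerivAt_rr ht r).norm_sq.div_const 2
    have h2 := hasDerivAt_comp_potential h.contDiff (h.hasDerivAt_r ht r)
    exact ((hg.deriv_r r t).mul (h1.sub h2)).congr_deriv (by simp only [Pi.sub_apply]; ring)
  have hc : Continuous fun r => gr r t * (‖ur u r t‖ ^ 2 / 2 - V (u r t)) + g r t *
        (⟪ur u r t, urr u r t⟫ - ⟪gradient V (u r t), ur u r t⟫) := by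
    have c1 := h.continuous_u ht
    have c2 := h.continuous_ur ht
    have c3 := h.sol.cont_rr t ht
    have c4 := hg.cont_left t
    have c5 := hg.cont_r_left t
    have c6 := h.continuous_pot
    have c7 := h.continuous_grad
    exact (c5.mul (by fun_prop)).add (c4.mul ((c2.inner c3).sub ((c7.comp c1).inner c2)))
  rw [← intervalIntegral.integral_eq_sub_of_hasDerivAt hd (hc.intervalIntegrable _ _)]
  refine intervalIntegral.integral_congr fun r hr => ?_
  rw [uIcc_of_le hB] at hr
  have hr0 : 0 < r := hℓ.trans_le hr.1
  rw [h.ut_eq hr0 ht, inner_add_right, inner_add_right, inner_neg_right, real_inner_smul_right,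
    real_inner_self_eq_norm_sq, real_inner_comm (gradient V (u r t))]
  ring

/-- The integral of the derivative of `g ⟨u, u_r⟩`. -/
lemma integral_deriv_inner (h : SolBound d V u C Λ) {g gr gt : ℝ → ℝ → ℝ}
    (hg : IsWeight g gr gt) {ℓ B : ℝ} (hℓ : 0 < ℓ) (hB : ℓ ≤ B) {t : ℝ} (ht : 0 < t) :
    ∫ r in ℓ..B, (gr r t * ⟪u r t, ur u r t⟫ + g r t * (‖ur u r t‖ ^ 2 + ⟪u r t, ut u r t⟫
      + ⟪u r t, gradient V (u r t)⟫ - ((d : ℝ) - 1) / r * ⟪u r t, ur u r t⟫)) =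
    g B t * ⟪u B t, ur u B t⟫ - g ℓ t * ⟪u ℓ t, ur u ℓ t⟫ := by
  have hd : ∀ r ∈ uIcc ℓ B, HasDerivAt (fun r => g r t * ⟪u r t, ur u r t⟫)
      (gr r t * ⟪u r t, ur u r t⟫ + g r t * (⟪u r t, urr u r t⟫ + ‖ur u r t‖ ^ 2)) r :=
      fun r _ => by
    have h1 := (h.hasDerivAt_r ht r).inner ℝ (h.hasDerivAt_rr ht r)
    exact ((hg.deriv_r r t).mul h1).congr_deriv (by rw [real_inner_self_eq_norm_sq])
  have hc : Continuous fun r => gr r t * ⟪u r t, ur u r t⟫ +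
      g r t * (⟪u r t, urr u r t⟫ + ‖ur u r t‖ ^ 2) := by
    have c1 := h.continuous_u ht
    have c2 := h.continuous_ur ht
    have c3 := h.sol.cont_rr t ht
    have c4 := hg.cont_left t
    have c5 := hg.cont_r_left t
    fun_prop
  rw [← intervalIntegral.integral_eq_sub_of_hasDerivAt hd (hc.intervalIntegrable _ _)]
  refine intervalIntegral.integral_congr fun r hr => ?_
  rw [uIcc_of_le hB] at hr
  have hr0 : 0 < r := hℓ.trans_le hr.1
  rw [h.ut_eq hr0 ht, inner_add_right, inner_add_right, inner_neg_right, real_inner_smul_right]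
  ring

end SolBound

namespace Frame

/-- Admissible parameters of a frame. -/
structure Adm (f : Frame) (κ A β₀ : ℝ) : Prop where
  κ_pos : 0 < κ
  κ_eq : f.κ = κ
  κ_le : κ ≤ f.a
  a_le : f.a ≤ A
  β_nonneg : 0 ≤ f.β
  β_le : f.β ≤ β₀

/-- The localized energy. -/
def E (f : Frame) (V : Euc n → ℝ) (u : ℝ → ℝ → Euc n) (ℓ B t : ℝ) : ℝ :=
  ∫ r in ℓ..B, f.wt 0 r t * eDen V u r t

/-- The localized mass. -/
def G (f : Frame) (u : ℝ → ℝ → Euc n) (ℓ B t : ℝ) : ℝ :=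
  ∫ r in ℓ..B, f.wt f.κ r t * (‖u r t‖ ^ 2 + ‖ur u r t‖ ^ 2)

/-- The localized dissipation. -/
def D (f : Frame) (u : ℝ → ℝ → Euc n) (ℓ B t : ℝ) : ℝ :=
  ∫ r in ℓ..B, f.wt 0 r t * ‖ut u r t + f.a • ur u r t‖ ^ 2

/-- The firewall functional with energy weight `w`. -/
def F (f : Frame) (V : Euc n → ℝ) (u : ℝ → ℝ → Euc n) (w ℓ B t : ℝ) : ℝ :=
  w * (∫ r in ℓ..B, f.wt f.κ r t * eDen V u r t) + ∫ r in ℓ..B, f.wt f.κ r t * (‖u r t‖ ^ 2 / 2)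

/-- The pollution terms due to the boundaries and the curvature. -/
def err (f : Frame) (ℓ B t : ℝ) : ℝ :=
  Real.exp (f.a * f.cut t) *
    (Real.exp (-f.κ * |f.dist B t|) + Real.exp (-f.κ * |f.dist ℓ t|) + 1 / ℓ)

lemma integral_wt_le {f : Frame} {κ A β₀ : ℝ} (hf : f.Adm κ A β₀) {k : ℝ} (hk : 0 ≤ k)
    (hkκ : k ≤ f.κ) {ℓ B : ℝ} (hB : ℓ ≤ B) (t : ℝ) :
    ∫ r in ℓ..B, f.wt k r t ≤ 2 / κ * Real.exp (f.a * f.cut t) := by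
  have hκ : 0 < f.κ := hf.κ_eq ▸ hf.κ_pos
  have c1 : Continuous fun r => f.wt k r t := (f.isWeight_wt k).cont_left t
  have c2 : Continuous fun r => f.dist r t := by unfold dist; fun_prop
  calc ∫ r in ℓ..B, f.wt k r t
      ≤ ∫ r in ℓ..B, Real.exp (f.a * f.cut t) * Real.exp (-f.κ * |f.dist r t|) :=
        intervalIntegral.integral_mono_on hB (c1.intervalIntegrable _ _)
          (Continuous.intervalIntegrable (by fun_prop) _ _)
          fun r _ => f.wt_le_exp_abs hk hkκ (hf.κ_eq.trans_le hf.κ_le) r t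
    _ = Real.exp (f.a * f.cut t) * ∫ r in ℓ..B, Real.exp (-f.κ * |f.dist r t|) :=
        intervalIntegral.integral_const_mul _ _
    _ ≤ Real.exp (f.a * f.cut t) * (2 / f.κ) := by
        refine mul_le_mul_of_nonneg_left ?_ (Real.exp_pos _).le
        have := integral_exp_neg_abs_le hκ hB (f.orig t + f.cut t)
        simpa only [dist, sub_sub] using this
    _ = _ := by rw [hf.κ_eq]; ring

lemma wt_err_le {f : Frame} {κ A β₀ : ℝ} (hf : f.Adm κ A β₀) {k : ℝ} (hk : 0 ≤ k)
    (hkκ : k ≤ f.κ) {ℓ B : ℝ} (hℓ : 0 < ℓ) (hB : ℓ ≤ B) (t : ℝ) :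
    f.wt k B t + f.wt k ℓ t + 1 / ℓ * ∫ r in ℓ..B, f.wt k r t ≤ (1 + 2 / κ) * f.err ℓ B t := by
  have hκ := hf.κ_pos
  have h1 := f.wt_le_exp_abs hk hkκ (hf.κ_eq.trans_le hf.κ_le) B t
  have h2 := f.wt_le_exp_abs hk hkκ (hf.κ_eq.trans_le hf.κ_le) ℓ t
  have h3 := mul_le_mul_of_nonneg_left (integral_wt_le hf hk hkκ hB t)
    (by positivity : (0:ℝ) ≤ 1 / ℓ)
  unfold err
  have e1 := Real.exp_pos (f.a * f.cut t)
  have e2 := Real.exp_pos (-f.κ * |f.dist B t|)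
  have e3 := Real.exp_pos (-f.κ * |f.dist ℓ t|)
  have : 0 ≤ 2 / κ * (Real.exp (f.a * f.cut t) *
    (Real.exp (-f.κ * |f.dist B t|) + Real.exp (-f.κ * |f.dist ℓ t|))) := by positivity
  have : 0 ≤ Real.exp (f.a * f.cut t) * (1 / ℓ) := by positivity
  linarith

end Frame


/-! ### Differential inequalities for the localized energy and the firewall -/

lemma energy_density_ineq {g ψ s a κ β A β₀ Λ C2 M X T Y U v m Z : ℝ} (hg : 0 ≤ g) (hs : 0 ≤ s)
    (hs1 : s ≤ 1) (hψ : g * s ≤ ψ) (hκ : 0 < κ) (hκa : κ ≤ a) (haA : a ≤ A) (hβ : 0 ≤ β)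
    (hβ₀ : β ≤ β₀) (hΛ : 0 ≤ Λ) (hX : 0 ≤ X) (hU : 0 ≤ U) (hv : |v| ≤ Λ * U) (hXC : X ≤ C2)
    (hYC : Y ≤ C2) (hm : 0 ≤ m) (hmM : m ≤ M) (hZ : Z = T + 2 * a * Y + a ^ 2 * X)
    (hsq : 0 ≤ Z - 2 * ((a + 2 * κ) * s) * (Y + a * X) + ((a + 2 * κ) * s) ^ 2 * X) :
    (g * (-a ^ 2 + (a + β) * ((a + 2 * κ) * s))) * (X / 2 + v)
      - (g * (a - (a + 2 * κ) * s)) * Y - g * T + m * g * Y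
      - a * ((g * (a - (a + 2 * κ) * s)) * (X / 2 - v) + g * (Y - m * X)) ≤
    -(1 / 2) * (g * Z) + (A + 2 * κ) * (A + 2 * κ + β₀ + β₀ * Λ) * (ψ * (U + X))
      + M * ((1 + A) * C2) * g := by
  have hA : 0 < A := by linarith
  set b := a + 2 * κ with hb
  have hb0 : 0 < b := by linarith
  have hbA : b ≤ A + 2 * κ := by linarith
  set B := A + 2 * κ with hB
  have hv' := abs_le.1 hv
  have e1 : m * (Y + a * X) ≤ M * ((1 + A) * C2) := by
    have : Y + a * X ≤ (1 + A) * C2 := by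
      linarith [mul_le_mul haA hXC hX hA.le]
    have h2 : 0 ≤ (1 + A) * C2 := by have : 0 ≤ C2 := hX.trans hXC; positivity
    calc m * (Y + a * X) ≤ m * ((1 + A) * C2) := by gcongr
      _ ≤ _ := by gcongr
  have e2 : b * s * X + β * X + 2 * β * v ≤ 2 * (B + β₀ + β₀ * Λ) * (U + X) := by
    have h1 : b * s * X ≤ B * X := by
      have : b * s ≤ B := (mul_le_of_le_one_right hb0.le hs1).trans hbA
      gcongr
    have h2 : β * X ≤ β₀ * X := by gcongr
    have h3 : 2 * β * v ≤ 2 * (β₀ * Λ) * U := by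
      have : β * v ≤ β * (Λ * U) := by gcongr; exact hv'.2
      have h4 : β * (Λ * U) ≤ β₀ * (Λ * U) := by gcongr
      linarith
    have hβ0 : 0 ≤ β₀ := hβ.trans hβ₀
    have p1 : 0 ≤ B * U := by positivity
    have p2 : 0 ≤ β₀ * U := by positivity
    have p3 : 0 ≤ β₀ * Λ * X := by positivity
    have p4 : 0 ≤ B * X := by positivity
    have p5 : 0 ≤ β₀ * X := by positivity
    linarith
  have e3 : g * (b * s) / 2 * (b * s * X + β * X + 2 * β * v) ≤
      B * (B + β₀ + β₀ * Λ) * (ψ * (U + X)) := by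
    have hβ0 : 0 ≤ β₀ := hβ.trans hβ₀
    calc g * (b * s) / 2 * (b * s * X + β * X + 2 * β * v)
        ≤ g * (b * s) / 2 * (2 * (B + β₀ + β₀ * Λ) * (U + X)) := by gcongr
      _ = b * (B + β₀ + β₀ * Λ) * ((g * s) * (U + X)) := by ring
      _ ≤ _ := by gcongr
  have e4 : g * (m * (Y + a * X)) ≤ g * (M * ((1 + A) * C2)) := by gcongr
  have e5 := mul_nonneg hg hsq
  subst hZ
  linarith

namespace SolBound

variable {d : ℕ} {V : Euc n → ℝ} {u : ℝ → ℝ → Euc n} {C Λ : ℝ}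

lemma curvature_nonneg (h : SolBound d V u C Λ) : (0:ℝ) ≤ (d:ℝ) - 1 := by
  have : (1:ℝ) ≤ d := by exact_mod_cast h.one_le_d
  linarith

set_option maxHeartbeats 800000 in
lemma exists_energy_deriv_le (h : SolBound d V u C Λ) {κ A β₀ : ℝ} (hA : 0 < A) (hκ : 0 < κ)
    (hβ₀ : 0 ≤ β₀) :
    ∃ K > (0:ℝ), ∀ f : Frame, f.Adm κ A β₀ → ∀ ℓ B t : ℝ, 0 < ℓ → ℓ ≤ B → 0 < t →
      ∃ E', HasDerivAt (fun t => f.E V u ℓ B t) E' t ∧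
        E' ≤ -(1 / 2) * f.D u ℓ B t + K * (f.G u ℓ B t + f.err ℓ B t) := by
  have hd := h.curvature_nonneg
  have hC := h.C_pos
  have hΛ := h.Λ_pos
  obtain ⟨K₁, hK₁⟩ : ∃ k, k = (A + 2 * κ) * (A + 2 * κ + β₀ + β₀ * Λ) := ⟨_, rfl⟩
  obtain ⟨K₂, hK₂⟩ : ∃ k, k = (d:ℝ) * ((1 + A) * ((1 + Λ) * C ^ 2)) := ⟨_, rfl⟩
  have hd0 : (0:ℝ) < d := by linarith
  have hK₁p : 0 < K₁ := by rw [hK₁]; positivity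
  have hK₂p : 0 < K₂ := by rw [hK₂]; positivity
  refine ⟨K₁ + K₂ * (1 + 2 / κ), by positivity, fun f hf ℓ B t hℓ hB ht => ?_⟩
  have hg := f.isWeight_wt 0
  have hE := h.hasDerivAt_energy hg hℓ hB ht
  have hP := h.integral_deriv_lagrangian hg hℓ hB ht
  refine ⟨_, hE, ?_⟩
  have c1 := h.continuous_u ht
  have c2 := h.continuous_ur ht
  have c3 : ContinuousOn (fun r => ut u r t) (uIcc ℓ B) := (h.continuousOn_ut_r ht).mono
    fun r hr => hℓ.trans_le (by rw [uIcc_of_le hB] at hr; exact hr.1)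
  have c4 := hg.cont_left t
  have c5 := hg.cont_r_left t
  have c6 := hg.cont_t_left t
  have c7 := h.continuous_pot
  have c8 := h.continuous_eDen ht
  have c9 : ContinuousOn (fun r : ℝ => ((d:ℝ) - 1) / r) (uIcc ℓ B) := by
    refine continuousOn_const.div continuousOn_id fun r hr => ?_
    rw [uIcc_of_le hB] at hr
    exact (hℓ.trans_le hr.1).ne'
  have c10 := (f.isWeight_wt f.κ).cont_left t
  have hκ' : 0 < f.κ := hf.κ_eq ▸ hκ
  have ha : 0 < f.a := hκ.trans_le hf.κ_le
  have cY : ContinuousOn (fun r => ⟪ur u r t, ut u r t⟫) (uIcc ℓ B) := c2.continuousOn.inner c3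
  have cT : ContinuousOn (fun r => ‖ut u r t‖ ^ 2) (uIcc ℓ B) := c3.norm.pow 2
  have cZ : ContinuousOn (fun r => ‖ut u r t + f.a • ur u r t‖ ^ 2) (uIcc ℓ B) :=
    (c3.add (c2.continuousOn.const_smul f.a)).norm.pow 2
  have cL : Continuous fun r => ‖ur u r t‖ ^ 2 / 2 - V (u r t) := by fun_prop
  have cX : Continuous fun r => ‖ur u r t‖ ^ 2 := by fun_prop
  have cUX : Continuous fun r => ‖u r t‖ ^ 2 + ‖ur u r t‖ ^ 2 := by fun_prop
  have i1 : IntervalIntegrable (fun r =>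
      f.wt 0 r t * (-f.a ^ 2 - (f.a + f.β) * 0 + (f.a + f.β) * ((f.a + 2 * f.κ) * f.sig r t)) *
        eDen V u r t - f.wt 0 r t * (f.a + 0 - (f.a + 2 * f.κ) * f.sig r t) * ⟪ur u r t, ut u r t⟫
        - f.wt 0 r t * ‖ut u r t‖ ^ 2 + ((d:ℝ) - 1) / r * f.wt 0 r t * ⟪ur u r t, ut u r t⟫)
      volume ℓ B := ((((c6.continuousOn.mul c8.continuousOn).sub (c5.continuousOn.mul cY)).sub
    (c4.continuousOn.mul cT)).add ((c9.mul c4.continuousOn).mul cY)).intervalIntegrable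
  have i2 : IntervalIntegrable (fun r =>
      f.wt 0 r t * (f.a + 0 - (f.a + 2 * f.κ) * f.sig r t) * (‖ur u r t‖ ^ 2 / 2 - V (u r t)) +
        f.wt 0 r t * (⟪ur u r t, ut u r t⟫ - ((d:ℝ) - 1) / r * ‖ur u r t‖ ^ 2)) volume ℓ B :=
    ((c5.continuousOn.mul cL.continuousOn).add (c4.continuousOn.mul
    (cY.sub (c9.mul cX.continuousOn)))).intervalIntegrable
  have i3 : IntervalIntegrable (fun r => f.wt 0 r t * ‖ut u r t + f.a • ur u r t‖ ^ 2) volume ℓ B :=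
    (c4.continuousOn.mul cZ).intervalIntegrable
  have i4 : IntervalIntegrable (fun r => f.wt f.κ r t * (‖u r t‖ ^ 2 + ‖ur u r t‖ ^ 2))
    volume ℓ B := (c10.mul cUX).intervalIntegrable ℓ B
  have i5 : IntervalIntegrable (fun r => f.wt 0 r t) volume ℓ B := c4.intervalIntegrable ℓ B
  have key := intervalIntegral.integral_mono_on hB (i1.sub (i2.const_mul f.a))
    (((i3.const_mul (-(1/2))).add (i4.const_mul K₁)).add (i5.const_mul (((d:ℝ) - 1) / ℓ *
      ((1 + A) * C ^ 2)))) (fun r hr => by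
    have hr0 : 0 < r := hℓ.trans_le hr.1
    have hZ : ‖ut u r t + f.a • ur u r t‖ ^ 2 =
        ‖ut u r t‖ ^ 2 + 2 * f.a * ⟪ur u r t, ut u r t⟫ + f.a ^ 2 * ‖ur u r t‖ ^ 2 := by
      rw [norm_add_sq_real, norm_smul, mul_pow, Real.norm_eq_abs, sq_abs, real_inner_smul_right,
        real_inner_comm]
      ring
    have hsq := sq_nonneg ‖ut u r t + f.a • ur u r t - ((f.a + 2 * f.κ) * f.sig r t) • ur u r t‖
    rw [norm_sub_sq_real, norm_smul, mul_pow, Real.norm_eq_abs, sq_abs, real_inner_smul_right,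
      inner_add_left, real_inner_smul_left, real_inner_self_eq_norm_sq, real_inner_comm] at hsq
    have hYC : ⟪ur u r t, ut u r t⟫ ≤ C ^ 2 := (real_inner_le_norm _ _).trans (by
        rw [pow_two]
        exact mul_le_mul (h.bur r t hr0.le ht) (h.but r t hr0.le ht) (norm_nonneg _) hC.le)
    have fin := energy_density_ineq (κ := f.κ) (β := f.β) (s := f.sig r t) (a := f.a)
      (v := V (u r t))
      (f.wt_pos 0 r t).le (f.sig_nonneg r t) (f.sig_le_one r t)
      (f.wt_zero_mul_sig_le hκ'.le ha.le r t) hκ' (hf.κ_eq.trans_le hf.κ_le) hf.a_le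
      hf.β_nonneg hf.β_le hΛ.le (sq_nonneg ‖ur u r t‖) (sq_nonneg ‖u r t‖)
      (h.pot_le (h.bu r t hr0.le ht)) (pow_le_pow_left₀ (norm_nonneg _) (h.bur r t hr0.le ht) 2)
      hYC (div_nonneg hd hr0.le) (div_le_div_of_nonneg_left hd hℓ hr.1) hZ (by linarith)
    rw [hf.κ_eq, ← hK₁] at fin
    rw [hf.κ_eq, mul_zero, sub_zero, add_zero]
    exact fin)
  rw [intervalIntegral.integral_sub i1 (i2.const_mul f.a), intervalIntegral.integral_const_mul,
    hP, intervalIntegral.integral_add ((i3.const_mul (-(1/2))).add (i4.const_mul K₁))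
      (i5.const_mul _), intervalIntegral.integral_add (i3.const_mul _) (i4.const_mul _),
    intervalIntegral.integral_const_mul, intervalIntegral.integral_const_mul,
    intervalIntegral.integral_const_mul] at key
  have hbd : ∀ r, 0 < r → |⟪ur u r t, ut u r t⟫ + f.a * (‖ur u r t‖ ^ 2 / 2 - V (u r t))| ≤ K₂ := by
    intro r hr
    have b1 : |⟪ur u r t, ut u r t⟫| ≤ C ^ 2 := (abs_real_inner_le_norm _ _).trans (by
        rw [pow_two]
        exact mul_le_mul (h.bur r t hr.le ht) (h.but r t hr.le ht) (norm_nonneg _) hC.le)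
    have b2 : ‖ur u r t‖ ^ 2 ≤ C ^ 2 := pow_le_pow_left₀ (norm_nonneg _) (h.bur r t hr.le ht) 2
    have b3 := h.pot_le (h.bu r t hr.le ht)
    have b4 : ‖u r t‖ ^ 2 ≤ C ^ 2 := pow_le_pow_left₀ (norm_nonneg _) (h.bu r t hr.le ht) 2
    have b5 : |‖ur u r t‖ ^ 2 / 2 - V (u r t)| ≤ (1 + Λ) * C ^ 2 := by
      rw [abs_le] at b3 ⊢
      have : Λ * ‖u r t‖ ^ 2 ≤ Λ * C ^ 2 := by gcongr
      constructor <;> linarith [sq_nonneg ‖ur u r t‖]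
    calc _ ≤ |⟪ur u r t, ut u r t⟫| + |f.a * (‖ur u r t‖ ^ 2 / 2 - V (u r t))| := abs_add_le _ _
      _ ≤ C ^ 2 + A * ((1 + Λ) * C ^ 2) := by
        rw [abs_mul, abs_of_pos ha]
        exact add_le_add b1 (mul_le_mul hf.a_le b5 (abs_nonneg _) hA.le)
      _ ≤ 1 * ((1 + A) * ((1 + Λ) * C ^ 2)) := by
        have : 0 ≤ Λ * C ^ 2 := by positivity
        linarith
      _ ≤ K₂ := by rw [hK₂]; gcongr; linarith
  have hb1 := mul_le_mul_of_nonneg_left (abs_le.1 (hbd B (hℓ.trans_le hB))).2 (f.wt_pos 0 B t).le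
  have hb2 := mul_le_mul_of_nonneg_left (abs_le.1 (hbd ℓ hℓ)).1 (f.wt_pos 0 ℓ t).le
  have herr := mul_le_mul_of_nonneg_left
    (Frame.wt_err_le hf le_rfl hκ'.le hℓ hB t) hK₂p.le
  have hcoef : ((d:ℝ) - 1) / ℓ * ((1 + A) * C ^ 2) ≤ K₂ * (1 / ℓ) := by
    rw [hK₂, div_mul_eq_mul_div, mul_one_div]
    gcongr
    · linarith
    · linarith [show 0 ≤ Λ * C ^ 2 by positivity]
  have hint0 : 0 ≤ ∫ r in ℓ..B, f.wt 0 r t :=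
    intervalIntegral.integral_nonneg hB fun r _ => (f.wt_pos 0 r t).le
  have hcoef' := mul_le_mul_of_nonneg_right hcoef hint0
  have hG0 : 0 ≤ f.G u ℓ B t := intervalIntegral.integral_nonneg hB fun r _ =>
    mul_nonneg (f.wt_pos _ r t).le (by positivity)
  have herr0 : 0 ≤ f.err ℓ B t := by unfold Frame.err; positivity
  have p1 : 0 ≤ K₂ * (1 + 2 / κ) * f.G u ℓ B t := by positivity
  have p2 : 0 ≤ K₁ * f.err ℓ B t := by positivity
  unfold Frame.D
  have hGdef : f.G u ℓ B t = ∫ r in ℓ..B, f.wt f.κ r t * (‖u r t‖ ^ 2 + ‖ur u r t‖ ^ 2) := rfl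
  rw [← hGdef] at key
  linarith

end SolBound

lemma firewall_density_ineq {g p τ a κ β A β₀ lam Λ C2 M w X T Y U S N v m e c : ℝ} (hg : 0 ≤ g)
    (hκ : 0 < κ) (hκa : κ ≤ a) (haA : a ≤ A) (hβ : 0 ≤ β) (hβ₀ : β ≤ β₀)
    (hlam : (A + κ) * (κ + β₀) ≤ lam / 4) (hp1 : -κ ≤ p) (hp2 : p ≤ a + κ)
    (hτ : τ = -a ^ 2 + (a + β) * (a - p)) (hX : 0 ≤ X) (hU : 0 ≤ U) (hv : |v| ≤ Λ * U)
    (hYC : Y ≤ C2) (hSC : S ≤ C2) (hm : 0 ≤ m) (hmM : m ≤ M) (hw : 0 ≤ w) (hC2 : 0 ≤ C2)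
    (hw1 : w * ((A ^ 2 + (A + β₀) * (A + κ)) * Λ) ≤ lam / 8)
    (hw2 : w * ((A ^ 2 + (A + β₀) * (A + κ)) / 2 + (A + κ) ^ 2 / 4) ≤ 1 / 4)
    (hsq1 : 0 ≤ T + p * Y + p ^ 2 / 4 * X) (hsq2 : 0 ≤ p ^ 2 * U + 2 * p * S + X)
    (hN : lam / 2 * U - e ≤ N) (hc1 : c ≤ 1 / 4) (hc2 : c ≤ lam / 4) :
    w * ((g * τ) * (X / 2 + v) - (g * p) * Y - g * T + m * g * Y) + (g * τ) * (U / 2)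
      - (g * p) * S - g * (X + N - m * S) ≤
    -c * (g * (U + X)) + e * g + M * ((1 + w) * C2) * g := by
  have hA : 0 < A := by linarith
  have hβ₀0 : 0 ≤ β₀ := hβ.trans hβ₀
  have hv' := abs_le.1 hv
  have hp : p ^ 2 ≤ (A + κ) ^ 2 := sq_le_sq' (by linarith) (by linarith)
  have hτ1 : |τ| ≤ A ^ 2 + (A + β₀) * (A + κ) := by
    have h1 : a ^ 2 ≤ A ^ 2 := pow_le_pow_left₀ (by linarith) haA 2
    have h2 : (a + β) * |a - p| ≤ (A + β₀) * (A + κ) := by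
      refine mul_le_mul (by linarith) ?_ (abs_nonneg _) (by linarith)
      rw [abs_le]; constructor <;> linarith
    calc |τ| ≤ |-a ^ 2| + |(a + β) * (a - p)| := by rw [hτ]; exact abs_add_le _ _
      _ = a ^ 2 + (a + β) * |a - p| := by
        rw [abs_neg, abs_of_nonneg (sq_nonneg a), abs_mul, abs_of_nonneg (by linarith : 0 ≤ a + β)]
      _ ≤ _ := add_le_add h1 h2
  have hτ2 : τ + p ^ 2 ≤ lam / 4 := by
    have e1 : τ + p ^ 2 = (p - a) * (p - β) := by rw [hτ]; ring
    have e2 : (a + κ) * (κ + β) ≤ (A + κ) * (κ + β₀) :=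
      mul_le_mul (by linarith) (by linarith) (by linarith) (by linarith)
    have e3 : (p - a) * (p - β) ≤ (a + κ) * (κ + β) := by
      have h1 : 0 ≤ (p + κ) * (a + κ - p) := mul_nonneg (by linarith) (by linarith)
      have h3 : 0 ≤ β * (p + κ) := mul_nonneg hβ (by linarith)
      linarith
    linarith
  -- energy part
  have hen : w * (τ * (X / 2 + v) - p * Y - T) ≤ 1 / 4 * X + lam / 8 * U := by
    have h1 : τ * (X / 2 + v) ≤ (A ^ 2 + (A + β₀) * (A + κ)) * (X / 2 + Λ * U) := by
      refine (le_abs_self _).trans ?_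
      rw [abs_mul]
      refine mul_le_mul hτ1 ?_ (abs_nonneg _) (by positivity)
      refine (abs_add_le _ _).trans (add_le_add ?_ hv)
      rw [abs_of_nonneg (by linarith)]
    have h2 : p ^ 2 / 4 * X ≤ (A + κ) ^ 2 / 4 * X := by gcongr
    have h3 : τ * (X / 2 + v) - p * Y - T ≤
        ((A ^ 2 + (A + β₀) * (A + κ)) / 2 + (A + κ) ^ 2 / 4) * X +
          ((A ^ 2 + (A + β₀) * (A + κ)) * Λ) * U := by linarith
    have h4 := mul_le_mul_of_nonneg_left h3 hw
    have h5 := mul_le_mul_of_nonneg_right hw2 hX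
    have h6 := mul_le_mul_of_nonneg_right hw1 hU
    linarith
  have hcX : c * X ≤ 1 / 4 * X := by gcongr
  have hcU : c * U ≤ lam / 4 * U := by gcongr
  have hτU := mul_le_mul_of_nonneg_right hτ2 hU
  have hmY : m * (w * Y + S) ≤ M * ((1 + w) * C2) := by
    have : w * Y + S ≤ (1 + w) * C2 := by linarith [mul_le_mul_of_nonneg_left hYC hw]
    exact (mul_le_mul_of_nonneg_left this hm).trans
      (mul_le_mul_of_nonneg_right hmM (by positivity))
  have hfin : w * (τ * (X / 2 + v) - p * Y - T) + τ * (U / 2) - p * S - X - N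
      + m * (w * Y + S) ≤ -c * (U + X) + e + M * ((1 + w) * C2) := by linarith
  have := mul_le_mul_of_nonneg_left hfin hg
  linarith

namespace SolBound

variable {d : ℕ} {V : Euc n → ℝ} {u : ℝ → ℝ → Euc n} {C Λ : ℝ}

set_option maxHeartbeats 1000000 in
lemma exists_firewall (h : SolBound d V u C Λ) (D : EscData n V) (h0 : (0 : Euc n) ∈ MinSet V)
    {κ A β₀ : ℝ} (hA : 0 < A) (hκ : 0 < κ) (hβ₀ : 0 ≤ β₀)
    (hlam : (A + κ) * (κ + β₀) ≤ D.lmin / 4) :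
    ∃ K > (0:ℝ), ∃ c > (0:ℝ), ∃ w : ℝ, ∀ f : Frame, f.Adm κ A β₀ → ∀ ℓ B t : ℝ, 0 < ℓ → ℓ ≤ B →
      0 < t → c * f.G u ℓ B t ≤ f.F V u w ℓ B t ∧ f.F V u w ℓ B t ≤ K * f.G u ℓ B t ∧
      ∀ p : ℝ, (∀ r ∈ Icc ℓ B, f.orig t + p < r → ‖u r t‖ ≤ D.dEsc) →
      ∃ F', HasDerivAt (fun t => f.F V u w ℓ B t) F' t ∧
        F' ≤ -c * f.G u ℓ B t +
          K * (Real.exp ((f.a + κ) * p - κ * f.cut t) + f.err ℓ B t) := by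
  have hd := h.curvature_nonneg
  have hC := h.C_pos
  have hΛ := h.Λ_pos
  have hl := D.lmin_pos
  obtain ⟨TT, hTT⟩ : ∃ k, k = A ^ 2 + (A + β₀) * (A + κ) := ⟨_, rfl⟩
  have hTTp : 0 < TT := by rw [hTT]; positivity
  obtain ⟨w, hwp, hw1, hw2, hw3, hw4⟩ : ∃ w > (0:ℝ), w * (TT * Λ) ≤ D.lmin / 8 ∧
      w * (TT / 2 + (A + κ) ^ 2 / 4) ≤ 1 / 4 ∧ w * Λ ≤ 1 / 4 ∧ w ≤ 1 := by
    have p1 : 0 < 8 * (TT * Λ) / D.lmin := by positivity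
    have p2 : 0 < 4 * (TT / 2 + (A + κ) ^ 2 / 4) := by positivity
    obtain ⟨S, hS⟩ : ∃ S, S = 1 + 8 * (TT * Λ) / D.lmin + 4 * (TT / 2 + (A + κ) ^ 2 / 4)
      + 4 * Λ := ⟨_, rfl⟩
    have hSp : 0 < S := by rw [hS]; positivity
    have hw : 0 < S⁻¹ := inv_pos.2 hSp
    have hS1 : S⁻¹ * S = 1 := inv_mul_cancel₀ hSp.ne'
    have q1 := mul_pos hw p1
    have q2 := mul_pos hw p2
    have q3 := mul_pos hw hΛ
    rw [hS, mul_add, mul_add, mul_add, ← hS] at hS1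
    refine ⟨S⁻¹, hw, ?_, by linarith, by linarith, by linarith⟩
    have q4 : S⁻¹ * (8 * (TT * Λ) / D.lmin) ≤ 1 := by linarith
    rw [← mul_div_assoc, div_le_one hl] at q4
    linarith
  obtain ⟨c, hcp, hc1, hc2, hc3⟩ : ∃ c > (0:ℝ), c ≤ 1 / 4 ∧ c ≤ D.lmin / 4 ∧ c ≤ w / 2 :=
    ⟨min (1 / 4) (min (D.lmin / 4) (w / 2)), by positivity, min_le_left _ _,
      (min_le_right _ _).trans (min_le_left _ _), (min_le_right _ _).trans (min_le_right _ _)⟩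
  have hd0 : (0:ℝ) < d := by linarith
  obtain ⟨K₂, hK₂⟩ : ∃ k, k = (d:ℝ) * ((1 + w) * C ^ 2) := ⟨_, rfl⟩
  have hK₂p : 0 < K₂ := by rw [hK₂]; positivity
  obtain ⟨K₃, hK₃⟩ : ∃ k, k = (D.lmin / 2 + Λ) * C ^ 2 := ⟨_, rfl⟩
  have hK₃p : 0 < K₃ := by rw [hK₃]; positivity
  refine ⟨1 + K₂ * (1 + 2 / κ) + K₃ / κ, by positivity, c, hcp, w,
    fun f hf ℓ B t hℓ hB ht => ?_⟩
  have hκ' : 0 < f.κ := hf.κ_eq ▸ hκ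
  have ha : 0 < f.a := hκ.trans_le hf.κ_le
  have hg := f.isWeight_wt f.κ
  have c1 := h.continuous_u ht
  have c2 := h.continuous_ur ht
  have c4 := hg.cont_left t
  have c8 := h.continuous_eDen ht
  have cX : Continuous fun r => ‖ur u r t‖ ^ 2 := by fun_prop
  have cU : Continuous fun r => ‖u r t‖ ^ 2 / 2 := by fun_prop
  have cUX : Continuous fun r => ‖u r t‖ ^ 2 + ‖ur u r t‖ ^ 2 := by fun_prop
  have i4 : IntervalIntegrable (fun r => f.wt f.κ r t * (‖u r t‖ ^ 2 + ‖ur u r t‖ ^ 2))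
    volume ℓ B := (c4.mul cUX).intervalIntegrable ℓ B
  have j1 : IntervalIntegrable (fun r => f.wt f.κ r t * eDen V u r t) volume ℓ B :=
    (c4.mul c8).intervalIntegrable ℓ B
  have j2 : IntervalIntegrable (fun r => f.wt f.κ r t * (‖u r t‖ ^ 2 / 2)) volume ℓ B :=
    (c4.mul cU).intervalIntegrable ℓ B
  have hG0 : 0 ≤ f.G u ℓ B t := intervalIntegral.integral_nonneg hB fun r _ =>
    mul_nonneg (f.wt_pos _ r t).le (by positivity)
  have hFeq : f.F V u w ℓ B t = ∫ r in ℓ..B,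
      (w * (f.wt f.κ r t * eDen V u r t) + f.wt f.κ r t * (‖u r t‖ ^ 2 / 2)) := by
    rw [intervalIntegral.integral_add (j1.const_mul w) j2, intervalIntegral.integral_const_mul]
    rfl
  have hpt : ∀ r ∈ Icc ℓ B, |w * eDen V u r t - w * (‖ur u r t‖ ^ 2 / 2)| ≤ ‖u r t‖ ^ 2 / 4 := by
    intro r hr
    have h1 := h.pot_le (h.bu r t (hℓ.le.trans hr.1) ht)
    unfold eDen
    rw [← mul_sub, add_sub_cancel_left, abs_mul, abs_of_pos hwp]
    calc w * |V (u r t)| ≤ w * (Λ * ‖u r t‖ ^ 2) := by gcongr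
      _ = w * Λ * ‖u r t‖ ^ 2 := by ring
      _ ≤ 1 / 4 * ‖u r t‖ ^ 2 := by gcongr
      _ = _ := by ring
  refine ⟨?_, ?_, fun p hesc => ?_⟩
  · rw [hFeq]
    unfold Frame.G
    rw [← intervalIntegral.integral_const_mul]
    refine intervalIntegral.integral_mono_on hB (i4.const_mul c) ((j1.const_mul w).add j2)
      fun r hr => ?_
    have h1 := (abs_le.1 (hpt r hr)).1
    have h2 := mul_le_mul_of_nonneg_right hc3 (sq_nonneg ‖ur u r t‖)
    have h3 := mul_le_mul_of_nonneg_right hc1 (sq_nonneg ‖u r t‖)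
    have h4 := mul_le_mul_of_nonneg_left (show c * (‖u r t‖ ^ 2 + ‖ur u r t‖ ^ 2) ≤
      w * eDen V u r t + ‖u r t‖ ^ 2 / 2 by linarith) (f.wt_pos f.κ r t).le
    linarith
  · have hK1 : f.F V u w ℓ B t ≤ 1 * f.G u ℓ B t := by
      rw [hFeq]
      unfold Frame.G
      rw [← intervalIntegral.integral_const_mul]
      refine intervalIntegral.integral_mono_on hB ((j1.const_mul w).add j2) (i4.const_mul 1)
        fun r hr => ?_
      have h1 := (abs_le.1 (hpt r hr)).2
      have h2 := mul_le_mul_of_nonneg_right hw4 (sq_nonneg ‖ur u r t‖)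
      have h5 := sq_nonneg ‖ur u r t‖
      have h6 := sq_nonneg ‖u r t‖
      have h4 := mul_le_mul_of_nonneg_left (show w * eDen V u r t + ‖u r t‖ ^ 2 / 2 ≤
        1 * (‖u r t‖ ^ 2 + ‖ur u r t‖ ^ 2) by linarith) (f.wt_pos f.κ r t).le
      linarith
    refine hK1.trans (mul_le_mul_of_nonneg_right ?_ hG0)
    have : 0 ≤ K₂ * (1 + 2 / κ) + K₃ / κ := by positivity
    linarith
  have hE := h.hasDerivAt_energy hg hℓ hB ht
  have hM := h.hasDerivAt_mass hg hℓ hB ht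
  have hP := h.integral_deriv_inner hg hℓ hB ht
  refine ⟨_, (hE.const_mul w).add hM, ?_⟩
  have c3 : ContinuousOn (fun r => ut u r t) (uIcc ℓ B) := (h.continuousOn_ut_r ht).mono
    fun r hr => hℓ.trans_le (by rw [uIcc_of_le hB] at hr; exact hr.1)
  have c5 := hg.cont_r_left t
  have c6 := hg.cont_t_left t
  have c7 := h.continuous_grad
  have c9 : ContinuousOn (fun r : ℝ => ((d:ℝ) - 1) / r) (uIcc ℓ B) := by
    refine continuousOn_const.div continuousOn_id fun r hr => ?_
    rw [uIcc_of_le hB] at hr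
    exact (hℓ.trans_le hr.1).ne'
  have cY : ContinuousOn (fun r => ⟪ur u r t, ut u r t⟫) (uIcc ℓ B) := c2.continuousOn.inner c3
  have cW : ContinuousOn (fun r => ⟪u r t, ut u r t⟫) (uIcc ℓ B) := c1.continuousOn.inner c3
  have cT : ContinuousOn (fun r => ‖ut u r t‖ ^ 2) (uIcc ℓ B) := c3.norm.pow 2
  have cS : Continuous fun r => ⟪u r t, ur u r t⟫ := by fun_prop
  have cN : Continuous fun r => ⟪u r t, gradient V (u r t)⟫ := c1.inner (c7.comp c1)
  have i1 : IntervalIntegrable (fun r =>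
      f.wt f.κ r t * (-f.a ^ 2 - (f.a + f.β) * f.κ + (f.a + f.β) * ((f.a + 2 * f.κ) * f.sig r t)) *
        eDen V u r t - f.wt f.κ r t * (f.a + f.κ - (f.a + 2 * f.κ) * f.sig r t) *
        ⟪ur u r t, ut u r t⟫ - f.wt f.κ r t * ‖ut u r t‖ ^ 2 +
        ((d:ℝ) - 1) / r * f.wt f.κ r t * ⟪ur u r t, ut u r t⟫)
      volume ℓ B := ((((c6.continuousOn.mul c8.continuousOn).sub (c5.continuousOn.mul cY)).sub
    (c4.continuousOn.mul cT)).add ((c9.mul c4.continuousOn).mul cY)).intervalIntegrable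
  have i2 : IntervalIntegrable (fun r =>
      f.wt f.κ r t * (-f.a ^ 2 - (f.a + f.β) * f.κ + (f.a + f.β) * ((f.a + 2 * f.κ) * f.sig r t)) *
        (‖u r t‖ ^ 2 / 2) + f.wt f.κ r t * ⟪u r t, ut u r t⟫) volume ℓ B :=
    ((c6.mul cU).continuousOn.add (c4.continuousOn.mul cW)).intervalIntegrable
  have i3 : IntervalIntegrable (fun r =>
      f.wt f.κ r t * (f.a + f.κ - (f.a + 2 * f.κ) * f.sig r t) * ⟪u r t, ur u r t⟫ +
        f.wt f.κ r t * (‖ur u r t‖ ^ 2 + ⟪u r t, ut u r t⟫ + ⟪u r t, gradient V (u r t)⟫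
          - ((d:ℝ) - 1) / r * ⟪u r t, ur u r t⟫)) volume ℓ B :=
    ((c5.mul cS).continuousOn.add (c4.continuousOn.mul (((cX.continuousOn.add cW).add
      cN.continuousOn).sub (c9.mul cS.continuousOn)))).intervalIntegrable
  have i5 : IntervalIntegrable (fun r => f.wt f.κ r t) volume ℓ B := c4.intervalIntegrable ℓ B
  have hdens : ∀ r ∈ Icc ℓ B, ∀ e : ℝ,
      D.lmin / 2 * ‖u r t‖ ^ 2 - e ≤ ⟪u r t, gradient V (u r t)⟫ →
      (w * (f.wt f.κ r t * (-f.a ^ 2 - (f.a + f.β) * f.κ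
          + (f.a + f.β) * ((f.a + 2 * f.κ) * f.sig r t)) *
        eDen V u r t - f.wt f.κ r t * (f.a + f.κ - (f.a + 2 * f.κ) * f.sig r t) *
        ⟪ur u r t, ut u r t⟫ - f.wt f.κ r t * ‖ut u r t‖ ^ 2 +
        ((d:ℝ) - 1) / r * f.wt f.κ r t * ⟪ur u r t, ut u r t⟫)
      + (f.wt f.κ r t * (-f.a ^ 2 - (f.a + f.β) * f.κ
          + (f.a + f.β) * ((f.a + 2 * f.κ) * f.sig r t)) *
        (‖u r t‖ ^ 2 / 2) + f.wt f.κ r t * ⟪u r t, ut u r t⟫)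
      - (f.wt f.κ r t * (f.a + f.κ - (f.a + 2 * f.κ) * f.sig r t) * ⟪u r t, ur u r t⟫ +
        f.wt f.κ r t * (‖ur u r t‖ ^ 2 + ⟪u r t, ut u r t⟫ + ⟪u r t, gradient V (u r t)⟫
          - ((d:ℝ) - 1) / r * ⟪u r t, ur u r t⟫)))
      - (-c * (f.wt f.κ r t * (‖u r t‖ ^ 2 + ‖ur u r t‖ ^ 2))
        + ((d:ℝ) - 1) / ℓ * ((1 + w) * C ^ 2) * f.wt f.κ r t) ≤ e * f.wt f.κ r t := by
    intro r hr e he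
    have hr0 : 0 < r := hℓ.trans_le hr.1
    have b1 := h.bu r t hr0.le ht
    have b2 := h.bur r t hr0.le ht
    have b3 := h.but r t hr0.le ht
    have hY : ⟪ur u r t, ut u r t⟫ ≤ C ^ 2 := (real_inner_le_norm _ _).trans (by
      rw [pow_two]; exact mul_le_mul b2 b3 (norm_nonneg _) hC.le)
    have hS : ⟪u r t, ur u r t⟫ ≤ C ^ 2 := (real_inner_le_norm _ _).trans (by
      rw [pow_two]; exact mul_le_mul b1 b2 (norm_nonneg _) hC.le)
    obtain ⟨q, hq⟩ : ∃ q, q = f.a + f.κ - (f.a + 2 * f.κ) * f.sig r t := ⟨_, rfl⟩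
    have hs0 : 0 ≤ (f.a + 2 * f.κ) * f.sig r t := mul_nonneg (by linarith) (f.sig_nonneg r t)
    have hs1 : (f.a + 2 * f.κ) * f.sig r t ≤ f.a + 2 * f.κ :=
      mul_le_of_le_one_right (by linarith) (f.sig_le_one r t)
    have hsq1 := sq_nonneg ‖ut u r t + (q / 2) • ur u r t‖
    rw [norm_add_sq_real, norm_smul, mul_pow, Real.norm_eq_abs, sq_abs, real_inner_smul_right,
      real_inner_comm] at hsq1
    have hsq2 := sq_nonneg ‖q • u r t + ur u r t‖
    rw [norm_add_sq_real, norm_smul, mul_pow, Real.norm_eq_abs, sq_abs,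
      real_inner_smul_left] at hsq2
    have fin := firewall_density_ineq (p := q)
      (τ := -f.a ^ 2 - (f.a + f.β) * f.κ + (f.a + f.β) * ((f.a + 2 * f.κ) * f.sig r t))
      (v := V (u r t)) (T := ‖ut u r t‖ ^ 2)
      (f.wt_pos f.κ r t).le hκ hf.κ_le hf.a_le hf.β_nonneg hf.β_le hlam
      (by rw [← hf.κ_eq]; linarith) (by rw [← hf.κ_eq]; linarith) (by rw [hq]; ring)
      (sq_nonneg ‖ur u r t‖) (sq_nonneg ‖u r t‖) (h.pot_le b1) hY hS (div_nonneg hd hr0.le)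
      (div_le_div_of_nonneg_left hd hℓ hr.1) hwp.le (sq_nonneg C) (hTT ▸ hw1) (hTT ▸ hw2)
      (by linarith) (by linarith) he hc1 hc2
    rw [← hq]
    unfold eDen
    linarith
  have hinner : ∀ r ∈ Icc ℓ B, D.lmin / 2 * ‖u r t‖ ^ 2 - K₃ ≤ ⟪u r t, gradient V (u r t)⟫ := by
    intro r hr
    have hr0 : 0 < r := hℓ.trans_le hr.1
    have b1 := h.bu r t hr0.le ht
    have hN := (abs_le.1 ((abs_real_inner_le_norm (u r t) (gradient V (u r t))).trans
      (mul_le_mul_of_nonneg_left (h.grad_le b1) (norm_nonneg _)))).1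
    have b4 : (D.lmin / 2 + Λ) * ‖u r t‖ ^ 2 ≤ K₃ := by
      rw [hK₃]; gcongr
    linarith
  have src := integral_indicator_exp_le (A := f.a + f.κ) (by linarith) hB (f.orig t + p)
    (-(f.a + f.κ) * f.orig t - f.κ * f.cut t)
    (((((i1.const_mul w).add i2).sub i3).sub ((i4.const_mul (-c)).add (i5.const_mul
      (((d:ℝ) - 1) / ℓ * ((1 + w) * C ^ 2))))).const_mul K₃⁻¹)
    (fun r hr _ => by
      refine (mul_le_mul_of_nonneg_left (hdens r hr K₃ (hinner r hr)) (by positivity)).trans ?_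
      rw [inv_mul_cancel_left₀ hK₃p.ne']
      refine (f.wt_le_exp f.κ r t).trans (le_of_eq ?_)
      unfold Frame.dist
      congr 1
      ring)
    (fun r hr hrY => by
      have := hdens r hr 0 (by
        rw [sub_zero]
        exact inner_gradient_ge h.contDiff D h0 (hesc r hr hrY))
      rw [zero_mul] at this
      exact mul_nonpos_of_nonneg_of_nonpos (by positivity) this)
  rw [intervalIntegral.integral_const_mul, intervalIntegral.integral_sub
    (((i1.const_mul w).add i2).sub i3) ((i4.const_mul (-c)).add (i5.const_mul _)),
    intervalIntegral.integral_sub ((i1.const_mul w).add i2) i3,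
    intervalIntegral.integral_add (i1.const_mul w) i2,
    intervalIntegral.integral_add (i4.const_mul (-c)) (i5.const_mul _),
    intervalIntegral.integral_const_mul, intervalIntegral.integral_const_mul,
    intervalIntegral.integral_const_mul, hP, inv_mul_le_iff₀ hK₃p] at src
  have hGdef : f.G u ℓ B t = ∫ r in ℓ..B, f.wt f.κ r t * (‖u r t‖ ^ 2 + ‖ur u r t‖ ^ 2) := rfl
  rw [← hGdef] at src
  have hexp : K₃ * (Real.exp ((f.a + f.κ) * (f.orig t + p) + (-(f.a + f.κ) * f.orig t
      - f.κ * f.cut t)) / (f.a + f.κ)) ≤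
      K₃ / κ * Real.exp ((f.a + κ) * p - κ * f.cut t) := by
    rw [show (f.a + f.κ) * (f.orig t + p) + (-(f.a + f.κ) * f.orig t - f.κ * f.cut t) =
      (f.a + κ) * p - κ * f.cut t by rw [hf.κ_eq]; ring, div_mul_eq_mul_div, mul_div_assoc]
    gcongr
    rw [hf.κ_eq]; linarith
  have hbd : ∀ r, 0 < r → |w * ⟪ur u r t, ut u r t⟫ + ⟪u r t, ur u r t⟫| ≤ K₂ := by
    intro r hr
    have b1 := h.bu r t hr.le ht
    have b2 := h.bur r t hr.le ht
    have b3 := h.but r t hr.le ht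
    have hY : |⟪ur u r t, ut u r t⟫| ≤ C ^ 2 := (abs_real_inner_le_norm _ _).trans (by
      rw [pow_two]; exact mul_le_mul b2 b3 (norm_nonneg _) hC.le)
    have hS : |⟪u r t, ur u r t⟫| ≤ C ^ 2 := (abs_real_inner_le_norm _ _).trans (by
      rw [pow_two]; exact mul_le_mul b1 b2 (norm_nonneg _) hC.le)
    calc _ ≤ |w * ⟪ur u r t, ut u r t⟫| + |⟪u r t, ur u r t⟫| := abs_add_le _ _
      _ ≤ w * C ^ 2 + C ^ 2 := by rw [abs_mul, abs_of_pos hwp]; gcongr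
      _ = 1 * ((1 + w) * C ^ 2) := by ring
      _ ≤ K₂ := by rw [hK₂]; gcongr; linarith
  have hb1 := mul_le_mul_of_nonneg_left (abs_le.1 (hbd B (hℓ.trans_le hB))).2
    (f.wt_pos f.κ B t).le
  have hb2 := mul_le_mul_of_nonneg_left (abs_le.1 (hbd ℓ hℓ)).1 (f.wt_pos f.κ ℓ t).le
  have herr := mul_le_mul_of_nonneg_left
    (Frame.wt_err_le hf hκ'.le le_rfl hℓ hB t) hK₂p.le
  have hcoef : ((d:ℝ) - 1) / ℓ * ((1 + w) * C ^ 2) ≤ K₂ * (1 / ℓ) := by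
    rw [hK₂, div_mul_eq_mul_div, mul_one_div]
    gcongr
    linarith
  have hint0 : 0 ≤ ∫ r in ℓ..B, f.wt f.κ r t :=
    intervalIntegral.integral_nonneg hB fun r _ => (f.wt_pos f.κ r t).le
  have hcoef' := mul_le_mul_of_nonneg_right hcoef hint0
  have herr0 : 0 ≤ f.err ℓ B t := by unfold Frame.err; positivity
  have hexp0 := Real.exp_pos ((f.a + κ) * p - κ * f.cut t)
  have p1 : 0 ≤ (1 + K₃ / κ) * f.err ℓ B t := by positivity
  have p2 : 0 ≤ (1 + K₂ * (1 + 2 / κ)) * Real.exp ((f.a + κ) * p - κ * f.cut t) := by positivity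
  linarith

end SolBound

/-! ### Integrated estimates along a time interval -/

lemma tsource_increment_le {ω τ t₁ t₂ k : ℝ}
    (hω : (ω < 0 ∧ τ ≤ t₁) ∨ (0 < ω ∧ t₂ ≤ τ)) :
    Real.exp (k + ω * (t₂ - τ)) / ω - Real.exp (k + ω * (t₁ - τ)) / ω ≤ Real.exp k / |ω| := by
  have p1 := Real.exp_pos (k + ω * (t₁ - τ))
  have p2 := Real.exp_pos (k + ω * (t₂ - τ))
  rcases hω with ⟨hω, ht⟩ | ⟨hω, ht⟩
  · rw [abs_of_neg hω, div_neg, ← sub_div]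
    rw [div_le_iff_of_neg hω, neg_mul, div_mul_cancel₀ _ hω.ne]
    have : Real.exp (k + ω * (t₁ - τ)) ≤ Real.exp k := by
      rw [Real.exp_le_exp]
      linarith [mul_nonpos_of_nonpos_of_nonneg hω.le (sub_nonneg.2 ht)]
    linarith
  · rw [abs_of_pos hω, ← sub_div]
    have : Real.exp (k + ω * (t₂ - τ)) ≤ Real.exp k := by
      rw [Real.exp_le_exp]
      linarith [mul_nonpos_of_nonneg_of_nonpos hω.le (sub_nonpos.2 ht)]
    gcongr
    linarith

namespace Frame

lemma err_nonneg (f : Frame) {ℓ : ℝ} (hℓ : 0 < ℓ) (B t : ℝ) : 0 ≤ f.err ℓ B t := by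
  unfold err; positivity

lemma G_nonneg (f : Frame) (u : ℝ → ℝ → Euc n) {ℓ B : ℝ} (hB : ℓ ≤ B) (t : ℝ) :
    0 ≤ f.G u ℓ B t :=
  intervalIntegral.integral_nonneg hB fun r _ => mul_nonneg (f.wt_pos _ r t).le (by positivity)

end Frame

namespace SolBound

variable {d : ℕ} {V : Euc n → ℝ} {u : ℝ → ℝ → Euc n} {C Λ : ℝ}

lemma continuousOn_D (h : SolBound d V u C Λ) (f : Frame) {ℓ B : ℝ} (hℓ : 0 < ℓ) (hB : ℓ ≤ B) :
    ContinuousOn (fun t => f.D u ℓ B t) (Ioi 0) := by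
  refine continuousOn_weighted (f.isWeight_wt 0) (M := (C + |f.a| * C) ^ 2) hℓ hB
    (fun t ht => ?_) (fun r hr => ?_) (fun r hr t ht => ?_)
  · exact ((h.continuousOn_ut_r ht).add
      ((h.continuous_ur ht).continuousOn.const_smul f.a)).norm.pow 2
  · exact ((h.sol.cont_t r).add ((h.continuousOn_ur_t hr.le).const_smul f.a)).norm.pow 2
  · rw [abs_of_nonneg (sq_nonneg _)]
    refine pow_le_pow_left₀ (norm_nonneg _) ((norm_add_le _ _).trans ?_) 2
    rw [norm_smul, Real.norm_eq_abs]
    have := h.but r t hr.le ht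
    have := h.bur r t hr.le ht
    gcongr

lemma exists_run (h : SolBound d V u C Λ) (D : EscData n V) (h0 : (0 : Euc n) ∈ MinSet V)
    {κ A β₀ : ℝ} (hA : 0 < A) (hκ : 0 < κ) (hβ₀ : 0 ≤ β₀)
    (hlam : (A + κ) * (κ + β₀) ≤ D.lmin / 4) :
    ∃ K > (0:ℝ), ∀ f : Frame, f.Adm κ A β₀ → ∀ ℓ B t₁ t₂ η P γ ω : ℝ, 0 < ℓ → ℓ ≤ B → 0 < t₁ →
      t₁ ≤ t₂ → (∀ t ∈ Icc t₁ t₂, f.err ℓ B t ≤ η) → ω = (f.a + κ) * γ - κ * f.β →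
      (ω < 0 ∧ f.τ ≤ t₁) ∨ (0 < ω ∧ t₂ ≤ f.τ) →
      (∀ t ∈ Icc t₁ t₂, ∀ r ∈ Icc ℓ B, f.orig t + (P + γ * (t - f.τ)) < r →
        ‖u r t‖ ≤ D.dEsc) →
      f.G u ℓ B t₂ ≤
        K * (f.G u ℓ B t₁ + Real.exp ((f.a + κ) * P - κ * f.x) / |ω| + η * (t₂ - t₁)) ∧
      (∫ t in t₁..t₂, f.D u ℓ B t) + 2 * f.E V u ℓ B t₂ ≤ 2 * f.E V u ℓ B t₁ +
        K * (f.G u ℓ B t₁ + Real.exp ((f.a + κ) * P - κ * f.x) / |ω| + η * (t₂ - t₁)) := by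
  obtain ⟨K, hK, hE⟩ := h.exists_energy_deriv_le hA hκ hβ₀
  obtain ⟨K', hK', c, hc, w, hF⟩ := h.exists_firewall D h0 hA hκ hβ₀ hlam
  refine ⟨K' / c + 2 * K + 2 * (K / c) * K', by positivity,
    fun f hf ℓ B t₁ t₂ η P γ ω hℓ hB ht₁ h12 hη hω hcase hesc => ?_⟩
  obtain ⟨k, hk⟩ : ∃ k, k = (f.a + κ) * P - κ * f.x := ⟨_, rfl⟩
  rw [← hk]
  have hω0 : ω ≠ 0 := by rcases hcase with hh | hh <;> [exact hh.1.ne; exact hh.1.ne']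
  have hsrc : ∀ t, Real.exp ((f.a + κ) * (P + γ * (t - f.τ)) - κ * f.cut t) =
      Real.exp (k + ω * (t - f.τ)) := fun t => by
    congr 1; rw [hω, hk]; unfold Frame.cut; ring
  have hpos : ∀ t ∈ Icc t₁ t₂, 0 < t := fun t ht => ht₁.trans_le ht.1
  choose! E' hE1 hE2 using fun t (ht : t ∈ Icc t₁ t₂) => hE f hf ℓ B t hℓ hB (hpos t ht)
  choose! F' hF1 hF2 using fun t (ht : t ∈ Icc t₁ t₂) =>
    (hF f hf ℓ B t hℓ hB (hpos t ht)).2.2 _ (hesc t ht)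
  have hdS : ∀ t, HasDerivAt (fun t => Real.exp (k + ω * (t - f.τ)) / ω + η * t)
      (Real.exp (k + ω * (t - f.τ)) + η) t := fun t => by
    have h1 : HasDerivAt (fun t => k + ω * (t - f.τ)) ω t :=
      ((((hasDerivAt_id t).sub_const f.τ).const_mul ω).const_add k).congr_deriv (by ring)
    have h2 : HasDerivAt (fun t : ℝ => η * t) η t :=
      ((hasDerivAt_id t).const_mul η).congr_deriv (by ring)
    exact ((h1.exp.div_const ω).add h2).congr_deriv (by field_simp)
  have hinc := tsource_increment_le (k := k) hcase
  have hmem₁ : t₁ ∈ Icc t₁ t₂ := ⟨le_rfl, h12⟩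
  have hmem₂ : t₂ ∈ Icc t₁ t₂ := ⟨h12, le_rfl⟩
  have G0 := fun t => f.G_nonneg u hB t
  obtain ⟨X, hX⟩ : ∃ X, X = Real.exp k / |ω| + η * (t₂ - t₁) := ⟨_, rfl⟩
  have hη0 : 0 ≤ η := (f.err_nonneg hℓ B t₁).trans (hη t₁ hmem₁)
  have hX0 : 0 ≤ X := by
    have : 0 ≤ t₂ - t₁ := by linarith
    rw [hX]; positivity
  have hF0 : ∀ t ∈ Icc t₁ t₂, 0 ≤ f.F V u w ℓ B t := fun t ht =>
    (mul_nonneg hc.le (G0 t)).trans (hF f hf ℓ B t hℓ hB (hpos t ht)).1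
  -- increments
  have hFinc : f.F V u w ℓ B t₂ ≤ f.F V u w ℓ B t₁ + K' * X := by
    have hd : ∀ t ∈ Icc t₁ t₂, HasDerivAt (fun t => f.F V u w ℓ B t -
        K' * (Real.exp (k + ω * (t - f.τ)) / ω + η * t))
        (F' t - K' * (Real.exp (k + ω * (t - f.τ)) + η)) t := fun t ht =>
      (hF1 t ht).sub ((hdS t).const_mul K')
    have := intervalIntegral.sub_le_integral_of_hasDeriv_right_of_le h12
      (φ := fun _ => (0:ℝ)) (fun t ht => (hd t ht).continuousAt.continuousWithinAt)
      (fun t ht => (hd t (Ioo_subset_Icc_self ht)).hasDerivWithinAt) (by simp) (fun t ht => by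
        have hm := Ioo_subset_Icc_self ht
        have h1 := hF2 t hm
        rw [hsrc] at h1
        have h2 := mul_nonneg hc.le (G0 t)
        have h3 := mul_le_mul_of_nonneg_left (hη t hm) hK'.le
        linarith)
    rw [intervalIntegral.integral_zero] at this
    have h3 := mul_le_mul_of_nonneg_left hinc hK'.le
    rw [hX]
    linarith
  have hEinc : (∫ t in t₁..t₂, f.D u ℓ B t) + 2 * f.E V u ℓ B t₂ ≤ 2 * f.E V u ℓ B t₁ +
      (2 * (K / c) * f.F V u w ℓ B t₁ + (2 * K + 2 * (K / c) * K') * X) := by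
    have hd : ∀ t ∈ Icc t₁ t₂, HasDerivAt (fun t => f.E V u ℓ B t + K / c * f.F V u w ℓ B t -
        (K / c * K' * (Real.exp (k + ω * (t - f.τ)) / ω + η * t) + K * η * t))
        (E' t + K / c * F' t - (K / c * K' * (Real.exp (k + ω * (t - f.τ)) + η) + K * η)) t :=
      fun t ht => by
        have h2 : HasDerivAt (fun t : ℝ => K * η * t) (K * η) t :=
          ((hasDerivAt_id t).const_mul (K * η)).congr_deriv (by ring)
        exact ((hE1 t ht).add ((hF1 t ht).const_mul (K / c))).sub
          (((hdS t).const_mul (K / c * K')).add h2)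
    have hD : ContinuousOn (fun t => -(1 / 2) * f.D u ℓ B t) (Icc t₁ t₂) :=
      continuousOn_const.mul ((h.continuousOn_D f hℓ hB).mono fun t ht => hpos t ht)
    have := intervalIntegral.sub_le_integral_of_hasDeriv_right_of_le h12
      (φ := fun t => -(1 / 2) * f.D u ℓ B t)
      (fun t ht => (hd t ht).continuousAt.continuousWithinAt)
      (fun t ht => (hd t (Ioo_subset_Icc_self ht)).hasDerivWithinAt)
      (hD.integrableOn_compact isCompact_Icc) (fun t ht => by
        have hm := Ioo_subset_Icc_self ht
        have h1 := mul_le_mul_of_nonneg_left (hF2 t hm) (by positivity : 0 ≤ K / c)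
        rw [hsrc] at h1
        have h2 := hE2 t hm
        have h3 := mul_le_mul_of_nonneg_left (hη t hm) (by positivity : 0 ≤ K / c * K')
        have h4 := mul_le_mul_of_nonneg_left (hη t hm) hK.le
        have h5 : K / c * (-c * f.G u ℓ B t) = -K * f.G u ℓ B t := by field_simp
        rw [mul_add, h5] at h1
        linarith)
    rw [intervalIntegral.integral_const_mul] at this
    have h3 := mul_le_mul_of_nonneg_left hinc (by positivity : 0 ≤ K / c * K')
    have h6 := mul_nonneg (by positivity : 0 ≤ K / c) (hF0 t₂ hmem₂)
    have h7 : 0 ≤ K * (Real.exp k / |ω|) := by positivity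
    rw [hX]
    linarith
  have hFG := (hF f hf ℓ B t₁ hℓ hB ht₁).2.1
  rw [add_assoc (f.G u ℓ B t₁), ← hX]
  have hG1 := G0 t₁
  constructor
  · have h1 := (hF f hf ℓ B t₂ hℓ hB (hpos t₂ hmem₂)).1
    have h2 : f.G u ℓ B t₂ ≤ K' / c * (f.G u ℓ B t₁ + X) := by
      rw [div_mul_eq_mul_div, le_div_iff₀ hc]
      linarith
    refine h2.trans ?_
    have : 0 ≤ (2 * K + 2 * (K / c) * K') * (f.G u ℓ B t₁ + X) := by positivity
    linarith
  · have h1 := mul_le_mul_of_nonneg_left hFG (by positivity : 0 ≤ 2 * (K / c))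
    have p1 : 0 ≤ K' / c * (f.G u ℓ B t₁ + X) := by positivity
    have p2 : 0 ≤ 2 * K * f.G u ℓ B t₁ := by positivity
    linarith

lemma abs_E_le (h : SolBound d V u C Λ) {κ A β₀ : ℝ} {f : Frame} (hf : f.Adm κ A β₀)
    {ℓ B t : ℝ} (hℓ : 0 < ℓ) (hB : ℓ ≤ B) (ht : 0 < t) :
    |f.E V u ℓ B t| ≤ (1 + Λ) * C ^ 2 * (2 / κ) * Real.exp (f.a * f.cut t) := by
  have hκ' : 0 < f.κ := hf.κ_eq ▸ hf.κ_pos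
  have hΛ := h.Λ_pos
  have c4 := (f.isWeight_wt 0).cont_left t
  have h1 : |f.E V u ℓ B t| ≤ ∫ r in ℓ..B, f.wt 0 r t * ((1 + Λ) * C ^ 2) := by
    refine (intervalIntegral.abs_integral_le_integral_abs hB).trans ?_
    refine intervalIntegral.integral_mono_on hB
      ((c4.mul (h.continuous_eDen ht)).abs.intervalIntegrable _ _)
      (Continuous.intervalIntegrable (by fun_prop) _ _) fun r hr => ?_
    rw [abs_mul, abs_of_pos (f.wt_pos 0 r t)]
    exact mul_le_mul_of_nonneg_left (h.eDen_bdd (hℓ.le.trans hr.1) ht) (f.wt_pos 0 r t).le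
  rw [intervalIntegral.integral_mul_const] at h1
  have h2 := mul_le_mul_of_nonneg_right (Frame.integral_wt_le hf le_rfl hκ'.le hB t)
    (by positivity : 0 ≤ (1 + Λ) * C ^ 2)
  linarith

lemma G_le (h : SolBound d V u C Λ) {κ A β₀ : ℝ} {f : Frame} (hf : f.Adm κ A β₀)
    {ℓ B t : ℝ} (hℓ : 0 < ℓ) (hB : ℓ ≤ B) (ht : 0 < t) :
    f.G u ℓ B t ≤ 2 * C ^ 2 * (2 / κ) * Real.exp (f.a * f.cut t) := by
  have hκ' : 0 < f.κ := hf.κ_eq ▸ hf.κ_pos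
  have c4 := (f.isWeight_wt f.κ).cont_left t
  have c1 := h.continuous_u ht
  have c2 := h.continuous_ur ht
  have h1 : f.G u ℓ B t ≤ ∫ r in ℓ..B, f.wt f.κ r t * (2 * C ^ 2) := by
    refine intervalIntegral.integral_mono_on hB
      (Continuous.intervalIntegrable (by fun_prop) _ _)
      (Continuous.intervalIntegrable (by fun_prop) _ _) fun r hr => ?_
    have b1 := pow_le_pow_left₀ (norm_nonneg _) (h.bu r t (hℓ.le.trans hr.1) ht) 2
    have b2 := pow_le_pow_left₀ (norm_nonneg _) (h.bur r t (hℓ.le.trans hr.1) ht) 2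
    exact mul_le_mul_of_nonneg_left (by linarith) (f.wt_pos _ r t).le
  rw [intervalIntegral.integral_mul_const] at h1
  have h2 := mul_le_mul_of_nonneg_right (Frame.integral_wt_le hf hκ'.le le_rfl hB t)
    (by positivity : 0 ≤ 2 * C ^ 2)
  linarith

lemma neg_E_le (h : SolBound d V u C Λ) (D : EscData n V) (h0 : (0 : Euc n) ∈ MinSet V)
    {κ A β₀ : ℝ} {f : Frame} (hf : f.Adm κ A β₀)
    {ℓ B t : ℝ} (hℓ : 0 < ℓ) (hB : ℓ ≤ B) (ht : 0 < t) {p : ℝ}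
    (hesc : ∀ r ∈ Icc ℓ B, f.orig t + p < r → ‖u r t‖ ≤ D.dEsc) :
    -f.E V u ℓ B t ≤ (1 + Λ) * C ^ 2 / κ * Real.exp (f.a * p) := by
  have hκ := hf.κ_pos
  have ha : 0 < f.a := hκ.trans_le hf.κ_le
  have hΛ := h.Λ_pos
  have hC := h.C_pos
  obtain ⟨M, hM⟩ : ∃ M, M = (1 + Λ) * C ^ 2 := ⟨_, rfl⟩
  have hMp : 0 < M := by rw [hM]; positivity
  have c4 := (f.isWeight_wt 0).cont_left t
  have hi : IntervalIntegrable (fun r => f.wt 0 r t * eDen V u r t) volume ℓ B :=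
    (c4.mul (h.continuous_eDen ht)).intervalIntegrable _ _
  have := integral_indicator_exp_le ha hB (f.orig t + p) (-f.a * f.orig t)
    (hi.const_mul (-M⁻¹)) (fun r hr _ => by
      have h1 := (abs_le.1 (h.eDen_bdd (hℓ.le.trans hr.1) ht)).1
      rw [← hM] at h1
      have h2 := mul_le_mul_of_nonneg_left h1 (f.wt_pos 0 r t).le
      have h3 : -M⁻¹ * (f.wt 0 r t * eDen V u r t) ≤ f.wt 0 r t := by
        rw [neg_mul, ← mul_neg, inv_mul_le_iff₀ hMp]
        linarith
      refine h3.trans ((f.wt_le_exp 0 r t).trans (le_of_eq ?_))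
      congr 1; ring)
    (fun r hr hrY => by
      have h1 := potential_nonneg_of_le h.contDiff D h0 h.pot0 (hesc r hr hrY)
      have h2 : 0 ≤ eDen V u r t := by unfold eDen; positivity
      have h3 := mul_nonneg (f.wt_pos 0 r t).le h2
      rw [neg_mul]
      exact neg_nonpos.2 (mul_nonneg (by positivity) h3))
  rw [intervalIntegral.integral_const_mul, neg_mul, ← mul_neg, inv_mul_le_iff₀ hMp,
    show f.a * (f.orig t + p) + -f.a * f.orig t = f.a * p by ring] at this
  refine this.trans ?_
  rw [← hM, ← mul_div_assoc, div_mul_eq_mul_div]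
  gcongr
  exact hf.κ_le

end SolBound

/-! ### The firewall functional in the laboratory frame -/

lemma kappa0_pos {l : ℝ} (hl : 0 < l) : 0 < kappa0 l := by unfold kappa0; positivity

lemma rsc_pos {d : ℕ} (hd : 2 ≤ d) (l : ℝ) : 0 < rsc d l := by
  have : (2:ℝ) ≤ d := by exact_mod_cast hd
  exact lt_of_lt_of_le (by linarith) (le_max_left _ _)

lemma wV_le_one (V : Euc n → ℝ) : wV V ≤ 1 := by
  unfold wV
  rw [div_le_one (lt_of_lt_of_le one_pos (le_max_left _ _))]
  exact le_max_left _ _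

lemma Tpsi_nonneg {d : ℕ} (hd : 2 ≤ d) (l ρ : ℝ) {r : ℝ} (hr : 0 ≤ r) : 0 ≤ Tpsi d l ρ r := by
  have := rsc_pos hd l
  unfold Tpsi
  split_ifs <;> positivity

lemma Tpsi_le {d : ℕ} (hd : 2 ≤ d) (l ρ : ℝ) {r : ℝ} (hr : 0 ≤ r) :
    Tpsi d l ρ r ≤ Real.exp (-(kappa0 l) * |r - ρ|) := by
  have h := rsc_pos hd l
  unfold Tpsi
  split_ifs with h1
  · refine mul_le_of_le_one_right (Real.exp_pos _).le (pow_le_one₀ (by positivity) ?_)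
    rw [div_le_one h]
    exact h1
  · exact le_rfl

lemma Tpsi_of_le {d : ℕ} (hd : 2 ≤ d) {l ρ r : ℝ} (hρ : rsc d l ≤ ρ) (hr : ρ ≤ r) :
    Tpsi d l ρ r = Real.exp (-(kappa0 l) * (r - ρ)) := by
  have h := rsc_pos hd l
  unfold Tpsi
  rw [abs_of_nonneg (sub_nonneg.2 hr)]
  split_ifs with h1
  · have : r = rsc d l := le_antisymm h1 (hρ.trans hr)
    rw [this, div_self h.ne', one_pow, mul_one]
  · rfl

lemma measurable_Tpsi (d : ℕ) (l ρ : ℝ) : Measurable (Tpsi d l ρ) := by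
  unfold Tpsi
  refine Measurable.ite measurableSet_Iic ?_ ?_
  · exact (by fun_prop : Continuous fun r : ℝ =>
      Real.exp (-(kappa0 l) * |r - ρ|) * (r / rsc d l) ^ (d - 1)).measurable
  · exact (by fun_prop : Continuous fun r : ℝ => Real.exp (-(kappa0 l) * |r - ρ|)).measurable

lemma integrable_exp_neg_abs {k : ℝ} (hk : 0 < k) (ρ : ℝ) :
    Integrable fun r : ℝ => Real.exp (-k * |r - ρ|) := by
  have h1 : Integrable fun r : ℝ => Real.exp (-k * |r|) := by
    rw [← integrableOn_univ, ← Iic_union_Ioi (a := (0:ℝ))]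
    refine IntegrableOn.union ?_ ?_
    · refine (integrableOn_exp_mul_Iic hk 0).congr_fun (fun r hr => ?_) measurableSet_Iic
      simp only
      rw [abs_of_nonpos hr]; ring_nf
    · refine (integrableOn_exp_mul_Ioi (neg_lt_zero.2 hk) 0).congr_fun (fun r hr => ?_)
        measurableSet_Ioi
      simp only
      rw [abs_of_pos hr]
  exact h1.comp_sub_right ρ

lemma integral_univ_exp_neg_abs {k : ℝ} (hk : 0 < k) (ρ : ℝ) :
    ∫ r : ℝ, Real.exp (-k * |r - ρ|) = 2 / k := by
  rw [integral_sub_right_eq_self (fun r : ℝ => Real.exp (-k * |r|)) ρ]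
  rw [integral_comp_abs (f := fun r => Real.exp (-k * r)), integral_exp_mul_Ioi (neg_lt_zero.2 hk) 0]
  simp [div_eq_mul_inv]

lemma setIntegral_Tpsi_le {d : ℕ} (hd : 2 ≤ d) {l : ℝ} (hl : 0 < l) (ρ : ℝ) {s : Set ℝ}
    (hs : MeasurableSet s) (hs0 : s ⊆ Ici 0) {Y : ℝ} (hY : ∀ r ∈ s, Y ≤ |r - ρ|) :
    ∫ r in s, Tpsi d l ρ r ≤ Real.exp (-(kappa0 l / 2) * Y) * (4 / kappa0 l) := by
  have hκ := kappa0_pos hl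
  have hκ2 : 0 < kappa0 l / 2 := by positivity
  have hi := (integrable_exp_neg_abs hκ2 ρ).const_mul (Real.exp (-(kappa0 l / 2) * Y))
  calc ∫ r in s, Tpsi d l ρ r
      ≤ ∫ r in s, Real.exp (-(kappa0 l / 2) * Y) * Real.exp (-(kappa0 l / 2) * |r - ρ|) := by
        refine integral_mono_of_nonneg ?_ hi.integrableOn ?_
        · exact (ae_restrict_iff' hs).2 (Eventually.of_forall fun r hr => Tpsi_nonneg hd l ρ (hs0 hr))
        · refine (ae_restrict_iff' hs).2 (Eventually.of_forall fun r hr => ?_)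
          refine (Tpsi_le hd l ρ (hs0 hr)).trans ?_
          simp only
          rw [← Real.exp_add, Real.exp_le_exp]
          have := mul_le_mul_of_nonneg_left (hY r hr) hκ2.le
          linarith
    _ ≤ ∫ r, Real.exp (-(kappa0 l / 2) * Y) * Real.exp (-(kappa0 l / 2) * |r - ρ|) :=
        setIntegral_le_integral hi (Eventually.of_forall fun r => by positivity)
    _ = _ := by
        rw [integral_const_mul, integral_univ_exp_neg_abs hκ2]
        congr 1
        field_simp
        norm_num

namespace SolBound

variable {d : ℕ} {V : Euc n → ℝ} {u : ℝ → ℝ → Euc n} {C Λ : ℝ}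

/-- The integrand of the firewall, without its weight. -/
def fireDen (V : Euc n → ℝ) (u : ℝ → ℝ → Euc n) (r t : ℝ) : ℝ :=
  wV V * (‖ur u r t‖ ^ 2 / 2 + V (u r t)) + ‖u r t‖ ^ 2 / 2

/-- The squared `H¹` density. -/
def qDen (u : ℝ → ℝ → Euc n) (r t : ℝ) : ℝ := ‖u r t‖ ^ 2 + ‖ur u r t‖ ^ 2

lemma qDen_nonneg (u : ℝ → ℝ → Euc n) (r t : ℝ) : 0 ≤ qDen u r t := by unfold qDen; positivity

lemma continuous_qDen (h : SolBound d V u C Λ) {t : ℝ} (ht : 0 < t) :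
    Continuous fun r => qDen u r t :=
  ((h.continuous_u ht).norm.pow 2).add ((h.continuous_ur ht).norm.pow 2)

lemma qDen_le (h : SolBound d V u C Λ) {r t : ℝ} (hr : 0 ≤ r) (ht : 0 < t) :
    qDen u r t ≤ 2 * C ^ 2 := by
  have h1 := pow_le_pow_left₀ (norm_nonneg _) (h.bu r t hr ht) 2
  have h2 := pow_le_pow_left₀ (norm_nonneg _) (h.bur r t hr ht) 2
  unfold qDen
  linarith

lemma continuous_fireDen (h : SolBound d V u C Λ) {t : ℝ} (ht : 0 < t) :
    Continuous fun r => fireDen V u r t :=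
  ((h.continuous_eDen ht).const_mul _).add (((h.continuous_u ht).norm.pow 2).div_const 2)

lemma fireDen_ge (h : SolBound d V u C Λ) (hc : HCoerc V) (h0 : (0 : Euc n) ∈ MinSet V)
    (r t : ℝ) : min (wV V / 2) (1 / 4) * qDen u r t ≤ fireDen V u r t := by
  have h1 := wV_potential_add_nonneg h.contDiff hc h0 h.pot0 (u r t)
  have h2 := mul_le_mul_of_nonneg_right (min_le_left (wV V / 2) (1 / 4)) (sq_nonneg ‖ur u r t‖)
  have h3 := mul_le_mul_of_nonneg_right (min_le_right (wV V / 2) (1 / 4)) (sq_nonneg ‖u r t‖)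
  unfold qDen fireDen
  linarith

lemma fireDen_nonneg (h : SolBound d V u C Λ) (hc : HCoerc V) (h0 : (0 : Euc n) ∈ MinSet V)
    (r t : ℝ) : 0 ≤ fireDen V u r t := by
  refine le_trans ?_ (h.fireDen_ge hc h0 r t)
  have := wV_pos (V := V)
  have := qDen_nonneg u r t
  positivity

lemma fireDen_le (h : SolBound d V u C Λ) {r t : ℝ} (hr : 0 ≤ r) (ht : 0 < t) :
    fireDen V u r t ≤ (1 + Λ) * qDen u r t := by
  have h1 := (le_abs_self _).trans (h.eDen_le hr ht)
  have hw := wV_pos (V := V)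
  have h2 := mul_le_mul_of_nonneg_left h1 hw.le
  have h3 : wV V * (‖ur u r t‖ ^ 2 / 2 + Λ * ‖u r t‖ ^ 2) ≤
      ‖ur u r t‖ ^ 2 / 2 + Λ * ‖u r t‖ ^ 2 :=
    mul_le_of_le_one_left (by have := h.Λ_pos; positivity) (wV_le_one V)
  have h4 : 0 ≤ Λ * ‖ur u r t‖ ^ 2 := by have := h.Λ_pos; positivity
  unfold eDen at h2
  unfold qDen fireDen
  linarith [sq_nonneg ‖u r t‖, sq_nonneg ‖ur u r t‖]

lemma integrableOn_fire (h : SolBound d V u C Λ) (hd : 2 ≤ d) (hc : HCoerc V)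
    (h0 : (0 : Euc n) ∈ MinSet V) {l : ℝ} (hl : 0 < l) (ρ : ℝ) {t : ℝ} (ht : 0 < t) :
    IntegrableOn (fun r => Tpsi d l ρ r * fireDen V u r t) (Ioi 0) := by
  have hi := ((integrable_exp_neg_abs (kappa0_pos hl) ρ).mul_const
    ((1 + Λ) * (2 * C ^ 2))).integrableOn (s := Ioi 0)
  refine Integrable.mono' hi
    ((measurable_Tpsi d l ρ).mul (h.continuous_fireDen ht).measurable).aestronglyMeasurable ?_
  refine (ae_restrict_iff' measurableSet_Ioi).2 (Eventually.of_forall fun r hr => ?_)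
  have hr0 : (0:ℝ) ≤ r := le_of_lt hr
  have p1 := Tpsi_nonneg hd l ρ hr0
  have p2 := h.fireDen_nonneg hc h0 r t
  rw [Real.norm_of_nonneg (mul_nonneg p1 p2)]
  refine mul_le_mul (Tpsi_le hd l ρ hr0) ?_ p2 (Real.exp_pos _).le
  exact (h.fireDen_le hr0 ht).trans
    (mul_le_mul_of_nonneg_left (h.qDen_le hr0 ht) (by have := h.Λ_pos; positivity))

lemma F0_nonneg (h : SolBound d V u C Λ) (hd : 2 ≤ d) (hc : HCoerc V)
    (h0 : (0 : Euc n) ∈ MinSet V) (l ρ t : ℝ) : 0 ≤ F0 V d l u ρ t :=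
  setIntegral_nonneg measurableSet_Ioi fun r hr =>
    mul_nonneg (Tpsi_nonneg hd l ρ (le_of_lt hr)) (h.fireDen_nonneg hc h0 r t)

lemma norm_sq_le_F0 (h : SolBound d V u C Λ) (hd : 2 ≤ d) (hc : HCoerc V)
    (h0 : (0 : Euc n) ∈ MinSet V) {l : ℝ} (hl : 0 < l) {ρ t : ℝ} (hρ : rsc d l ≤ ρ) (ht : 0 < t) :
    min (wV V / 2) (1 / 4) * ‖u ρ t‖ ^ 2 ≤ (kappa0 l + 1) * F0 V d l u ρ t := by
  have hκ := kappa0_pos hl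
  obtain ⟨κ, hκe⟩ : ∃ k, k = kappa0 l := ⟨_, rfl⟩
  have hw := wV_pos (V := V)
  obtain ⟨m, hm⟩ : ∃ m, m = min (wV V / 2) (1 / 4) := ⟨_, rfl⟩
  have hm0 : 0 < m := by rw [hm]; positivity
  have hρ0 : 0 < ρ := (rsc_pos hd l).trans_le hρ
  have key : ∀ B ≥ ρ, m * ‖u ρ t‖ ^ 2 ≤
      Real.exp (-κ * (B - ρ)) * (m * C ^ 2) + (κ + 1) * F0 V d l u ρ t := by
    intro B hB
    have hder : ∀ r : ℝ, HasDerivAt (fun r => -(Real.exp (-κ * (r - ρ)) * ‖u r t‖ ^ 2))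
        (Real.exp (-κ * (r - ρ)) * (κ * ‖u r t‖ ^ 2 - 2 * ⟪u r t, ur u r t⟫)) r := by
      intro r
      have e1 : HasDerivAt (fun r : ℝ => Real.exp (-κ * (r - ρ))) (Real.exp (-κ * (r - ρ)) * -κ) r := by
        have := (((hasDerivAt_id r).sub_const ρ).const_mul (-κ)).exp
        exact this.congr_deriv (by simp)
      have e2 : HasDerivAt (fun r => ‖u r t‖ ^ 2) (2 * ⟪u r t, ur u r t⟫) r :=
        (h.hasDerivAt_r ht r).norm_sq
      exact (e1.mul e2).neg.congr_deriv (by ring)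
    have cc : Continuous fun r => Real.exp (-κ * (r - ρ)) *
        (κ * ‖u r t‖ ^ 2 - 2 * ⟪u r t, ur u r t⟫) := by
      have c1 := h.continuous_u ht
      have c2 := h.continuous_ur ht
      fun_prop
    have hIntg := intervalIntegral.integral_eq_sub_of_hasDerivAt
      (fun r _ => hder r) (cc.intervalIntegrable ρ B)
    have c3 : Continuous fun r => Real.exp (-κ * (r - ρ)) * ((κ + 1) * (fireDen V u r t / m)) := by
      have := h.continuous_fireDen ht
      fun_prop
    have hle : ∫ r in ρ..B, Real.exp (-κ * (r - ρ)) * (κ * ‖u r t‖ ^ 2 - 2 * ⟪u r t, ur u r t⟫) ≤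
        ∫ r in ρ..B, Real.exp (-κ * (r - ρ)) * ((κ + 1) * (fireDen V u r t / m)) := by
      refine intervalIntegral.integral_mono_on hB (cc.intervalIntegrable _ _)
        (c3.intervalIntegrable _ _) fun r _ => ?_
      refine mul_le_mul_of_nonneg_left ?_ (Real.exp_pos _).le
      have h1 := h.fireDen_ge hc h0 r t
      rw [← hm] at h1
      have h2 : qDen u r t ≤ fireDen V u r t / m := by rw [le_div_iff₀ hm0]; linarith
      have h3 := mul_le_mul_of_nonneg_left h2 (by rw [hκe]; linarith : 0 ≤ κ + 1)
      have h4 := neg_le_of_abs_le (abs_real_inner_le_norm (u r t) (ur u r t))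
      have h5 := two_mul_le_add_sq ‖u r t‖ ‖ur u r t‖
      have h6 : 0 ≤ κ * ‖ur u r t‖ ^ 2 := by rw [hκe]; positivity
      unfold qDen at h3
      linarith
    have hF : ∫ r in ρ..B, Real.exp (-κ * (r - ρ)) * ((κ + 1) * (fireDen V u r t / m)) ≤
        (κ + 1) / m * F0 V d l u ρ t := by
      have e : ∀ r, Real.exp (-κ * (r - ρ)) * ((κ + 1) * (fireDen V u r t / m)) =
          (κ + 1) / m * (Real.exp (-κ * (r - ρ)) * fireDen V u r t) := fun r => by ring
      simp_rw [e]
      rw [intervalIntegral.integral_const_mul]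
      refine mul_le_mul_of_nonneg_left ?_ (by rw [hκe]; positivity)
      rw [intervalIntegral.integral_of_le hB]
      have : ∫ r in Ioc ρ B, Real.exp (-κ * (r - ρ)) * fireDen V u r t =
          ∫ r in Ioc ρ B, Tpsi d l ρ r * fireDen V u r t :=
        setIntegral_congr_fun measurableSet_Ioc fun r hr => by
          rw [Tpsi_of_le hd hρ hr.1.le, hκe]
      rw [this]
      refine setIntegral_mono_set (h.integrableOn_fire hd hc h0 hl ρ ht) ?_ ?_
      · exact (ae_restrict_iff' measurableSet_Ioi).2 (Eventually.of_forall fun r hr =>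
          mul_nonneg (Tpsi_nonneg hd l ρ (le_of_lt hr)) (h.fireDen_nonneg hc h0 r t))
      · exact (Eventually.of_forall fun r hr => hρ0.trans hr.1)
    rw [hIntg] at hle
    have h7 := hle.trans hF
    simp only [sub_self, mul_zero, Real.exp_zero, one_mul] at h7
    have h8 := pow_le_pow_left₀ (norm_nonneg _) (h.bu B t (hρ0.le.trans hB) ht) 2
    have h9 := mul_le_mul_of_nonneg_left h8 (Real.exp_pos (-κ * (B - ρ))).le
    have h10 : ‖u ρ t‖ ^ 2 ≤ Real.exp (-κ * (B - ρ)) * C ^ 2 + (κ + 1) / m * F0 V d l u ρ t := by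
      linarith
    have h11 := mul_le_mul_of_nonneg_left h10 hm0.le
    have h12 : m * ((κ + 1) / m * F0 V d l u ρ t) = (κ + 1) * F0 V d l u ρ t := by field_simp
    linarith
  have hlim : Tendsto (fun B : ℝ => Real.exp (-κ * (B - ρ)) * (m * C ^ 2) +
      (κ + 1) * F0 V d l u ρ t) atTop (𝓝 (0 * (m * C ^ 2) + (κ + 1) * F0 V d l u ρ t)) := by
    refine ((Real.tendsto_exp_atBot.comp ?_).mul_const _).add_const _
    exact (tendsto_atTop_add_const_right _ (-ρ) tendsto_id).const_mul_atTop_of_neg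
      (by rw [hκe]; linarith)
  rw [← hκe, ← hm]
  have := ge_of_tendsto hlim (eventually_atTop.2 ⟨ρ, key⟩)
  linarith

lemma norm_lt_of_F0_le (h : SolBound d V u C Λ) (hd : 2 ≤ d) (hc : HCoerc V)
    (h0 : (0 : Euc n) ∈ MinSet V) (D : EscData n V) {ρ t δ : ℝ}
    (hδ : δ = deltaEsc D.dEsc (wV V) (kappa0 D.lmin)) (hρ : rsc d D.lmin ≤ ρ) (ht : 0 < t) :
    (F0 V d D.lmin u ρ t ≤ δ ^ 2 → ‖u ρ t‖ ≤ D.dEsc) ∧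
    (F0 V d D.lmin u ρ t ≤ δ ^ 2 / 2 → ‖u ρ t‖ < D.dEsc) := by
  have hκ := kappa0_pos D.lmin_pos
  have hw := wV_pos (V := V)
  have h1 := h.norm_sq_le_F0 hd hc h0 D.lmin_pos hρ ht
  obtain ⟨m, hm⟩ : ∃ m, m = min (wV V / 2) (1 / 4) := ⟨_, rfl⟩
  have hm0 : 0 < m := by rw [hm]; positivity
  rw [← hm] at h1
  have h2 : (kappa0 D.lmin + 1) * δ ^ 2 = m * D.dEsc ^ 2 := by
    rw [hδ, deltaEsc, mul_pow, ← hm, Real.sq_sqrt (by positivity)]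
    field_simp
  have hd0 := D.dEsc_pos
  constructor
  · intro hF
    have h3 := mul_le_mul_of_nonneg_left hF (by positivity : 0 ≤ kappa0 D.lmin + 1)
    have h4 : m * ‖u ρ t‖ ^ 2 ≤ m * D.dEsc ^ 2 := by linarith
    exact (pow_le_pow_iff_left₀ (norm_nonneg _) hd0.le two_ne_zero).1
      (le_of_mul_le_mul_left h4 hm0)
  · intro hF
    have h3 := mul_le_mul_of_nonneg_left hF (by positivity : 0 ≤ kappa0 D.lmin + 1)
    have h4 : m * ‖u ρ t‖ ^ 2 < m * D.dEsc ^ 2 := by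
      have : 0 < m * D.dEsc ^ 2 := by positivity
      linarith
    exact lt_of_pow_lt_pow_left₀ 2 hd0.le (lt_of_mul_lt_mul_left h4 hm0.le)

lemma exists_F0_le (h : SolBound d V u C Λ) (hd : 2 ≤ d) (hc : HCoerc V)
    (h0 : (0 : Euc n) ∈ MinSet V) {l : ℝ} (hl : 0 < l) {ε : ℝ} (hε : 0 < ε) :
    ∃ L > (0:ℝ), ∀ ρ t : ℝ, L ≤ ρ → 0 < t →
      F0 V d l u ρ t ≤ (1 + Λ) * (∫ r in (ρ - L)..(ρ + L), qDen u r t) + ε := by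
  have hκ := kappa0_pos hl
  have hκ2 : 0 < kappa0 l / 2 := by positivity
  have hΛ := h.Λ_pos
  have hC := h.C_pos
  obtain ⟨M, hM⟩ : ∃ M, M = (1 + Λ) * (2 * C ^ 2) * (4 / kappa0 l) := ⟨_, rfl⟩
  have hM0 : 0 < M := by rw [hM]; positivity
  have hlim : Tendsto (fun L : ℝ => Real.exp (-(kappa0 l / 2) * L) * M) atTop (𝓝 (0 * M)) :=
    (Real.tendsto_exp_atBot.comp (tendsto_id.const_mul_atTop_of_neg (by linarith))).mul_const _
  rw [zero_mul] at hlim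
  obtain ⟨L, hL0, hL⟩ := ((eventually_gt_atTop (0:ℝ)).and (hlim.eventually (gt_mem_nhds hε))).exists
  refine ⟨L, hL0, fun ρ t hρ ht => ?_⟩
  have c1 := h.continuous_qDen ht
  have i1 : Integrable (fun r => indicator (Ioc (ρ - L) (ρ + L))
      (fun r => (1 + Λ) * qDen u r t) r) := by
    refine IntegrableOn.integrable_indicator ?_ measurableSet_Ioc
    exact (by fun_prop : Continuous fun r => (1 + Λ) * qDen u r t).integrableOn_Ioc
  have i2 := (integrable_exp_neg_abs hκ2 ρ).const_mul
    ((1 + Λ) * (2 * C ^ 2) * Real.exp (-(kappa0 l / 2) * L))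
  have hb : ∀ r ∈ Ioi (0:ℝ), Tpsi d l ρ r * fireDen V u r t ≤
      indicator (Ioc (ρ - L) (ρ + L)) (fun r => (1 + Λ) * qDen u r t) r +
      (1 + Λ) * (2 * C ^ 2) * Real.exp (-(kappa0 l / 2) * L) *
        Real.exp (-(kappa0 l / 2) * |r - ρ|) := by
    intro r hr
    have hr0 : (0:ℝ) ≤ r := le_of_lt hr
    have p0 := qDen_nonneg u r t
    have p1 := Tpsi_nonneg hd l ρ hr0
    have p2 := Tpsi_le hd l ρ hr0
    have p3 := h.fireDen_nonneg hc h0 r t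
    have p4 := h.fireDen_le hr0 ht
    have p5 := h.qDen_le hr0 ht
    by_cases hm : r ∈ Ioc (ρ - L) (ρ + L)
    · rw [indicator_of_mem hm]
      have e1 : Tpsi d l ρ r ≤ 1 := p2.trans (Real.exp_le_one_iff.2
        (mul_nonpos_of_nonpos_of_nonneg (by linarith) (abs_nonneg _)))
      have := mul_le_of_le_one_left p3 e1
      have : 0 ≤ (1 + Λ) * (2 * C ^ 2) * Real.exp (-(kappa0 l / 2) * L) *
        Real.exp (-(kappa0 l / 2) * |r - ρ|) := by positivity
      linarith
    · rw [indicator_of_notMem hm, zero_add]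
      have hab : L ≤ |r - ρ| := by
        by_contra hlt
        rw [not_le, abs_lt] at hlt
        exact hm ⟨by linarith, by linarith⟩
      calc _ ≤ Real.exp (-(kappa0 l) * |r - ρ|) * ((1 + Λ) * (2 * C ^ 2)) :=
            mul_le_mul p2 (p4.trans (mul_le_mul_of_nonneg_left p5 (by positivity))) p3
              (Real.exp_pos _).le
        _ ≤ (Real.exp (-(kappa0 l / 2) * L) * Real.exp (-(kappa0 l / 2) * |r - ρ|)) *
            ((1 + Λ) * (2 * C ^ 2)) := by
            refine mul_le_mul_of_nonneg_right ?_ (by positivity)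
            rw [← Real.exp_add, Real.exp_le_exp]
            have := mul_le_mul_of_nonneg_left hab hκ2.le
            linarith
        _ = _ := by ring
  calc F0 V d l u ρ t = ∫ r in Ioi (0:ℝ), Tpsi d l ρ r * fireDen V u r t := rfl
    _ ≤ ∫ r in Ioi (0:ℝ), (indicator (Ioc (ρ - L) (ρ + L)) (fun r => (1 + Λ) * qDen u r t) r +
      (1 + Λ) * (2 * C ^ 2) * Real.exp (-(kappa0 l / 2) * L) *
        Real.exp (-(kappa0 l / 2) * |r - ρ|)) :=
        setIntegral_mono_on (h.integrableOn_fire hd hc h0 hl ρ ht) (i1.add i2).integrableOn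
          measurableSet_Ioi hb
    _ ≤ ∫ r, (indicator (Ioc (ρ - L) (ρ + L)) (fun r => (1 + Λ) * qDen u r t) r +
      (1 + Λ) * (2 * C ^ 2) * Real.exp (-(kappa0 l / 2) * L) *
        Real.exp (-(kappa0 l / 2) * |r - ρ|)) := by
        refine setIntegral_le_integral (i1.add i2) (Eventually.of_forall fun r => ?_)
        refine add_nonneg (indicator_nonneg (fun r _ => ?_) r) (by positivity)
        have := qDen_nonneg u r t
        positivity
    _ = (1 + Λ) * (∫ r in (ρ - L)..(ρ + L), qDen u r t) + Real.exp (-(kappa0 l / 2) * L) * M := by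
        rw [integral_add i1 i2, integral_indicator measurableSet_Ioc, integral_const_mul,
          integral_const_mul, integral_univ_exp_neg_abs hκ2,
          intervalIntegral.integral_of_le (by linarith), hM]
        congr 1
        field_simp
        norm_num
    _ ≤ _ := by linarith

end SolBound

/-! ### The escape point -/

/-- The properties of a moving point `R` ahead of which the solution stays close to `0` that are
used to establish relaxation. -/
structure FrontTrack {V : Euc n → ℝ} (D : EscData n V) (u : ℝ → ℝ → Euc n) (R H : ℝ → ℝ)
    (c : ℝ) : Prop where
  c_pos : 0 < c
  lim : Tendsto (fun t => R t / t) atTop (𝓝 c)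
  growth : ∃ Y > (0:ℝ), ∃ T > (0:ℝ), ∀ t ≥ T, ∀ s ≥ (0:ℝ), R (t + s) ≤ R t + Y * (s + 1)
  esc : ∀ᶠ t in atTop, ∀ r, R t < r → r ≤ H t → ‖u r t‖ ≤ D.dEsc
  gap : Tendsto (fun t => H t - R t) atTop atTop
  mono : Monotone H
  mass : ∃ L > (0:ℝ), ∃ c₀ > (0:ℝ), ∀ᶠ t in atTop,
    c₀ ≤ ∫ r in (R t - L)..(R t + L), SolBound.qDen u r t

/-- The hypotheses concerning the escape point. -/
structure EscSetup (d : ℕ) (V : Euc n → ℝ) (D : EscData n V) (u : ℝ → ℝ → Euc n) (cHom : ℝ)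
    (H : ℝ → ℝ) (ν K δ L₀ : ℝ) : Prop where
  two_le_d : 2 ≤ d
  coerc : HCoerc V
  zero_mem : (0 : Euc n) ∈ MinSet V
  hom : HHomWith u 0 cHom H
  deriv_nonneg : ∀ t : ℝ, 0 ≤ deriv H t
  ν_pos : 0 < ν
  K_pos : 0 < K
  δ_eq : δ = deltaEsc D.dEsc (wV V) (kappa0 D.lmin)
  fire : FireIneq V d D.lmin D.dEsc u ν K
  hull_bound : HullBound V d D.lmin u δ L₀ H

lemma le_hull {δ L₀ x : ℝ} (hx : 0 ≤ x) : ((δ ^ 2 / 4 : ℝ) : EReal) ≤ hull δ L₀ x := by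
  unfold hull
  rw [if_neg (not_lt.2 hx)]
  split_ifs with h1
  · rw [EReal.coe_le_coe_iff]
    have h2 : x / (2 * L₀) ≤ 1 / 2 := by
      rcases eq_or_lt_of_le (hx.trans h1) with h3 | h3
      · rw [← h3]; norm_num
      · rw [div_le_iff₀ (by positivity)]; linarith
    have := mul_le_mul_of_nonneg_left h2 (sq_nonneg δ)
    linarith
  · exact le_rfl

lemma hull_le {δ L₀ x : ℝ} (hx : 0 ≤ x) : hull δ L₀ x ≤ ((δ ^ 2 / 2 : ℝ) : EReal) := by
  unfold hull
  rw [if_neg (not_lt.2 hx)]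
  split_ifs with h1
  · rw [EReal.coe_le_coe_iff]
    have h2 : 0 ≤ x / (2 * L₀) := by
      have := hx.trans h1
      positivity
    have := mul_le_mul_of_nonneg_left h2 (sq_nonneg δ)
    linarith
  · rw [EReal.coe_le_coe_iff]
    linarith [sq_nonneg δ]

lemma hull_eq {δ L₀ x : ℝ} (hx : max L₀ 0 < x) : hull δ L₀ x = ((δ ^ 2 / 4 : ℝ) : EReal) := by
  unfold hull
  rw [if_neg (not_lt.2 ((le_max_right L₀ 0).trans hx.le)),
    if_neg (not_le.2 ((le_max_left L₀ 0).trans_lt hx))]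

lemma le_of_deriv_le_neg_mul {f : ℝ → ℝ} {ν b t₁ t₂ : ℝ} (h12 : t₁ ≤ t₂)
    (hf : ∀ t ∈ Icc t₁ t₂, DifferentiableAt ℝ f t)
    (hd : ∀ t ∈ Icc t₁ t₂, deriv f t ≤ -ν * (f t - b)) (h1 : f t₁ ≤ b) : f t₂ ≤ b := by
  have hder : ∀ t ∈ Icc t₁ t₂, HasDerivAt (fun t => (f t - b) * Real.exp (ν * t))
      ((deriv f t + ν * (f t - b)) * Real.exp (ν * t)) t := by
    intro t ht
    have e1 : HasDerivAt (fun t : ℝ => Real.exp (ν * t)) (Real.exp (ν * t) * ν) t :=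
      ((hasDerivAt_id t).const_mul ν).exp.congr_deriv (by simp)
    exact (((hf t ht).hasDerivAt.sub_const b).mul e1).congr_deriv (by ring)
  have hanti : AntitoneOn (fun t => (f t - b) * Real.exp (ν * t)) (Icc t₁ t₂) := by
    refine antitoneOn_of_hasDerivWithinAt_nonpos (convex_Icc _ _)
      (fun t ht => (hder t ht).continuousAt.continuousWithinAt)
      (fun t ht => (hder t (interior_subset ht)).hasDerivWithinAt) fun t ht => ?_
    refine mul_nonpos_of_nonpos_of_nonneg ?_ (Real.exp_pos _).le
    linarith [hd t (interior_subset ht)]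
  have := hanti (left_mem_Icc.2 h12) (right_mem_Icc.2 h12) h12
  simp only at this
  have h2 : (f t₁ - b) * Real.exp (ν * t₁) ≤ 0 :=
    mul_nonpos_of_nonpos_of_nonneg (by linarith) (Real.exp_pos _).le
  by_contra hlt
  have : 0 < (f t₂ - b) * Real.exp (ν * t₂) := mul_pos (by linarith) (Real.exp_pos _)
  linarith

namespace EscSetup

variable {d : ℕ} {V : Euc n → ℝ} {D : EscData n V} {u : ℝ → ℝ → Euc n} {C Λ cHom : ℝ}
  {H : ℝ → ℝ} {ν K δ L₀ : ℝ}

lemma δ_pos (S : EscSetup d V D u cHom H ν K δ L₀) : 0 < δ := by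
  have hκ := kappa0_pos D.lmin_pos
  have hw := wV_pos (V := V)
  have := D.dEsc_pos
  rw [S.δ_eq, deltaEsc]
  positivity

lemma monotone_H (S : EscSetup d V D u cHom H ν K δ L₀) : Monotone H :=
  monotone_of_deriv_nonneg (fun t => S.hom.2.1 t) S.deriv_nonneg

lemma eventually_increment_H (S : EscSetup d V D u cHom H ν K δ L₀) :
    ∃ T > (0:ℝ), ∀ t ≥ T, ∀ s ≥ (0:ℝ), cHom / 2 * s ≤ H (t + s) - H t ∧
      H (t + s) - H t ≤ 2 * cHom * s := by
  have hc := S.hom.1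
  have h1 := S.hom.2.2.1.eventually (lt_mem_nhds (by linarith : cHom / 2 < cHom))
  have h2 := S.hom.2.2.1.eventually (gt_mem_nhds (by linarith : cHom < 2 * cHom))
  obtain ⟨T, hT⟩ := eventually_atTop.1 (h1.and h2)
  refine ⟨max T 1, by positivity, fun t ht s hs => ?_⟩
  have hT' : T ≤ t := (le_max_left _ _).trans ht
  have hdiff : DifferentiableOn ℝ H (interior (Icc t (t + s))) :=
    fun x _ => (S.hom.2.1 x).differentiableWithinAt
  have hcont : ContinuousOn H (Icc t (t + s)) :=
    fun x _ => (S.hom.2.1 x).continuousAt.continuousWithinAt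
  have hx : ∀ x ∈ interior (Icc t (t + s)), T ≤ x :=
    fun x hx => hT'.trans (interior_subset hx).1
  have e1 := (convex_Icc t (t + s)).mul_sub_le_image_sub_of_le_deriv hcont hdiff
    (C := cHom / 2) (fun x h => (hT x (hx x h)).1.le) t ⟨le_rfl, by linarith⟩ (t + s)
    ⟨by linarith, le_rfl⟩ (by linarith)
  have e2 := (convex_Icc t (t + s)).image_sub_le_mul_sub_of_deriv_le hcont hdiff
    (C := 2 * cHom) (fun x h => (hT x (hx x h)).2.le) t ⟨le_rfl, by linarith⟩ (t + s)
    ⟨by linarith, le_rfl⟩ (by linarith)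
  rw [add_sub_cancel_left] at e1 e2
  exact ⟨e1, e2⟩

lemma tendsto_H (S : EscSetup d V D u cHom H ν K δ L₀) : Tendsto H atTop atTop := by
  obtain ⟨T, _, h⟩ := S.eventually_increment_H
  have hc := S.hom.1
  have h1 : Tendsto (fun t => H T + cHom / 2 * (t - T)) atTop atTop := by
    refine tendsto_atTop_add_const_left _ _ (Tendsto.const_mul_atTop (by positivity) ?_)
    exact tendsto_atTop_add_const_right _ (-T) tendsto_id
  refine tendsto_atTop_mono' _ ?_ h1
  filter_upwards [eventually_ge_atTop T] with t ht
  have := (h T le_rfl (t - T) (by linarith)).1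
  rw [add_sub_cancel] at this
  linarith

lemma eventually_F0_le (S : EscSetup d V D u cHom H ν K δ L₀) (h : SolBound d V u C Λ) (L : ℝ)
    {ε : ℝ} (hε : 0 < ε) :
    ∀ᶠ t in atTop, ∀ ρ ∈ Icc (H t - L) (H t), F0 V d D.lmin u ρ t ≤ ε := by
  obtain ⟨L', hL', hF⟩ := h.exists_F0_le S.two_le_d S.coerc S.zero_mem D.lmin_pos (half_pos hε)
  have hΛ := h.Λ_pos
  obtain ⟨M, hM⟩ : ∃ M, M = |L| + L' := ⟨_, rfl⟩
  have hM0 : 0 < M := by have := abs_nonneg L; linarith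
  have hη : 0 < ε / 2 / (1 + Λ) := by positivity
  filter_upwards [(S.hom.2.2.2 M hM0).eventually (gt_mem_nhds hη),
    S.tendsto_H.eventually_ge_atTop (|L| + L'), eventually_gt_atTop 0] with t h1 h2 ht ρ hρ
  have hLa := le_abs_self L
  have hLn := neg_abs_le L
  refine (hF ρ t (by linarith [hρ.1]) ht).trans ?_
  have c1 := h.continuous_qDen ht
  have e1 : ∫ r in (ρ - L')..(ρ + L'), SolBound.qDen u r t ≤
      ∫ r in (H t - M)..(H t + M), SolBound.qDen u r t := by
    refine intervalIntegral.integral_mono_interval (by linarith [hρ.1]) (by linarith)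
      (by linarith [hρ.2, abs_nonneg L])
      (Eventually.of_forall fun r => SolBound.qDen_nonneg u r t) (c1.intervalIntegrable _ _)
  have e2 : ∫ r in (-M)..M, (‖u (H t + r) t - 0‖ ^ 2 + ‖ur u (H t + r) t‖ ^ 2) =
      ∫ r in (H t - M)..(H t + M), SolBound.qDen u r t := by
    have := intervalIntegral.integral_comp_add_left (fun r => SolBound.qDen u r t) (H t)
      (a := -M) (b := M)
    rw [← sub_eq_add_neg] at this
    rw [← this]
    simp only [sub_zero, SolBound.qDen]
  rw [e2] at h1
  have e3 := mul_le_mul_of_nonneg_left (e1.trans h1.le) (by linarith : 0 ≤ 1 + Λ)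
  rw [mul_div_cancel₀ _ (by linarith : 1 + Λ ≠ 0)] at e3
  linarith

/-- The set defining the escape point. -/
abbrev eset (_ : EscSetup d V D u cHom H ν K δ L₀) (t : ℝ) : Set ℝ :=
  rescSet V d D.lmin u δ L₀ H t

/-- The escape point. -/
abbrev R (_ : EscSetup d V D u cHom H ν K δ L₀) (t : ℝ) : ℝ := rescF V d D.lmin u δ L₀ H t

lemma bddBelow_eset (S : EscSetup d V D u cHom H ν K δ L₀) (t : ℝ) : BddBelow (S.eset t) :=
  ⟨rsc d D.lmin, fun _ hx => hx.1.1⟩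

lemma nonempty_eset (S : EscSetup d V D u cHom H ν K δ L₀) {t : ℝ} (ht : 0 ≤ t) :
    (S.eset t).Nonempty :=
  ⟨H t - 1, ⟨(S.hull_bound t ht).1, by linarith⟩, (S.hull_bound t ht).2⟩

lemma rsc_le_R (S : EscSetup d V D u cHom H ν K δ L₀) {t : ℝ} (ht : 0 ≤ t) :
    rsc d D.lmin ≤ S.R t := le_csInf (S.nonempty_eset ht) fun _ hx => hx.1.1

lemma exists_mem_eset (S : EscSetup d V D u cHom H ν K δ L₀) {t r : ℝ} (ht : 0 ≤ t)
    (hr : S.R t < r) : ∃ rl ∈ S.eset t, rl < r := exists_lt_of_csInf_lt (S.nonempty_eset ht) hr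

lemma F0_le_half (S : EscSetup d V D u cHom H ν K δ L₀) {t r : ℝ} (ht : 0 ≤ t)
    (hr : S.R t < r) (hrH : r ≤ H t) : F0 V d D.lmin u r t ≤ δ ^ 2 / 2 := by
  obtain ⟨rl, hrl, hlt⟩ := S.exists_mem_eset ht hr
  have h1 := hrl.2 r ((S.rsc_le_R ht).trans hr.le)
  have h2 := h1.trans (max_le (hull_le (by linarith)) (hull_le (by linarith)))
  rwa [EReal.coe_le_coe_iff] at h2

lemma norm_lt (S : EscSetup d V D u cHom H ν K δ L₀) (h : SolBound d V u C Λ) {t r : ℝ}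
    (ht : 0 < t) (hr : S.R t < r) (hrH : r ≤ H t) : ‖u r t‖ < D.dEsc :=
  (h.norm_lt_of_F0_le S.two_le_d S.coerc S.zero_mem D S.δ_eq
    ((S.rsc_le_R ht.le).trans hr.le) ht).2 (S.F0_le_half ht.le hr hrH)

lemma R_le (S : EscSetup d V D u cHom H ν K δ L₀) {t y : ℝ}
    (hy : rsc d D.lmin ≤ y) (hyH : y ≤ H t)
    (hF : ∀ r ∈ Icc y (H t), F0 V d D.lmin u r t ≤ δ ^ 2 / 4) : S.R t ≤ y := by
  refine csInf_le (S.bddBelow_eset t) ⟨⟨hy, hyH⟩, fun r _ => ?_⟩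
  rcases lt_or_ge r y with h1 | h1
  · refine le_max_of_le_left ?_
    rw [hull, if_pos (by linarith)]
    exact le_top
  rcases lt_or_ge (H t) r with h2 | h2
  · refine le_max_of_le_right ?_
    rw [hull, if_pos (by linarith)]
    exact le_top
  refine le_max_of_le_left (le_trans ?_ (le_hull (by linarith)))
  rw [EReal.coe_le_coe_iff]
  exact hF r ⟨h1, h2⟩

lemma eventually_F0_le_quarter (S : EscSetup d V D u cHom H ν K δ L₀) (h : SolBound d V u C Λ) :
    ∀ᶠ t in atTop, ∀ r ∈ Icc (S.R t + (max L₀ 0 + 1)) (H t),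
      F0 V d D.lmin u r t ≤ δ ^ 2 / 4 := by
  have hδ := S.δ_pos
  filter_upwards [S.eventually_F0_le h (max L₀ 0 + 1) (by positivity : 0 < δ ^ 2 / 4),
    eventually_ge_atTop 0] with t h1 ht r hr
  rcases le_or_gt (H t - (max L₀ 0 + 1)) r with h2 | h2
  · exact h1 r ⟨h2, hr.2⟩
  · obtain ⟨rl, hrl, hlt⟩ := S.exists_mem_eset ht (lt_add_one (S.R t))
    have hL : 0 ≤ max L₀ 0 := le_max_right _ _
    have h3 := hrl.2 r ((S.rsc_le_R ht).trans (by linarith [hr.1]))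
    rw [hull_eq (by linarith [hr.1]), hull_eq (by linarith), max_self,
      EReal.coe_le_coe_iff] at h3
    exact h3

lemma tendsto_gap (S : EscSetup d V D u cHom H ν K δ L₀) (h : SolBound d V u C Λ) :
    Tendsto (fun t => H t - S.R t) atTop atTop := by
  have hδ := S.δ_pos
  refine tendsto_atTop.2 fun L => ?_
  filter_upwards [S.eventually_F0_le h |L| (by positivity : 0 < δ ^ 2 / 4),
    S.tendsto_H.eventually_ge_atTop (rsc d D.lmin + |L|)] with t h1 h2
  have := S.R_le (y := H t - |L|) (by linarith) (by linarith [abs_nonneg L]) h1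
  linarith [le_abs_self L]

lemma exists_step (S : EscSetup d V D u cHom H ν K δ L₀) (h : SolBound d V u C Λ) :
    ∃ τ > (0:ℝ), ∃ Y > (0:ℝ), ∃ T > (0:ℝ), ∀ t ≥ T, ∀ s ∈ Icc 0 τ, S.R (t + s) ≤ S.R t + Y := by
  have hδ := S.δ_pos
  have hκ := kappa0_pos D.lmin_pos
  have hK := S.K_pos
  have hν := S.ν_pos
  have hc := S.hom.1
  have hd := S.two_le_d
  obtain ⟨k, hk⟩ : ∃ k, k = K * (4 / kappa0 D.lmin) := ⟨_, rfl⟩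
  have hk0 : 0 < k := by rw [hk]; positivity
  obtain ⟨L, hLe⟩ : ∃ L, L = max L₀ 0 + 1 := ⟨_, rfl⟩
  have hL0 : 0 < L := by have := le_max_right L₀ 0; linarith
  have hmeas : ∀ t > 0, MeasurableSet (Sigma0 u D.dEsc t) := by
    intro t ht
    exact measurableSet_Ici.inter
      (isOpen_lt continuous_const (h.continuous_u ht).norm).measurableSet
  have hlim : Tendsto (fun Y : ℝ => Real.exp (-(kappa0 D.lmin / 2) * Y) * k) atTop (𝓝 (0 * k)) :=
    (Real.tendsto_exp_atBot.comp (tendsto_id.const_mul_atTop_of_neg (by linarith))).mul_const _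
  rw [zero_mul] at hlim
  obtain ⟨Y, hY0, hY⟩ := ((eventually_gt_atTop (0:ℝ)).and (hlim.eventually
    (gt_mem_nhds (by positivity : 0 < ν * (δ ^ 2 / 4))))).exists
  obtain ⟨τ, hτ⟩ : ∃ τ, τ = δ ^ 2 / 2 / k := ⟨_, rfl⟩
  have hτ0 : 0 < τ := by rw [hτ]; positivity
  obtain ⟨T₁, hT₁, hH⟩ := S.eventually_increment_H
  obtain ⟨T₂, hT₂⟩ := eventually_atTop.1 ((S.eventually_F0_le_quarter h).and
    ((S.eventually_F0_le h (Y + 2 * cHom * τ) (by positivity : 0 < δ ^ 2 / 4)).and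
      ((S.tendsto_gap h).eventually_ge_atTop (L + Y))))
  refine ⟨τ, hτ0, L + Y, by linarith, max T₁ T₂, by positivity, fun t ht s hs => ?_⟩
  have ht1 : T₁ ≤ t := (le_max_left _ _).trans ht
  have ht2 : T₂ ≤ t := (le_max_right _ _).trans ht
  have htpos : 0 < t := hT₁.trans_le ht1
  obtain ⟨a1, -, a3⟩ := hT₂ t ht2
  obtain ⟨-, b2, -⟩ := hT₂ (t + s) (by linarith [hs.1])
  rw [← hLe] at a1
  have hrsc := S.rsc_le_R htpos.le
  have hHm := S.monotone_H (by linarith [hs.1] : t ≤ t + s)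
  have bound : ∀ r ∈ Icc (S.R t + L) (H t), ∀ x ∈ Icc t (t + s), ‖u r x‖ ≤ D.dEsc := by
    intro r hr x hx
    have hrr : rsc d D.lmin ≤ r := by linarith [hr.1]
    refine (h.norm_lt_of_F0_le hd S.coerc S.zero_mem D S.δ_eq hrr (htpos.trans_le hx.1)).1 ?_
    have e2 := (convex_Icc t x).image_sub_le_mul_sub_of_deriv_le
      (f := fun s => F0 V d D.lmin u r s) (C := k)
      (fun y hy => (S.fire r hrr y (htpos.trans_le hy.1)).1.continuousAt.continuousWithinAt)
      (fun y hy => (S.fire r hrr y (htpos.trans_le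
        (interior_subset hy).1)).1.differentiableWithinAt)
      (fun y hy => by
        have hy0 := htpos.trans_le (interior_subset hy).1
        refine (S.fire r hrr y hy0).2.trans ?_
        have f1 := setIntegral_Tpsi_le hd D.lmin_pos r (hmeas y hy0) (fun z hz => hz.1)
          (Y := 0) (fun z _ => abs_nonneg _)
        rw [mul_zero, Real.exp_zero, one_mul] at f1
        have f2 := mul_le_mul_of_nonneg_left f1 hK.le
        have f3 := mul_nonneg hν.le (h.F0_nonneg hd S.coerc S.zero_mem D.lmin r y)
        linarith) t ⟨le_rfl, hx.1⟩ x ⟨hx.1, le_rfl⟩ hx.1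
    have e3 : k * (x - t) ≤ δ ^ 2 / 2 := by
      have : x - t ≤ δ ^ 2 / 2 / k := by rw [← hτ]; linarith [hx.2, hs.2]
      rw [le_div_iff₀ hk0] at this
      linarith
    have e4 := a1 r hr
    linarith [sq_nonneg δ]
  rw [← add_assoc]
  refine S.R_le (by linarith) (by linarith) fun r hr => ?_
  rcases le_or_gt (H t - Y) r with h2 | h2
  · refine b2 r ⟨?_, hr.2⟩
    have := (hH t ht1 s hs.1).2
    have : 2 * cHom * s ≤ 2 * cHom * τ := mul_le_mul_of_nonneg_left hs.2 (by positivity)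
    linarith
  · have hrr : rsc d D.lmin ≤ r := by linarith [hr.1]
    refine le_of_deriv_le_neg_mul (f := fun s => F0 V d D.lmin u r s) (ν := ν)
      (by linarith [hs.1] : t ≤ t + s) (fun x hx => (S.fire r hrr x (htpos.trans_le hx.1)).1)
      (fun x hx => ?_) (a1 r ⟨by linarith [hr.1], by linarith⟩)
    have hx0 := htpos.trans_le hx.1
    refine (S.fire r hrr x hx0).2.trans ?_
    have f1 := setIntegral_Tpsi_le hd D.lmin_pos r (hmeas x hx0) (fun z hz => hz.1)
      (Y := Y) (fun z hz => by
        by_contra hlt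
        rw [not_le, abs_lt] at hlt
        exact absurd (bound z ⟨by linarith [hr.1], by linarith⟩ x hx) (not_le.2 hz.2))
    have f2 := mul_le_mul_of_nonneg_left f1 hK.le
    have f3 : K * (Real.exp (-(kappa0 D.lmin / 2) * Y) * (4 / kappa0 D.lmin)) =
      Real.exp (-(kappa0 D.lmin / 2) * Y) * k := by rw [hk]; ring
    linarith

lemma growth (S : EscSetup d V D u cHom H ν K δ L₀) (h : SolBound d V u C Λ) :
    ∃ Y > (0:ℝ), ∃ T > (0:ℝ), ∀ t ≥ T, ∀ s ≥ (0:ℝ), S.R (t + s) ≤ S.R t + Y * (s + 1) := by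
  obtain ⟨τ, hτ, Y, hY, T, hT, hs⟩ := S.exists_step h
  have key : ∀ N : ℕ, ∀ t ≥ T, ∀ s ∈ Icc 0 ((N + 1) * τ), S.R (t + s) ≤ S.R t + (N + 1) * Y := by
    intro N
    induction N with
    | zero =>
      intro t ht s hs'
      have := hs t ht s (by simpa using hs')
      simpa using this
    | succ N ih =>
      intro t ht s hs'
      push_cast at hs' ⊢
      rcases le_or_gt s τ with h1 | h1
      · have := hs t ht s ⟨hs'.1, h1⟩
        have : 0 ≤ ((N:ℝ) + 1) * Y := by positivity
        linarith
      · have e1 := ih (t + τ) (by linarith) (s - τ) ⟨by linarith, by linarith [hs'.2]⟩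
        have e2 := hs t ht τ ⟨hτ.le, le_rfl⟩
        rw [show t + τ + (s - τ) = t + s by ring] at e1
        linarith
  refine ⟨Y * (1 / τ + 1), by positivity, T, hT, fun t ht s hs' => ?_⟩
  have h1 := key ⌊s / τ⌋₊ t ht s ⟨hs', by
    have := (Nat.lt_floor_add_one (s / τ)).le
    rwa [div_le_iff₀ hτ] at this⟩
  have h2 : (⌊s / τ⌋₊ : ℝ) ≤ s / τ := Nat.floor_le (by positivity)
  have h3 : (⌊s / τ⌋₊ : ℝ) + 1 ≤ (1 / τ + 1) * (s + 1) := by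
    have : (1 / τ + 1) * (s + 1) = s / τ + 1 / τ + s + 1 := by ring
    have : 0 < 1 / τ := by positivity
    linarith
  have h4 := mul_le_mul_of_nonneg_right h3 hY.le
  linarith

lemma eventually_bounds (S : EscSetup d V D u cHom H ν K δ L₀) (h : SolBound d V u C Λ) :
    ∃ M : ℝ, ∀ᶠ t in atTop, 0 ≤ S.R t / t ∧ S.R t / t ≤ M := by
  obtain ⟨Y, hY, T, hT, hg⟩ := S.growth h
  refine ⟨|S.R T| + 2 * Y, ?_⟩
  filter_upwards [eventually_ge_atTop T, eventually_ge_atTop 1] with t ht ht1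
  have h0 : 0 < t := by linarith
  refine ⟨div_nonneg ((rsc_pos S.two_le_d D.lmin).le.trans (S.rsc_le_R h0.le)) h0.le, ?_⟩
  rw [div_le_iff₀ h0]
  have := hg T le_rfl (t - T) (by linarith)
  rw [add_sub_cancel] at this
  have h1 : |S.R T| ≤ |S.R T| * t := le_mul_of_one_le_right (abs_nonneg _) ht1
  have h2 : Y * (t - T + 1) ≤ Y * (2 * t) := mul_le_mul_of_nonneg_left (by linarith) hY.le
  linarith [le_abs_self (S.R T)]

lemma exists_mass (S : EscSetup d V D u cHom H ν K δ L₀) (h : SolBound d V u C Λ)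
    (hR : Tendsto S.R atTop atTop) :
    ∃ L > (0:ℝ), ∃ c₀ > (0:ℝ), ∀ᶠ t in atTop,
      c₀ ≤ ∫ r in (S.R t - L)..(S.R t + L), SolBound.qDen u r t := by
  have hδ := S.δ_pos
  have hΛ := h.Λ_pos
  obtain ⟨L', hL', hF⟩ := h.exists_F0_le S.two_le_d S.coerc S.zero_mem D.lmin_pos
    (by positivity : 0 < δ ^ 2 / 8)
  have hm : 0 ≤ max L₀ 0 := le_max_right _ _
  refine ⟨max L₀ 0 + 1 + L', by linarith, δ ^ 2 / 8 / (1 + Λ), by positivity, ?_⟩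
  filter_upwards [S.eventually_F0_le_quarter h, eventually_gt_atTop 0,
    hR.eventually_ge_atTop (rsc d D.lmin + 1 + L'), (S.tendsto_gap h).eventually_ge_atTop 0]
    with t h1 ht h2 h3
  have : ∃ r ∈ Icc (S.R t - 1) (S.R t + (max L₀ 0 + 1)), δ ^ 2 / 4 < F0 V d D.lmin u r t := by
    by_contra hne
    push Not at hne
    have := S.R_le (t := t) (y := S.R t - 1) (by linarith) (by linarith) fun r hr => by
      rcases le_or_gt r (S.R t + (max L₀ 0 + 1)) with h4 | h4
      · exact hne r ⟨hr.1, h4⟩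
      · exact h1 r ⟨h4.le, hr.2⟩
    linarith
  obtain ⟨r, hr, hFr⟩ := this
  have hrs := rsc_pos S.two_le_d D.lmin
  have h5 := hF r t (by linarith [hr.1]) ht
  have h6 : ∫ x in (r - L')..(r + L'), SolBound.qDen u x t ≤
      ∫ x in (S.R t - (max L₀ 0 + 1 + L'))..(S.R t + (max L₀ 0 + 1 + L')), SolBound.qDen u x t :=
    intervalIntegral.integral_mono_interval (by linarith [hr.1]) (by linarith)
      (by linarith [hr.2]) (Eventually.of_forall fun r => SolBound.qDen_nonneg u r t)
      ((h.continuous_qDen ht).intervalIntegrable _ _)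
  have h7 := mul_le_mul_of_nonneg_left h6 (by linarith : 0 ≤ 1 + Λ)
  rw [div_le_iff₀ (by linarith)]
  linarith

lemma frontTrack (S : EscSetup d V D u cHom H ν K δ L₀) (h : SolBound d V u C Λ)
    (hinv : 0 < cEscV u 0 D.dEsc H) {c : ℝ}
    (hc₁ : liminf (fun t => S.R t / t) atTop = c) (hc₂ : limsup (fun t => S.R t / t) atTop = c) :
    FrontTrack D u S.R H c := by
  obtain ⟨M, hM⟩ := S.eventually_bounds h
  have bu : IsBoundedUnder (· ≤ ·) atTop fun t => S.R t / t :=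
    isBoundedUnder_of_eventually_le (hM.mono fun _ h => h.2)
  have bl : IsBoundedUnder (· ≥ ·) atTop fun t => S.R t / t :=
    isBoundedUnder_of_eventually_ge (hM.mono fun _ h => h.1)
  have hlim := tendsto_of_liminf_eq_limsup hc₁ hc₂ bu bl
  have hEsc : ∀ᶠ t in atTop, 0 ≤ rEscF u 0 D.dEsc H t / t ∧
      rEscF u 0 D.dEsc H t / t ≤ S.R t / t := by
    filter_upwards [eventually_gt_atTop 0] with t ht
    constructor
    · exact div_nonneg (Real.sSup_nonneg fun x hx => hx.1.1) ht.le
    · refine div_le_div_of_nonneg_right ?_ ht.le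
      refine Real.sSup_le (fun x hx => ?_)
        ((rsc_pos S.two_le_d D.lmin).le.trans (S.rsc_le_R ht.le))
      by_contra hlt
      have := S.norm_lt h ht (not_le.1 hlt) hx.1.2
      have h2 := hx.2
      rw [sub_zero] at h2
      linarith
  have hcpos : 0 < c := by
    rw [← hc₂]
    refine hinv.trans_le (limsup_le_limsup (hEsc.mono fun _ h => h.2) ?_ bu)
    exact (isBoundedUnder_of_eventually_ge (hEsc.mono fun _ h => h.1)).isCoboundedUnder_le
  have hR : Tendsto S.R atTop atTop := by
    have := hlim.pos_mul_atTop hcpos tendsto_id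
    refine this.congr' ?_
    filter_upwards [eventually_gt_atTop 0] with t ht
    exact div_mul_cancel₀ _ ht.ne'
  exact ⟨hcpos, hlim, S.growth h, (eventually_gt_atTop 0).mono fun t ht r hr hrH =>
    (S.norm_lt h ht hr hrH).le, S.tendsto_gap h, S.monotone_H, S.exists_mass h hR⟩

end EscSetup

/-! ### Bounded entire solutions of the profile equation -/

/-- Bounded solutions of the travelling wave equation, written as a first order system. -/
structure IsProfile (V : Euc n → ℝ) (a C : ℝ) (φ ψ : ℝ → Euc n) : Prop where
  a_pos : 0 < a
  deriv_φ : ∀ x, HasDerivAt φ (ψ x) x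
  deriv_ψ : ∀ x, HasDerivAt ψ (-(a • ψ x) + gradient V (φ x)) x
  bφ : ∀ x, ‖φ x‖ ≤ C
  bψ : ∀ x, ‖ψ x‖ ≤ C

namespace IsProfile

variable {V : Euc n → ℝ} {a C : ℝ} {φ ψ : ℝ → Euc n}

/-- The Hamiltonian along a profile. -/
def ham (V : Euc n → ℝ) (φ ψ : ℝ → Euc n) (x : ℝ) : ℝ := ‖ψ x‖ ^ 2 / 2 - V (φ x)

lemma hasDerivAt_ham (P : IsProfile V a C φ ψ) (hV : ContDiff ℝ 2 V) (x : ℝ) :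
    HasDerivAt (ham V φ ψ) (-(a * ‖ψ x‖ ^ 2)) x := by
  have h1 : HasDerivAt (fun x => ‖ψ x‖ ^ 2 / 2)
      (2 * ⟪ψ x, -(a • ψ x) + gradient V (φ x)⟫ / 2) x :=
    (P.deriv_ψ x).norm_sq.div_const 2
  have h2 := hasDerivAt_comp_potential hV (P.deriv_φ x)
  refine (h1.sub h2).congr_deriv ?_
  rw [inner_add_right, inner_neg_right, real_inner_smul_right, real_inner_self_eq_norm_sq,
    real_inner_comm (gradient V (φ x))]
  ring

lemma antitone_ham (P : IsProfile V a C φ ψ) (hV : ContDiff ℝ 2 V) : Antitone (ham V φ ψ) :=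
  antitone_of_hasDerivAt_nonpos (fun x => P.hasDerivAt_ham hV x) fun x => by
    simp only [Pi.zero_apply]
    have := P.a_pos
    have : 0 ≤ a * ‖ψ x‖ ^ 2 := by positivity
    linarith

lemma C_nonneg (P : IsProfile V a C φ ψ) : 0 ≤ C := (norm_nonneg _).trans (P.bφ 0)

lemma exists_bound_ham (P : IsProfile V a C φ ψ) (hV : ContDiff ℝ 2 V) :
    ∃ M : ℝ, ∀ x, |ham V φ ψ x| ≤ M := by
  obtain ⟨A, hA⟩ := (isCompact_closedBall (0 : Euc n) C).exists_bound_of_continuousOn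
    hV.continuous.continuousOn
  refine ⟨C ^ 2 / 2 + A, fun x => ?_⟩
  have h1 := hA (φ x) (by simpa using P.bφ x)
  have h2 := pow_le_pow_left₀ (norm_nonneg _) (P.bψ x) 2
  unfold ham
  refine (abs_sub _ _).trans (add_le_add ?_ h1)
  rw [abs_of_nonneg (by positivity)]
  linarith

lemma exists_lim_ham (P : IsProfile V a C φ ψ) (hV : ContDiff ℝ 2 V) :
    (∃ y, Tendsto (ham V φ ψ) atTop (𝓝 y)) ∧ (∃ y, Tendsto (ham V φ ψ) atBot (𝓝 y)) := by
  obtain ⟨M, hM⟩ := P.exists_bound_ham hV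
  refine ⟨⟨_, tendsto_atTop_ciInf (P.antitone_ham hV) ⟨-M, ?_⟩⟩,
    ⟨_, tendsto_atBot_ciSup (P.antitone_ham hV) ⟨M, ?_⟩⟩⟩
  · rintro _ ⟨x, rfl⟩
    exact (abs_le.1 (hM x)).1
  · rintro _ ⟨x, rfl⟩
    exact (abs_le.1 (hM x)).2

lemma exists_lipschitz (P : IsProfile V a C φ ψ) (hV : ContDiff ℝ 2 V) :
    ∃ B > (0:ℝ), (∀ x y, ‖ψ y - ψ x‖ ≤ B * |y - x|) ∧
      ∀ x y, ‖(-(a • ψ y) + gradient V (φ y)) - (-(a • ψ x) + gradient V (φ x))‖ ≤ B * |y - x| := by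
  obtain ⟨Λ, hΛ, hl⟩ := exists_lipschitz_gradient hV C
  obtain ⟨A, hA⟩ := (isCompact_closedBall (0 : Euc n) C).exists_bound_of_continuousOn
    (contDiff_gradient hV).continuous.continuousOn
  have hC := P.C_nonneg
  have ha := P.a_pos
  have hA0 : 0 ≤ A := (norm_nonneg _).trans (hA 0 (by simpa using hC))
  have h1 : ∀ x y, ‖ψ y - ψ x‖ ≤ (a * C + A) * |y - x| := fun x y => by
    have := convex_univ.norm_image_sub_le_of_norm_hasDerivWithin_le (f := ψ)
      (f' := fun x => -(a • ψ x) + gradient V (φ x)) (C := a * C + A)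
      (fun s _ => (P.deriv_ψ s).hasDerivWithinAt) (fun s _ => by
        refine (norm_add_le _ _).trans (add_le_add ?_ (hA _ (by simpa using P.bφ s)))
        rw [norm_neg, norm_smul, Real.norm_of_nonneg ha.le]
        exact mul_le_mul_of_nonneg_left (P.bψ s) ha.le) (mem_univ x) (mem_univ y)
    simpa using this
  have h2 : ∀ x y, ‖φ y - φ x‖ ≤ C * |y - x| := fun x y => by
    have := convex_univ.norm_image_sub_le_of_norm_hasDerivWithin_le (f := φ)
      (f' := ψ) (C := C) (fun s _ => (P.deriv_φ s).hasDerivWithinAt) (fun s _ => P.bψ s)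
      (mem_univ x) (mem_univ y)
    simpa using this
  refine ⟨(a * C + A) + (a * (a * C + A) + Λ * C) + 1, by positivity, fun x y => ?_, fun x y => ?_⟩
  · refine (h1 x y).trans (mul_le_mul_of_nonneg_right ?_ (abs_nonneg _))
    have : 0 ≤ a * (a * C + A) + Λ * C := by positivity
    linarith
  · have e : (-(a • ψ y) + gradient V (φ y)) - (-(a • ψ x) + gradient V (φ x)) =
      -(a • (ψ y - ψ x)) + (gradient V (φ y) - gradient V (φ x)) := by
      rw [smul_sub]; abel
    rw [e]
    have e1 : ‖-(a • (ψ y - ψ x))‖ ≤ a * ((a * C + A) * |y - x|) := by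
      rw [norm_neg, norm_smul, Real.norm_of_nonneg ha.le]
      exact mul_le_mul_of_nonneg_left (h1 x y) ha.le
    have e2 := (hl (φ y) (φ x) (P.bφ y) (P.bφ x)).trans (mul_le_mul_of_nonneg_left (h2 x y) hΛ.le)
    refine (norm_add_le _ _).trans ((add_le_add e1 e2).trans ?_)
    have : 0 ≤ ((a * C + A) + 1) * |y - x| := by positivity
    linarith

lemma tendsto_ψ (P : IsProfile V a C φ ψ) (hV : ContDiff ℝ 2 V) {l : Filter ℝ} {y : ℝ}
    (hl : ∀ h : ℝ, Tendsto (fun x => x + h) l l) (hy : Tendsto (ham V φ ψ) l (𝓝 y)) :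
    Tendsto ψ l (𝓝 0) := by
  obtain ⟨B, hB, h1, -⟩ := P.exists_lipschitz hV
  have ha := P.a_pos
  rw [tendsto_zero_iff_norm_tendsto_zero, Metric.tendsto_nhds]
  intro ε hε
  obtain ⟨s, hs⟩ : ∃ s, s = ε / (2 * B) := ⟨_, rfl⟩
  have hs0 : 0 < s := by rw [hs]; positivity
  have hlim : Tendsto (fun x => ham V φ ψ x - ham V φ ψ (x + s)) l (𝓝 0) :=
    tendsto_nhds_congr (hy.sub (hy.comp (hl s))) (sub_self y)
  filter_upwards [hlim.eventually (gt_mem_nhds (by positivity : 0 < a * (ε / 2) ^ 2 * s))] with x hx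
  rw [Real.dist_0_eq_abs, abs_norm]
  by_contra hge
  rw [not_lt] at hge
  have hd : ∀ z ∈ Icc x (x + s), ε / 2 ≤ ‖ψ z‖ := by
    intro z hz
    have e1 := h1 x z
    rw [abs_of_nonneg (by linarith [hz.1])] at e1
    have e2 : B * (z - x) ≤ ε / 2 := by
      have : z - x ≤ s := by linarith [hz.2]
      have := mul_le_mul_of_nonneg_left this hB.le
      rw [hs] at this
      have e3 : B * (ε / (2 * B)) = ε / 2 := by field_simp
      linarith
    have e3 := norm_sub_norm_le (ψ x) (ψ z)
    rw [norm_sub_rev] at e3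
    linarith
  have := (convex_Icc x (x + s)).image_sub_le_mul_sub_of_deriv_le (f := ham V φ ψ)
    (C := -(a * (ε / 2) ^ 2))
    (fun z _ => (P.hasDerivAt_ham hV z).continuousAt.continuousWithinAt)
    (fun z _ => (P.hasDerivAt_ham hV z).differentiableAt.differentiableWithinAt)
    (fun z hz => by
      rw [(P.hasDerivAt_ham hV z).deriv, neg_le_neg_iff]
      exact mul_le_mul_of_nonneg_left (pow_le_pow_left₀ (by positivity)
        (hd z (interior_subset hz)) 2) ha.le)
    x ⟨le_rfl, by linarith⟩ (x + s) ⟨by linarith, le_rfl⟩ (by linarith)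
  rw [add_sub_cancel_left] at this
  linarith

lemma tendsto_grad (P : IsProfile V a C φ ψ) (hV : ContDiff ℝ 2 V) {l : Filter ℝ}
    (hl : ∀ h : ℝ, Tendsto (fun x => x + h) l l) (hψ : Tendsto ψ l (𝓝 0)) :
    Tendsto (fun x => gradient V (φ x)) l (𝓝 0) := by
  obtain ⟨B, hB, -, h2⟩ := P.exists_lipschitz hV
  have ha := P.a_pos
  rw [tendsto_zero_iff_norm_tendsto_zero, Metric.tendsto_nhds]
  intro ε hε
  obtain ⟨s, hs⟩ : ∃ s, s = ε / (2 * B) := ⟨_, rfl⟩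
  have hs0 : 0 < s := by rw [hs]; positivity
  have hn := tendsto_zero_iff_norm_tendsto_zero.1 hψ
  have hlim : Tendsto (fun x => a * ‖ψ x‖ + (‖ψ (x + s)‖ + ‖ψ x‖) / s) l (𝓝 0) :=
    tendsto_nhds_congr ((hn.const_mul a).add (((hn.comp (hl s)).add hn).div_const s)) (by simp)
  filter_upwards [hlim.eventually (gt_mem_nhds (half_pos hε))] with x hx
  rw [Real.dist_0_eq_abs, abs_norm]
  obtain ⟨w, hw⟩ : ∃ w, w = -(a • ψ x) + gradient V (φ x) := ⟨_, rfl⟩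
  have e1 := (convex_Icc x (x + s)).norm_image_sub_le_of_norm_hasDerivWithin_le
    (f := fun z => ψ z - z • w) (f' := fun z => -(a • ψ z) + gradient V (φ z) - w)
    (C := B * s)
    (fun z _ => by
      have h1 := (P.deriv_ψ z).sub ((hasDerivAt_id z).smul_const w)
      exact (h1.congr_deriv (by rw [one_smul])).hasDerivWithinAt)
    (fun z hz => by
      have := h2 x z
      rw [← hw, abs_of_nonneg (by linarith [hz.1])] at this
      exact this.trans (mul_le_mul_of_nonneg_left (by linarith [hz.2]) hB.le))
    (left_mem_Icc.2 (by linarith)) (right_mem_Icc.2 (by linarith : x ≤ x + s))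
  have e2 : s • w = (ψ (x + s) - ψ x) - ((ψ (x + s) - (x + s) • w) - (ψ x - x • w)) := by
    rw [add_smul]; abel
  have e3 : s * ‖w‖ ≤ (‖ψ (x + s)‖ + ‖ψ x‖) + B * s * s := by
    rw [← Real.norm_of_nonneg hs0.le, ← norm_smul, e2, Real.norm_of_nonneg hs0.le]
    refine (norm_sub_le _ _).trans (add_le_add (norm_sub_le _ _) ?_)
    refine e1.trans (le_of_eq ?_)
    rw [add_sub_cancel_left, Real.norm_of_nonneg hs0.le]
  have e4 : ‖w‖ ≤ (‖ψ (x + s)‖ + ‖ψ x‖) / s + B * s := by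
    refine le_of_mul_le_mul_left (e3.trans (le_of_eq ?_)) hs0
    field_simp
  have e5 : gradient V (φ x) = w + a • ψ x := by rw [hw]; abel
  have e6 : B * s = ε / 2 := by rw [hs]; field_simp
  rw [e5]
  refine (norm_add_le _ _).trans_lt ?_
  rw [norm_smul, Real.norm_of_nonneg ha.le]
  linarith

end IsProfile

lemma exists_norm_gradient_ge {V : Euc n → ℝ} (hV : ContDiff ℝ 2 V) {m : Euc n}
    (hm : gradient V m = 0) (hnd : ∀ v, hess V m v = 0 → v = 0) :
    ∃ μ > (0:ℝ), ∃ ε₀ > (0:ℝ), ∀ x, ‖x - m‖ ≤ ε₀ → μ * ‖x - m‖ ≤ ‖gradient V x‖ := by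
  obtain ⟨k, hk, hanti⟩ := (hess V m).toLinearMap.exists_antilipschitzWith
    (LinearMap.ker_eq_bot'.2 fun v hv => hnd v hv)
  have hk' : (0:ℝ) < k := hk
  have h1 := (hasFDerivAt_gradient hV m).isLittleO
  have h2 := h1.def (by positivity : (0:ℝ) < 1 / (2 * k))
  obtain ⟨ε, hε, hball⟩ := Metric.eventually_nhds_iff.1 h2
  refine ⟨1 / (2 * k), by positivity, ε / 2, by positivity, fun x hx => ?_⟩
  have h3 := hball (y := x) (by rw [dist_eq_norm]; linarith)
  have h4 := hanti.le_mul_dist x m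
  rw [dist_eq_norm, dist_eq_norm, ← map_sub] at h4
  rw [hm, sub_zero] at h3
  have h5 := norm_sub_norm_le (hess V m (x - m)) (gradient V x)
  rw [norm_sub_rev] at h5
  have h6 : ‖x - m‖ / k ≤ ‖hess V m (x - m)‖ := by
    rw [div_le_iff₀ hk']
    have : ‖x - m‖ ≤ k * ‖hess V m (x - m)‖ := h4
    linarith
  have h7 : ‖x - m‖ / k = 2 * (1 / (2 * k) * ‖x - m‖) := by field_simp
  linarith

lemma IsProfile.exists_tendsto_atBot {V : Euc n → ℝ} {a C : ℝ} {φ ψ : ℝ → Euc n}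
    (P : IsProfile V a C φ ψ) (hV : ContDiff ℝ 2 V) (hnd : HNonDeg V)
    (hg : Tendsto (fun x => gradient V (φ x)) atBot (𝓝 0)) :
    ∃ m, gradient V m = 0 ∧ Tendsto φ atBot (𝓝 m) := by
  have hcφ : Continuous φ := continuous_iff_continuousAt.2 fun x => (P.deriv_φ x).continuousAt
  obtain ⟨m, -, hm⟩ := (isCompact_closedBall (0 : Euc n) C).exists_mapClusterPt (f := atBot)
    (u := φ) (by
      rw [Filter.le_principal_iff, Filter.mem_map]
      exact Eventually.of_forall fun x => by simpa using P.bφ x)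
  have hgm : gradient V m = 0 := by
    have h1 : MapClusterPt (gradient V m) atBot (fun x => gradient V (φ x)) :=
      hm.continuousAt_comp (contDiff_gradient hV).continuous.continuousAt
    by_contra hne
    have hd := disjoint_nhds_nhds.2 hne
    have hc : ClusterPt (gradient V m) (map (fun x => gradient V (φ x)) atBot) := h1
    have : ClusterPt (gradient V m) (𝓝 0) := hc.mono hg
    exact this.ne (disjoint_iff.1 hd)
  obtain ⟨μ, hμ, ε₀, hε₀, hge⟩ := exists_norm_gradient_ge hV hgm (hnd m hgm)
  refine ⟨m, hgm, ?_⟩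
  rw [Metric.tendsto_nhds]
  intro ε hε
  obtain ⟨η, hη⟩ : ∃ η, η = min ε ε₀ := ⟨_, rfl⟩
  have hη0 : 0 < η := by rw [hη]; positivity
  have h2 := (tendsto_zero_iff_norm_tendsto_zero.1 hg).eventually
    (gt_mem_nhds (by positivity : 0 < μ * η))
  obtain ⟨X, hX⟩ := eventually_atBot.1 h2
  have hne : ∀ x ≤ X, dist (φ x) m ≠ η := by
    intro x hx heq
    rw [dist_eq_norm] at heq
    have := hge (φ x) (by rw [heq, hη]; exact min_le_right _ _)
    rw [heq] at this
    linarith [hX x hx]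
  have hfreq : ∃ᶠ x in atBot, dist (φ x) m < η :=
    hm.frequently (Metric.ball_mem_nhds m hη0)
  obtain ⟨x₀, hx₀, hx₀X⟩ := (hfreq.and_eventually (eventually_le_atBot X)).exists
  filter_upwards [eventually_le_atBot X] with x hx
  by_contra hlt
  have hη1 : η ≤ dist (φ x) m := by
    rw [not_lt] at hlt
    rw [hη]
    exact (min_le_left _ _).trans hlt
  obtain ⟨z, hz, hzη⟩ := (convex_Iic X).isPreconnected.intermediate_value
    (f := fun x => dist (φ x) m) (mem_Iic.2 hx₀X) (mem_Iic.2 hx)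
    (hcφ.dist continuous_const).continuousOn ⟨hx₀.le, hη1⟩
  exact hne z hz hzη

lemma IsProfile.phiInv_nonempty {V : Euc n → ℝ} {a C : ℝ} {φ ψ : ℝ → Euc n}
    (P : IsProfile V a C φ ψ) (hV : ContDiff ℝ 2 V) (D : EscData n V)
    (h0 : (0 : Euc n) ∈ MinSet V) (hnd : HNonDeg V) (hbist : HOnlyBist V)
    (hesc : ∀ x > 0, ‖φ x‖ ≤ D.dEsc) (hne : ∃ x y, φ x ≠ φ y) : (PhiInv V a 0).Nonempty := by
  obtain ⟨⟨yT, hT⟩, ⟨yB, hB⟩⟩ := P.exists_lim_ham hV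
  have hlT : ∀ h : ℝ, Tendsto (fun x : ℝ => x + h) atTop atTop :=
    fun h => tendsto_atTop_add_const_right _ h tendsto_id
  have hlB : ∀ h : ℝ, Tendsto (fun x : ℝ => x + h) atBot atBot :=
    fun h => tendsto_atBot_add_const_right _ h tendsto_id
  have gT := P.tendsto_grad hV hlT (P.tendsto_ψ hV hlT hT)
  have gB := P.tendsto_grad hV hlB (P.tendsto_ψ hV hlB hB)
  obtain ⟨m, hm, hφm⟩ := P.exists_tendsto_atBot hV hnd gB
  have hφ0 : Tendsto φ atTop (𝓝 0) := by
    have hl := D.lmin_pos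
    have h1 := (tendsto_zero_iff_norm_tendsto_zero.1 gT).const_mul (2 / D.lmin)
    rw [mul_zero] at h1
    rw [tendsto_zero_iff_norm_tendsto_zero]
    refine squeeze_zero' (Eventually.of_forall fun _ => norm_nonneg _) ?_ h1
    filter_upwards [eventually_gt_atTop 0] with x hx
    have e1 := inner_gradient_ge hV D h0 (hesc x hx)
    have e2 := e1.trans (real_inner_le_norm _ _)
    rcases eq_or_lt_of_le (norm_nonneg (φ x)) with h3 | h3
    · rw [← h3]; positivity
    · have e3 : D.lmin / 2 * ‖φ x‖ ≤ ‖gradient V (φ x)‖ := by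
        refine le_of_mul_le_mul_left ?_ h3
        linarith
      have e4 := mul_le_mul_of_nonneg_left e3 (by positivity : 0 ≤ 2 / D.lmin)
      have e5 : 2 / D.lmin * (D.lmin / 2 * ‖φ x‖) = ‖φ x‖ := by field_simp
      linarith
  have hdφ : deriv φ = ψ := funext fun x => (P.deriv_φ x).deriv
  have hmem : φ ∈ Phi V a m 0 := by
    refine ⟨hne, fun x => (P.deriv_φ x).differentiableAt, fun x => ?_, fun x => ?_, hφm, hφ0⟩
    · rw [hdφ]; exact (P.deriv_ψ x).differentiableAt
    · rw [hdφ]; exact (P.deriv_ψ x).deriv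
  have hmin := hbist 0 h0 m hm a P.a_pos ⟨φ, hmem⟩
  exact ⟨φ, mem_iUnion₂.2 ⟨m, hmin, hmem⟩⟩

/-! ### Compactness: small dissipation forces the existence of a front -/

lemma hasDerivAt_of_norm_le_sq {f : ℝ → Euc n} {f' : Euc n} {x B : ℝ}
    (h : ∀ y, ‖f y - f x - (y - x) • f'‖ ≤ B * |y - x| ^ 2) : HasDerivAt f f' x := by
  rw [hasDerivAt_iff_isLittleO]
  have h1 : (fun y => f y - f x - (y - x) • f') =O[𝓝 x] fun y => ‖y - x‖ ^ 2 :=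
    Asymptotics.IsBigO.of_bound B (Eventually.of_forall fun y => by
      have := h y
      rwa [Real.norm_of_nonneg (sq_nonneg _), Real.norm_eq_abs])
  have h2 : (fun y : ℝ => ‖y - x‖ ^ 2) =o[𝓝 x] fun y => y - x :=
    Asymptotics.isLittleO_pow_sub_sub x one_lt_two
  exact h1.trans_isLittleO h2

namespace SolBound

variable {d : ℕ} {V : Euc n → ℝ} {u : ℝ → ℝ → Euc n} {C Λ : ℝ}

/-- The residual of the travelling wave transport equation. -/
def zDen (u : ℝ → ℝ → Euc n) (a r t : ℝ) : Euc n := ut u r t + a • ur u r t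

lemma continuousOn_zDen (h : SolBound d V u C Λ) (a : ℝ) {t : ℝ} (ht : 0 < t) :
    ContinuousOn (fun r => zDen u a r t) (Ioi 0) :=
  (h.continuousOn_ut_r ht).add ((h.continuous_ur ht).continuousOn.const_smul a)

lemma taylor_ur (h : SolBound d V u C Λ) {a : ℝ} (ha : 0 ≤ a) {ℓ r r' b t : ℝ} (hℓ : 0 < ℓ)
    (hr : r ∈ Icc ℓ b) (hr' : r' ∈ Icc ℓ b) (ht : 0 < t) :
    ‖ur u r' t - ur u r t - (r' - r) • (-(a • ur u r t) + gradient V (u r t))‖ ≤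
      (a + Λ) * C * |r' - r| ^ 2 + d * C / ℓ * |r' - r| + ∫ s in ℓ..b, ‖zDen u a s t‖ := by
  obtain ⟨w, hw⟩ : ∃ w, w = -(a • ur u r t) + gradient V (u r t) := ⟨_, rfl⟩
  have hsub : uIcc r r' ⊆ Icc ℓ b := fun x hx =>
    ⟨(le_min hr.1 hr'.1).trans hx.1, hx.2.trans (max_le hr.2 hr'.2)⟩
  have hpos : uIcc r r' ⊆ Ioi 0 := fun x hx => hℓ.trans_le (hsub hx).1
  have cZ : ContinuousOn (fun s => zDen u a s t) (Icc ℓ b) :=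
    (h.continuousOn_zDen a ht).mono fun x hx => hℓ.trans_le hx.1
  have cZ' := cZ.mono hsub
  have crr := h.sol.cont_rr t ht
  have i1 : IntervalIntegrable (fun s => urr u s t - w) volume r r' :=
    (by fun_prop : Continuous fun s => urr u s t - w).intervalIntegrable _ _
  have iZ : IntervalIntegrable (fun s => zDen u a s t) volume r r' := cZ'.intervalIntegrable
  have hder : ∀ s, HasDerivAt (fun s => ur u s t - s • w) (urr u s t - w) s := fun s =>
    ((h.hasDerivAt_rr ht s).sub ((hasDerivAt_id s).smul_const w)).congr_deriv (by rw [one_smul])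
  have e1 : ur u r' t - ur u r t - (r' - r) • w = ∫ s in r..r', (urr u s t - w) := by
    rw [intervalIntegral.integral_eq_sub_of_hasDerivAt (fun s _ => hder s) i1, sub_smul]
    abel
  have e2 : ∫ s in r..r', (urr u s t - w) =
      (∫ s in r..r', zDen u a s t) + ∫ s in r..r', (urr u s t - w - zDen u a s t) := by
    rw [← intervalIntegral.integral_add iZ (i1.sub iZ)]
    refine intervalIntegral.integral_congr fun s _ => ?_
    abel
  have e3 : ‖∫ s in r..r', (urr u s t - w - zDen u a s t)‖ ≤
      ((a + Λ) * C * |r' - r| + d * C / ℓ) * |r' - r| := by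
    refine intervalIntegral.norm_integral_le_of_norm_le_const fun s hs => ?_
    have hs' := uIoc_subset_uIcc hs
    have hs0 := hpos hs'
    have hsℓ := (hsub hs').1
    have hr0 : 0 ≤ r := hℓ.le.trans hr.1
    have hC := h.C_pos
    have e4 : urr u s t - w - zDen u a s t = (gradient V (u s t) - gradient V (u r t)) -
        a • (ur u s t - ur u r t) - (((d : ℝ) - 1) / s) • ur u s t := by
      unfold zDen
      rw [h.ut_eq hs0 ht, hw, smul_sub]
      abel
    have f1 : ‖gradient V (u s t) - gradient V (u r t)‖ ≤ Λ * (C * |r' - r|) := by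
      refine (h.lip _ _ (h.bu s t (le_of_lt hs0) ht) (h.bu r t hr0 ht)).trans
        (mul_le_mul_of_nonneg_left ((h.lip_r hr0 (le_of_lt hs0) ht).trans ?_) h.Λ_pos.le)
      exact mul_le_mul_of_nonneg_left (abs_sub_left_of_mem_uIcc hs') hC.le
    have f2 : ‖a • (ur u s t - ur u r t)‖ ≤ a * (C * |r' - r|) := by
      rw [norm_smul, Real.norm_of_nonneg ha]
      refine mul_le_mul_of_nonneg_left ((h.lip_ur hr0 (le_of_lt hs0) ht).trans ?_) ha
      exact mul_le_mul_of_nonneg_left (abs_sub_left_of_mem_uIcc hs') hC.le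
    have f3 : ‖(((d : ℝ) - 1) / s) • ur u s t‖ ≤ d * C / ℓ := by
      have hd1 : (1:ℝ) ≤ d := by exact_mod_cast h.one_le_d
      rw [norm_smul, Real.norm_of_nonneg (div_nonneg (by linarith) (le_of_lt hs0)), mul_div_right_comm]
      refine mul_le_mul (div_le_div₀ (by linarith) (by linarith) hℓ hsℓ)
        (h.bur s t (le_of_lt hs0) ht) (norm_nonneg _) (by positivity)
    rw [e4]
    refine (norm_sub_le _ _).trans ((add_le_add ((norm_sub_le _ _).trans
      (add_le_add f1 f2)) f3).trans (le_of_eq ?_))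
    ring
  have e5 : ‖∫ s in r..r', zDen u a s t‖ ≤ ∫ s in ℓ..b, ‖zDen u a s t‖ := by
    refine intervalIntegral.norm_integral_le_integral_norm_uIoc.trans ?_
    rw [intervalIntegral.integral_of_le (hr.1.trans hr.2)]
    refine setIntegral_mono_set (cZ.norm.integrableOn_Icc.mono_set Ioc_subset_Icc_self)
      (Eventually.of_forall fun s => norm_nonneg _) (Eventually.of_forall fun s hs => ?_)
    exact ⟨(le_min hr.1 hr'.1).trans_lt hs.1, hs.2.trans (max_le hr.2 hr'.2)⟩
  rw [← hw, e1, e2]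
  refine (norm_add_le _ _).trans ((add_le_add e5 e3).trans (le_of_eq ?_))
  ring

lemma integral_norm_zDen_le (h : SolBound d V u C Λ) (a : ℝ) {ℓ b t η : ℝ} (hℓ : 0 < ℓ)
    (hb : ℓ ≤ b) (ht : 0 < t) (hη : 0 < η) :
    ∫ s in ℓ..b, ‖zDen u a s t‖ ≤ η * (b - ℓ) + (∫ s in ℓ..b, ‖zDen u a s t‖ ^ 2) / η := by
  have cZ : ContinuousOn (fun s => zDen u a s t) (uIcc ℓ b) := by
    rw [uIcc_of_le hb]
    exact (h.continuousOn_zDen a ht).mono fun x hx => hℓ.trans_le hx.1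
  have i1 : IntervalIntegrable (fun s => ‖zDen u a s t‖ ^ 2 / η) volume ℓ b :=
    ((cZ.norm.pow 2).div_const η).intervalIntegrable
  have : ∫ s in ℓ..b, ‖zDen u a s t‖ ≤ ∫ s in ℓ..b, (η + ‖zDen u a s t‖ ^ 2 / η) := by
    refine intervalIntegral.integral_mono_on hb cZ.norm.intervalIntegrable
      (intervalIntegrable_const.add i1) fun s _ => ?_
    have e1 := two_mul_le_add_sq ‖zDen u a s t‖ η
    have e2 : η * (η + ‖zDen u a s t‖ ^ 2 / η) = η ^ 2 + ‖zDen u a s t‖ ^ 2 := by field_simp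
    refine le_of_mul_le_mul_left ?_ hη
    have : 0 ≤ ‖zDen u a s t‖ * η := by positivity
    linarith
  refine this.trans (le_of_eq ?_)
  rw [intervalIntegral.integral_add intervalIntegrable_const i1, intervalIntegral.integral_const,
    intervalIntegral.integral_div, smul_eq_mul]
  ring

end SolBound

/-! ### Limits of the solution along the escape point -/

lemma exists_ultrafilter_lim {U : Ultrafilter ℕ} {f : ℕ → Euc n} {C : ℝ}
    (h : ∀ᶠ p in (U : Filter ℕ), ‖f p‖ ≤ C) : ∃ l, ‖l‖ ≤ C ∧ Tendsto f U (𝓝 l) := by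
  obtain ⟨l, hl, hU⟩ := (isCompact_closedBall (0 : Euc n) C).ultrafilter_le_nhds' (U.map f)
    (show ∀ᶠ p in (U : Filter ℕ), f p ∈ Metric.closedBall 0 C from
      h.mono fun p hp => by simpa using hp)
  exact ⟨l, by simpa using hl, hU⟩

namespace SolBound

variable {d : ℕ} {V : Euc n → ℝ} {u : ℝ → ℝ → Euc n} {C Λ : ℝ}

lemma exists_profile (h : SolBound d V u C Λ) {a : ℝ} (ha : 0 < a) {t q : ℕ → ℝ}
    (ht : Tendsto t atTop atTop) (hq : Tendsto q atTop atTop)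
    (hZ : ∀ W > 0, Tendsto (fun p => ∫ r in (q p - W)..(q p + W), ‖zDen u a r (t p)‖ ^ 2)
      atTop (𝓝 0)) :
    ∃ (U : Ultrafilter ℕ) (φ ψ : ℝ → Euc n), (U : Filter ℕ) ≤ atTop ∧ IsProfile V a C φ ψ ∧
      (∀ x, Tendsto (fun p => u (q p + x) (t p)) U (𝓝 (φ x))) ∧
      ∀ x, Tendsto (fun p => ur u (q p + x) (t p)) U (𝓝 (ψ x)) := by
  obtain ⟨U, hU⟩ : ∃ U : Ultrafilter ℕ, (U : Filter ℕ) ≤ atTop :=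
    ⟨hyperfilter ℕ, Nat.hyperfilter_le_atTop⟩
  have tpos : ∀ᶠ p in (U : Filter ℕ), 0 < t p := hU (ht.eventually_gt_atTop 0)
  have qge : ∀ y, ∀ᶠ p in (U : Filter ℕ), y < q p := fun y => hU (hq.eventually_gt_atTop y)
  have hφ : ∀ x, ∃ l, ‖l‖ ≤ C ∧ Tendsto (fun p => u (q p + x) (t p)) U (𝓝 l) := fun x =>
    exists_ultrafilter_lim (by
      filter_upwards [tpos, qge (-x)] with p h1 h2
      exact h.bu _ _ (by linarith) h1)
  have hψ : ∀ x, ∃ l, ‖l‖ ≤ C ∧ Tendsto (fun p => ur u (q p + x) (t p)) U (𝓝 l) := fun x =>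
    exists_ultrafilter_lim (by
      filter_upwards [tpos, qge (-x)] with p h1 h2
      exact h.bur _ _ (by linarith) h1)
  choose φ bφ lφ using hφ
  choose ψ bψ lψ using hψ
  refine ⟨U, φ, ψ, hU, ⟨ha, fun x => ?_, fun x => ?_, bφ, bψ⟩, lφ, lψ⟩
  · refine hasDerivAt_of_norm_le_sq (B := C) fun y => ?_
    have l1 : Tendsto (fun p => ‖u (q p + y) (t p) - u (q p + x) (t p) -
        (y - x) • ur u (q p + x) (t p)‖) U (𝓝 ‖φ y - φ x - (y - x) • ψ x‖) :=
      (((lφ y).sub (lφ x)).sub ((lψ x).const_smul (y - x))).norm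
    refine le_of_tendsto l1 ?_
    filter_upwards [tpos, qge (-x), qge (-y)] with p h1 h2 h3
    have := h.taylor_u (r := q p + x) (r' := q p + y) (by linarith) (by linarith) h1
    rwa [add_sub_add_left_eq_sub] at this
  · refine hasDerivAt_of_norm_le_sq (B := (a + Λ) * C) fun y => ?_
    have l1 : Tendsto (fun p => ‖ur u (q p + y) (t p) - ur u (q p + x) (t p) -
        (y - x) • (-(a • ur u (q p + x) (t p)) + gradient V (u (q p + x) (t p)))‖) U
        (𝓝 ‖ψ y - ψ x - (y - x) • (-(a • ψ x) + gradient V (φ x))‖) :=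
      (((lψ y).sub (lψ x)).sub (((((lψ x).const_smul a).neg).add
        ((h.continuous_grad.tendsto _).comp (lφ x))).const_smul (y - x))).norm
    obtain ⟨W, hW⟩ : ∃ W, W = |x| + |y| + 1 := ⟨_, rfl⟩
    have hWp : 0 < W := by rw [hW]; positivity
    refine le_of_forall_pos_le_add fun ε hε => ?_
    obtain ⟨η, hη⟩ : ∃ η, η = ε / (2 * W) := ⟨_, rfl⟩
    have hηp : 0 < η := by rw [hη]; positivity
    have hηW : η * (2 * W) = ε := by rw [hη]; field_simp
    have l2 : Tendsto (fun p => (a + Λ) * C * |y - x| ^ 2 + d * C / (q p - W) * |y - x| +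
        (ε + (∫ r in (q p - W)..(q p + W), ‖zDen u a r (t p)‖ ^ 2) / η)) U
        (𝓝 ((a + Λ) * C * |y - x| ^ 2 + 0 * |y - x| + (ε + 0 / η))) := by
      refine (tendsto_const_nhds.add (Tendsto.mul_const _ ?_)).add
        (tendsto_const_nhds.add (((hZ W hWp).mono_left hU).div_const η))
      exact Tendsto.div_atTop tendsto_const_nhds
        ((tendsto_atTop_add_const_right _ (-W) hq).mono_left hU)
    rw [zero_mul, zero_div, add_zero, add_zero] at l2
    refine le_of_tendsto_of_tendsto l1 l2 ?_
    filter_upwards [tpos, qge W] with p h1 h2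
    have hx1 := neg_abs_le x
    have hx2 := le_abs_self x
    have hy1 := neg_abs_le y
    have hy2 := le_abs_self y
    have hx3 := abs_nonneg x
    have hy3 := abs_nonneg y
    have h3 := h.taylor_ur ha.le (ℓ := q p - W) (b := q p + W) (r := q p + x) (r' := q p + y)
      (by linarith) ⟨by linarith, by linarith⟩ ⟨by linarith, by linarith⟩ h1
    rw [add_sub_add_left_eq_sub] at h3
    have h4 := h.integral_norm_zDen_le a (ℓ := q p - W) (b := q p + W) (by linarith)
      (by linarith) h1 hηp
    have h5 : η * (q p + W - (q p - W)) = ε := by rw [← hηW]; ring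
    rw [h5] at h4
    linarith

end SolBound

namespace FrontTrack

variable {d : ℕ} {V : Euc n → ℝ} {D : EscData n V} {u : ℝ → ℝ → Euc n} {C Λ c : ℝ}
  {R H : ℝ → ℝ}

lemma tendsto_atTop (F : FrontTrack D u R H c) : Tendsto R atTop atTop := by
  have h1 : Tendsto (fun t : ℝ => R t / t * t) atTop atTop :=
    F.lim.pos_mul_atTop F.c_pos tendsto_id
  refine h1.congr' ?_
  filter_upwards [eventually_gt_atTop 0] with t ht
  field_simp

/-- Away from the set of speeds of invading fronts, the solution is never close to a
travelling front near the escape point. -/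
lemma exists_dissip_ge (F : FrontTrack D u R H c) (h : SolBound d V u C Λ) {a : ℝ} (ha : 0 < a)
    (h0 : (0 : Euc n) ∈ MinSet V) (hnd : HNonDeg V) (hbist : HOnlyBist V)
    (hempty : ¬ (PhiInv V a 0).Nonempty) :
    ∃ ε > 0, ∃ W > 0, ∃ T, ∀ t ≥ T,
      ε ≤ ∫ r in (R t - W)..(R t + W), ‖SolBound.zDen u a r t‖ ^ 2 := by
  by_contra! hcon
  have hex : ∀ p : ℕ, ∃ t ≥ (p : ℝ), (p : ℝ) + 1 < R t ∧
      ∫ r in (R t - ((p : ℝ) + 1))..(R t + ((p : ℝ) + 1)),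
        ‖SolBound.zDen u a r t‖ ^ 2 < 1 / ((p : ℝ) + 1) := fun p => by
    obtain ⟨T, hT⟩ := eventually_atTop.1 (F.tendsto_atTop.eventually_gt_atTop ((p : ℝ) + 1))
    obtain ⟨t, ht, hlt⟩ := hcon (1 / ((p : ℝ) + 1)) (by positivity) ((p : ℝ) + 1) (by positivity)
      (max p T)
    exact ⟨t, (le_max_left _ _).trans ht, hT t ((le_max_right _ _).trans ht), hlt⟩
  choose t htp hRp hIntg using hex
  have ht : Tendsto t atTop atTop := tendsto_atTop_mono htp tendsto_natCast_atTop_atTop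
  have hq : Tendsto (fun p => R (t p)) atTop atTop := F.tendsto_atTop.comp ht
  have hZ : ∀ W > 0, Tendsto (fun p => ∫ r in (R (t p) - W)..(R (t p) + W),
      ‖SolBound.zDen u a r (t p)‖ ^ 2) atTop (𝓝 0) := by
    intro W hW
    refine tendsto_of_tendsto_of_tendsto_of_le_of_le' tendsto_const_nhds
      tendsto_one_div_add_atTop_nhds_zero_nat ?_ ?_
    · exact Eventually.of_forall fun p =>
        intervalIntegral.integral_nonneg (by linarith) fun r _ => sq_nonneg _
    · filter_upwards [tendsto_natCast_atTop_atTop.eventually_ge_atTop W,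
        ht.eventually_gt_atTop 0] with p hp htp
      have hR := hRp p
      refine le_trans (intervalIntegral.integral_mono_interval (by linarith) (by linarith)
        (by linarith) (Eventually.of_forall fun r => sq_nonneg _) ?_) (hIntg p).le
      refine ContinuousOn.intervalIntegrable ?_
      rw [uIcc_of_le (by linarith [(Nat.cast_nonneg p : (0:ℝ) ≤ p)])]
      exact ((h.continuousOn_zDen a htp).mono fun x hx =>
        mem_Ioi.2 (by linarith [hx.1])).norm.pow 2
  obtain ⟨U, φ, ψ, hU, P, lφ, lψ⟩ := h.exists_profile ha ht hq hZ
  have tpos : ∀ᶠ p in (U : Filter ℕ), 0 < t p := hU (ht.eventually_gt_atTop 0)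
  have qge : ∀ y, ∀ᶠ p in (U : Filter ℕ), y < R (t p) :=
    fun y => hU (hq.eventually_gt_atTop y)
  have hesc : ∀ x ≥ 0, ‖φ x‖ ≤ D.dEsc := by
    intro x hx
    have cont : Continuous φ :=
      continuous_iff_continuousAt.2 fun y => (P.deriv_φ y).continuousAt
    have hpos : ∀ x > 0, ‖φ x‖ ≤ D.dEsc := by
      intro x hx
      refine le_of_tendsto (lφ x).norm ?_
      filter_upwards [hU (ht.eventually F.esc),
        hU ((F.gap.comp ht).eventually_ge_atTop x)] with p h1 h2
      exact h1 _ (by linarith) (by simp only [Function.comp] at h2; linarith)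
    refine le_of_tendsto ((cont.norm.tendsto x).mono_left
      (nhdsWithin_le_nhds (s := Ioi x))) ?_
    filter_upwards [self_mem_nhdsWithin] with y hy
    exact hpos y (hx.trans_lt hy)
  refine hempty (P.phiInv_nonempty h.contDiff D h0 hnd hbist (fun x hx => hesc x hx.le) ?_)
  by_contra! hconst
  have hφ : ∀ x, φ x = φ 0 := fun x => hconst x 0
  have hψ : ∀ x, ψ x = 0 := fun x => by
    have h1 : HasDerivAt φ 0 x := by
      rw [show φ = fun _ => φ 0 from funext hφ]
      exact hasDerivAt_const x _
    exact (P.deriv_φ x).unique h1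
  have hgrad : gradient V (φ 0) = 0 := by
    have h1 : HasDerivAt ψ 0 0 := by
      rw [show ψ = fun _ => 0 from funext hψ]
      exact hasDerivAt_const _ _
    have h2 := (P.deriv_ψ 0).unique h1
    rwa [hψ 0, smul_zero, neg_zero, zero_add] at h2
  have hφ0 : φ 0 = 0 := by
    have h1 := inner_gradient_ge h.contDiff D h0 (hesc 0 le_rfl)
    rw [hgrad, inner_zero_right] at h1
    have h2 : ‖φ 0‖ ^ 2 ≤ 0 := by
      by_contra! h3
      have := mul_pos (half_pos D.lmin_pos) h3
      linarith
    exact norm_eq_zero.1 (pow_eq_zero_iff two_ne_zero |>.1 (le_antisymm h2 (sq_nonneg _)))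
  obtain ⟨L, hL, c₀, hc₀, hmass⟩ := F.mass
  have hex : ∀ p, ∃ x ∈ Icc (-L) L,
      c₀ ≤ ∫ r in (R (t p) - L)..(R (t p) + L), SolBound.qDen u r (t p) → 0 < t p →
        c₀ / (4 * L) ≤ SolBound.qDen u (R (t p) + x) (t p) := by
    intro p
    by_contra! hlt
    obtain ⟨hm, htp, -⟩ := hlt 0 ⟨by linarith, hL.le⟩
    have h2 : ∫ r in (R (t p) - L)..(R (t p) + L), SolBound.qDen u r (t p) ≤
        ∫ r in (R (t p) - L)..(R (t p) + L), c₀ / (4 * L) := by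
      refine intervalIntegral.integral_mono_on (by linarith)
        ((h.continuous_qDen htp).intervalIntegrable _ _)
        (continuous_const.intervalIntegrable _ _) fun r hr => ?_
      obtain ⟨-, -, h3⟩ := hlt (r - R (t p)) ⟨by linarith [hr.1], by linarith [hr.2]⟩
      rw [add_sub_cancel] at h3
      exact h3.le
    rw [intervalIntegral.integral_const, smul_eq_mul,
      show (R (t p) + L - (R (t p) - L)) * (c₀ / (4 * L)) = c₀ / 2 by field_simp; ring] at h2
    linarith
  choose x hxL hx using hex
  obtain ⟨y, -, hy⟩ := (isCompact_Icc (a := -L) (b := L)).ultrafilter_le_nhds' (U.map x)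
    (show ∀ᶠ p in (U : Filter ℕ), x p ∈ Icc (-L) L from Eventually.of_forall hxL)
  have hxy : Tendsto (fun p => C * |x p - y|) U (𝓝 0) := by
    have h2 : Tendsto x U (𝓝 y) := hy
    have h3 := (h2.sub_const y).abs.const_mul C
    rwa [sub_self, abs_zero, mul_zero] at h3
  have hsmall : ∀ᶠ p in (U : Filter ℕ), 0 ≤ R (t p) + x p ∧ 0 ≤ R (t p) + y := by
    filter_upwards [qge L, qge (-y)] with p h2 h3
    exact ⟨by linarith [(hxL p).1], by linarith⟩
  have l1 : Tendsto (fun p => u (R (t p) + x p) (t p)) U (𝓝 0) := by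
    have h2 : Tendsto (fun p => u (R (t p) + x p) (t p) - u (R (t p) + y) (t p)) U (𝓝 0) := by
      refine squeeze_zero_norm' ?_ hxy
      filter_upwards [hsmall, tpos] with p h3 h4
      have := h.lip_r h3.2 h3.1 h4
      rwa [add_sub_add_left_eq_sub] at this
    have h3 := h2.add (lφ y)
    rw [hφ y, hφ0, add_zero] at h3
    exact h3.congr fun p => sub_add_cancel _ _
  have l2 : Tendsto (fun p => ur u (R (t p) + x p) (t p)) U (𝓝 0) := by
    have h2 : Tendsto (fun p => ur u (R (t p) + x p) (t p) - ur u (R (t p) + y) (t p)) U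
        (𝓝 0) := by
      refine squeeze_zero_norm' ?_ hxy
      filter_upwards [hsmall, tpos] with p h3 h4
      have := h.lip_ur h3.2 h3.1 h4
      rwa [add_sub_add_left_eq_sub] at this
    have h3 := h2.add (lψ y)
    rw [hψ y, add_zero] at h3
    exact h3.congr fun p => sub_add_cancel _ _
  have l3 : Tendsto (fun p => SolBound.qDen u (R (t p) + x p) (t p)) U
      (𝓝 (‖(0 : Euc n)‖ ^ 2 + ‖(0 : Euc n)‖ ^ 2)) := (l1.norm.pow 2).add (l2.norm.pow 2)
  have h4 : c₀ / (4 * L) ≤ ‖(0 : Euc n)‖ ^ 2 + ‖(0 : Euc n)‖ ^ 2 := by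
    refine ge_of_tendsto l3 ?_
    filter_upwards [tpos, hU (ht.eventually hmass)] with p h5 h6
    exact hx p h6 h5
  have h5 : 0 < c₀ / (4 * L) := by positivity
  rw [norm_zero] at h4
  linarith

end FrontTrack

/-! ### Control of the mean speed of the escape point -/

/-- At time `τ`, the escape point is at distance at least `N` from both ends of the window
`[cτ/2, H(τ - S)]`, on which the solution is under control during `[τ - S, τ + S]`. -/
structure Window {V : Euc n → ℝ} (D : EscData n V) (u : ℝ → ℝ → Euc n) (R H : ℝ → ℝ)
    (c S N τ : ℝ) : Prop where
  pos : 0 < τ - S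
  le_ℓ : N ≤ c * τ / 2
  left : c * τ / 2 + N ≤ R τ
  right : R τ + N ≤ H (τ - S)
  esc : ∀ t ∈ Icc (τ - S) (τ + S), ∀ r, R t < r → r ≤ H (τ - S) → ‖u r t‖ ≤ D.dEsc

lemma Window.anti {V : Euc n → ℝ} {D : EscData n V} {u : ℝ → ℝ → Euc n} {R H : ℝ → ℝ}
    {c S N N' τ : ℝ} (h : Window D u R H c S N τ) (hN : N' ≤ N) : Window D u R H c S N' τ :=
  ⟨h.pos, hN.trans h.le_ℓ, by linarith [h.left], by linarith [h.right], h.esc⟩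

lemma FrontTrack.eventually_window {V : Euc n → ℝ} {D : EscData n V} {u : ℝ → ℝ → Euc n}
    {R H : ℝ → ℝ} {c : ℝ} (F : FrontTrack D u R H c) {S : ℝ} (hS : 0 ≤ S) (N : ℝ) :
    ∀ᶠ τ in atTop, Window D u R H c S N τ := by
  obtain ⟨Y, hY, T, hT, hg⟩ := F.growth
  obtain ⟨T', hT'⟩ := eventually_atTop.1 F.esc
  have hc := F.c_pos
  have hsub : Tendsto (fun τ : ℝ => τ - S) atTop atTop :=
    tendsto_atTop_add_const_right _ (-S) tendsto_id
  have h1 : ∀ᶠ τ : ℝ in atTop, N ≤ c / 4 * τ :=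
    (tendsto_id.const_mul_atTop (by positivity)).eventually_ge_atTop N
  have h2 : ∀ᶠ τ : ℝ in atTop, 3 / 4 * c < R τ / τ := F.lim.eventually_const_lt (by linarith)
  have h3 : ∀ᶠ τ in atTop, N + Y * (S + 1) ≤ H (τ - S) - R (τ - S) :=
    hsub.eventually (F.gap.eventually_ge_atTop _)
  filter_upwards [h1, h2, h3, eventually_gt_atTop 0, hsub.eventually_gt_atTop 0,
    hsub.eventually_ge_atTop T, hsub.eventually_ge_atTop T'] with τ h1 h2 h3 h4 h5 h6 h7
  rw [lt_div_iff₀ h4] at h2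
  have hcτ : 0 < c * τ := by positivity
  have h8 := hg (τ - S) h6 S hS
  rw [sub_add_cancel] at h8
  refine ⟨h5, by linarith, by linarith, by linarith, fun t ht r hr1 hr2 => ?_⟩
  exact hT' t (h7.trans ht.1) r hr1 (hr2.trans (F.mono ht.1))

lemma exists_err_le {κ A β₀ S X η : ℝ} (hκ : 0 < κ) (hA : 0 < A) (hβ₀ : 0 ≤ β₀) (hS : 0 ≤ S)
    (hX : 0 ≤ X) (hη : 0 < η) : ∃ N > (0:ℝ), ∀ f : Frame, f.Adm κ A β₀ → |f.x| ≤ X →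
      ∀ ℓ B, N ≤ ℓ → ℓ + N ≤ f.ρ → f.ρ + N ≤ B → ∀ t, |t - f.τ| ≤ S → f.err ℓ B t ≤ η := by
  obtain ⟨X₁, hX₁⟩ : ∃ X₁, X₁ = X + (A + β₀) * S := ⟨_, rfl⟩
  have hlim : Tendsto (fun N : ℝ => Real.exp (A * X₁) *
      (Real.exp (-(κ * (N - X₁))) + Real.exp (-(κ * (N - X₁))) + 1 / N)) atTop
      (𝓝 (Real.exp (A * X₁) * (0 + 0 + 0))) := by
    have h1 : Tendsto (fun N : ℝ => Real.exp (-(κ * (N - X₁)))) atTop (𝓝 0) :=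
      Real.tendsto_exp_neg_atTop_nhds_zero.comp
        (Tendsto.const_mul_atTop hκ (tendsto_atTop_add_const_right _ (-X₁) tendsto_id))
    exact ((h1.add h1).add (tendsto_const_nhds.div_atTop tendsto_id)).const_mul _
  rw [add_zero, add_zero, mul_zero] at hlim
  obtain ⟨N, hNη, hN0⟩ := ((hlim.eventually_lt_const hη).and (eventually_gt_atTop 0)).exists
  refine ⟨N, hN0, fun f hf hx ℓ B hℓ h1 h2 t ht => le_trans ?_ hNη.le⟩
  have hκf := hf.κ_eq
  have ha : 0 < f.a := hκ.trans_le hf.κ_le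
  have hβ := hf.β_nonneg
  have hx' := abs_le.1 hx
  have hAS : |f.a * (t - f.τ)| ≤ A * S := by
    rw [abs_mul, abs_of_pos ha]
    exact mul_le_mul hf.a_le ht (abs_nonneg _) hA.le
  have hBS : |f.β * (t - f.τ)| ≤ β₀ * S := by
    rw [abs_mul, abs_of_nonneg hβ]
    exact mul_le_mul hf.β_le ht (abs_nonneg _) hβ₀
  have hAS' := abs_le.1 hAS
  have hBS' := abs_le.1 hBS
  have hS1 : 0 ≤ A * S := by positivity
  have hS2 : 0 ≤ β₀ * S := by positivity
  have hcut : f.cut t ≤ X₁ := by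
    unfold Frame.cut
    rw [hX₁, add_mul]
    linarith
  have e1 : f.a * f.cut t ≤ A * X₁ := by
    have hX1 : 0 ≤ X₁ := by rw [hX₁, add_mul]; linarith
    exact (mul_le_mul_of_nonneg_left hcut ha.le).trans (mul_le_mul_of_nonneg_right hf.a_le hX1)
  have dB : N - X₁ ≤ |f.dist B t| := by
    refine le_trans ?_ (le_abs_self _)
    unfold Frame.dist Frame.orig Frame.cut
    rw [hX₁, add_mul]
    linarith
  have dℓ : N - X₁ ≤ |f.dist ℓ t| := by
    refine le_trans ?_ (neg_le_abs _)
    unfold Frame.dist Frame.orig Frame.cut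
    rw [hX₁, add_mul]
    linarith
  unfold Frame.err
  rw [hκf]
  have dB' := mul_le_mul_of_nonneg_left dB hκ.le
  have dℓ' := mul_le_mul_of_nonneg_left dℓ hκ.le
  have e4 : 1 / ℓ ≤ 1 / N := one_div_le_one_div_of_le hN0 hℓ
  have e5 : 0 ≤ 1 / ℓ := one_div_nonneg.2 (hN0.le.trans hℓ)
  refine mul_le_mul (Real.exp_le_exp.2 e1) (add_le_add (add_le_add ?_ ?_) e4)
    (by positivity) (Real.exp_pos _).le
  · exact Real.exp_le_exp.2 (by linarith)
  · exact Real.exp_le_exp.2 (by linarith)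

lemma exists_nonfront {V : Euc n → ℝ} (hdisc : HDiscVel V) (h0 : (0 : Euc n) ∈ MinSet V)
    {x y : ℝ} (hx : 0 ≤ x) (hxy : x < y) :
    ∃ a, x < a ∧ a < y ∧ ¬ (PhiInv V a 0).Nonempty := by
  by_contra! hcon
  have h1 : Ioo x y ⊆ interior {c : ℝ | 0 ≤ c ∧ (PhiInv V c 0).Nonempty} :=
    interior_maximal (fun a ha => ⟨hx.trans ha.1.le, hcon a ha.1 ha.2⟩) isOpen_Ioo
  rw [hdisc 0 h0] at h1
  obtain ⟨a, ha⟩ := exists_between hxy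
  exact h1 ha

/-- A function of controlled growth which cannot remain above its initial value for a long time
has no high peaks. -/
lemma exists_no_peak {g : ℝ → ℝ} {a γ C₀ T₀ K : ℝ} (ha : 0 < a) (hγ : 0 < γ) (hK : 0 < K)
    (hgrow : ∀ t ≥ T₀, ∀ s ≥ 0, g (t + s) ≤ g t + γ * s + C₀)
    (hstar : ∀ T > 0, ∃ t', ∀ t₀ ≥ t', ∀ v₁ v₂ t₂ q, t₀ ≤ v₁ → v₁ ≤ v₂ → v₂ ≤ t₂ → t₂ ≤ t₀ + T →
      (∀ v ∈ Icc v₁ v₂, q ≤ g v - g t₀) →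
      (v₂ - v₁) * Real.exp (a * q) ≤ K * (1 + Real.exp (a * (g t₂ - g t₀)))) :
    ∃ M ≥ (0:ℝ), ∃ t', ∀ t₀ t₁ t₂, t' ≤ t₀ → t₀ < t₁ → t₁ < t₂ → g t₀ ≤ g t₁ - M →
      g t₂ ≤ g t₁ - M → False := by
  obtain ⟨M, hM1, hM2, hM3⟩ : ∃ M, γ + C₀ ≤ M ∧ 0 ≤ M ∧
      2 * K * Real.exp (-(a * M)) < Real.exp (-(a * (γ + C₀))) := by
    have hlim : Tendsto (fun M => 2 * K * Real.exp (-(a * M))) atTop (𝓝 (2 * K * 0)) :=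
      (Real.tendsto_exp_neg_atTop_nhds_zero.comp (tendsto_id.const_mul_atTop ha)).const_mul _
    rw [mul_zero] at hlim
    obtain ⟨M, h1, h2, h3⟩ := ((hlim.eventually_lt_const (Real.exp_pos (-(a * (γ + C₀))))).and
      ((eventually_ge_atTop (γ + C₀)).and (eventually_ge_atTop 0))).exists
    exact ⟨M, h2, h3, h1⟩
  obtain ⟨S, hS⟩ : ∃ S, S = K * Real.exp (a * M) * (1 + Real.exp a) + 1 := ⟨_, rfl⟩
  have hSp : 0 < S := by rw [hS]; positivity
  obtain ⟨t', ht'⟩ := hstar (2 * S) (by positivity)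
  refine ⟨M + 1, by linarith, max T₀ t', fun t₀ t₁' t₂ ht₀ h01 h12 hg0 hg2 => ?_⟩
  have hT₀ : T₀ ≤ t₀ := (le_max_left _ _).trans ht₀
  have ht₀' : t' ≤ t₀ := (le_max_right _ _).trans ht₀
  obtain ⟨t₁, h1m, h1max, hg1⟩ : ∃ t₁ ∈ Icc t₀ t₂, (∀ v ∈ Icc t₀ t₂, g v ≤ g t₁ + 1) ∧
      g t₁' ≤ g t₁ + 1 := by
    have hne : (g '' Icc t₀ t₂).Nonempty := ⟨g t₀, t₀, ⟨le_rfl, by linarith⟩, rfl⟩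
    obtain ⟨y, ⟨t₁, ht₁, rfl⟩, hy⟩ := exists_lt_of_lt_csSup hne
      (sub_one_lt (sSup (g '' Icc t₀ t₂)))
    have hbdd : BddAbove (g '' Icc t₀ t₂) := by
      refine ⟨g t₀ + γ * (t₂ - t₀) + C₀, ?_⟩
      rintro _ ⟨v, hv, rfl⟩
      have h1 := hgrow t₀ hT₀ (v - t₀) (by linarith [hv.1])
      rw [add_sub_cancel] at h1
      have h2 := mul_le_mul_of_nonneg_left (by linarith [hv.2] : v - t₀ ≤ t₂ - t₀) hγ.le
      linarith
    have hmax : ∀ v ∈ Icc t₀ t₂, g v ≤ g t₁ + 1 := fun v hv => by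
      have := le_csSup hbdd (mem_image_of_mem g hv)
      linarith
    exact ⟨t₁, ht₁, hmax, hmax t₁' ⟨h01.le, h12.le⟩⟩
  have hg0' : g t₀ ≤ g t₁ - M := by linarith
  have hg2' : g t₂ ≤ g t₁ - M := by linarith
  have hSM : K * (1 + Real.exp a) < S * Real.exp (-(a * M)) := by
    have h1 : Real.exp (a * M) * Real.exp (-(a * M)) = 1 := by
      rw [← Real.exp_add, add_neg_cancel, Real.exp_zero]
    have h2 : S * Real.exp (-(a * M)) =
        K * (1 + Real.exp a) * (Real.exp (a * M) * Real.exp (-(a * M))) + Real.exp (-(a * M)) := by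
      rw [hS]; ring
    rw [h2, h1]
    linarith [Real.exp_pos (-(a * M))]
  obtain ⟨s₀, hs0, hs1, hs2, hgs⟩ : ∃ s₀, t₀ ≤ s₀ ∧ s₀ ≤ t₁ ∧ t₁ - S ≤ s₀ ∧ g s₀ ≤ g t₁ - M := by
    by_cases hc : t₁ - S ≤ t₀
    · exact ⟨t₀, le_rfl, h1m.1, hc, hg0'⟩
    by_contra! hcon
    push Not at hc
    obtain ⟨m, hm⟩ : ∃ m, m = g t₁ - g (t₁ - S) := ⟨_, rfl⟩
    have h1 := ht' (t₁ - S) (by linarith) (t₁ - S) t₁ t₁ (m - M) le_rfl (by linarith) le_rfl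
      (by linarith) fun v hv => by
        have := hcon v (by linarith [hv.1]) hv.2 hv.1
        linarith
    rw [← hm, sub_sub_cancel] at h1
    have h2 : -m ≤ 1 := by
      have := h1max (t₁ - S) ⟨hc.le, by linarith [h1m.2]⟩
      linarith
    have h3 : Real.exp (a * (m - M)) = Real.exp (a * m) * Real.exp (-(a * M)) := by
      rw [← Real.exp_add]; ring_nf
    have h4 : K * (1 + Real.exp (a * m)) ≤ Real.exp (a * m) * (K * (1 + Real.exp a)) := by
      have h5 : (1:ℝ) ≤ Real.exp (a * m) * Real.exp a := by
        rw [← Real.exp_add]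
        refine Real.one_le_exp ?_
        have := mul_le_mul_of_nonneg_left h2 ha.le
        linarith
      have h6 := mul_le_mul_of_nonneg_left h5 hK.le
      linarith
    rw [h3] at h1
    have h5 := mul_lt_mul_of_pos_left hSM (Real.exp_pos (a * m))
    linarith
  obtain ⟨s₂, hr0, hr1, hr2, hgr⟩ : ∃ s₂, s₂ ≤ t₂ ∧ t₁ ≤ s₂ ∧ s₂ ≤ t₁ + S ∧ g s₂ ≤ g t₁ - M := by
    by_cases hc : t₂ ≤ t₁ + S
    · exact ⟨t₂, le_rfl, h1m.2, hc, hg2'⟩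
    by_contra! hcon
    push Not at hc
    have h1 := ht' t₁ (by linarith [h1m.1]) t₁ (t₁ + S) (t₁ + S) (-M) le_rfl (by linarith) le_rfl
      (by linarith) fun v hv => by
        have := hcon v (by linarith [hv.2]) hv.1 hv.2
        linarith
    have h2 := h1max (t₁ + S) ⟨by linarith [h1m.1], hc.le⟩
    have h3 : Real.exp (a * (g (t₁ + S) - g t₁)) ≤ Real.exp a := by
      refine Real.exp_le_exp.2 ?_
      have := mul_le_mul_of_nonneg_left (by linarith : g (t₁ + S) - g t₁ ≤ 1) ha.le
      linarith
    have h4 := mul_le_mul_of_nonneg_left h3 hK.le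
    rw [add_sub_cancel_left, mul_neg] at h1
    linarith
  have hs3 : s₀ ≤ t₁ - 1 := by
    by_contra! hlt
    have h1 := hgrow s₀ (hT₀.trans hs0) (t₁ - s₀) (by linarith)
    rw [add_sub_cancel] at h1
    have := mul_lt_mul_of_pos_left (by linarith : t₁ - s₀ < 1) hγ
    linarith
  obtain ⟨m, hm⟩ : ∃ m, m = g t₁ - g s₀ := ⟨_, rfl⟩
  have hmM : M ≤ m := by linarith
  have h1 := ht' s₀ (ht₀'.trans hs0) (t₁ - 1) t₁ s₂ (m - (γ + C₀)) hs3 (by linarith) hr1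
    (by linarith) fun v hv => by
      have h2 := hgrow v (by linarith [hv.1]) (t₁ - v) (by linarith [hv.2])
      rw [add_sub_cancel] at h2
      have h3 := mul_le_mul_of_nonneg_left (by linarith [hv.1] : t₁ - v ≤ 1) hγ.le
      linarith
  rw [sub_sub_cancel, one_mul] at h1
  have h2 : Real.exp (a * (m - (γ + C₀))) = Real.exp (a * m) * Real.exp (-(a * (γ + C₀))) := by
    rw [← Real.exp_add]; ring_nf
  have h3 : Real.exp (a * (g s₂ - g s₀)) ≤ Real.exp (a * m) * Real.exp (-(a * M)) := by
    rw [← Real.exp_add]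
    refine Real.exp_le_exp.2 ?_
    have := mul_le_mul_of_nonneg_left (by linarith : g s₂ - g s₀ ≤ m - M) ha.le
    linarith
  have h4 : (1:ℝ) ≤ Real.exp (a * m) * Real.exp (-(a * M)) := by
    rw [← Real.exp_add]
    refine Real.one_le_exp ?_
    have := mul_le_mul_of_nonneg_left hmM ha.le
    linarith
  have h5 := mul_lt_mul_of_pos_left hM3 (Real.exp_pos (a * m))
  have h6 := mul_le_mul_of_nonneg_left (add_le_add h4 h3) hK.le
  rw [h2] at h1
  linarith

namespace Frame

lemma half_exp_le_wt {f : Frame} (hf : 0 ≤ f.a + 2 * f.κ) {r t : ℝ} (h : f.dist r t ≤ 0) :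
    Real.exp (f.a * (r - f.orig t)) / 2 ≤ f.wt 0 r t := by
  unfold wt
  rw [zero_mul, add_zero]
  refine div_le_div_of_nonneg_left (Real.exp_pos _).le (by positivity) ?_
  have : Real.exp ((f.a + 2 * f.κ) * f.dist r t) ≤ 1 :=
    Real.exp_le_one_iff.2 (mul_nonpos_of_nonneg_of_nonpos hf h)
  linarith

end Frame

namespace SolBound

variable {d : ℕ} {V : Euc n → ℝ} {u : ℝ → ℝ → Euc n} {C Λ : ℝ}

/-- The localized dissipation controls the dissipation in an interval behind the cut-off. -/
lemma exp_mul_le_D (h : SolBound d V u C Λ) {f : Frame} (hfκ : 0 ≤ f.κ) (hfa : 0 ≤ f.a)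
    {ℓ B b₁ b₂ t q : ℝ} (ht : 0 < t) (hℓ : 0 < ℓ) (h1 : ℓ ≤ b₁) (h12 : b₁ ≤ b₂) (h2 : b₂ ≤ B)
    (hq : q ≤ b₁ - f.orig t) (hcut : b₂ - f.orig t ≤ f.cut t) :
    Real.exp (f.a * q) / 2 * ∫ r in b₁..b₂, ‖zDen u f.a r t‖ ^ 2 ≤ f.D u ℓ B t := by
  have cZ : ContinuousOn (fun r => zDen u f.a r t) (Icc ℓ B) :=
    (h.continuousOn_zDen f.a ht).mono fun x hx => hℓ.trans_le hx.1
  have c0 : Continuous fun r => f.wt 0 r t := (f.isWeight_wt 0).cont_left t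
  have c1 : ContinuousOn (fun r => f.wt 0 r t * ‖zDen u f.a r t‖ ^ 2) (Icc ℓ B) :=
    c0.continuousOn.mul (cZ.norm.pow 2)
  have hsub : Icc b₁ b₂ ⊆ Icc ℓ B := Icc_subset_Icc h1 h2
  have i1 : IntervalIntegrable (fun r => f.wt 0 r t * ‖zDen u f.a r t‖ ^ 2) volume ℓ B :=
    ContinuousOn.intervalIntegrable (by rwa [uIcc_of_le (h1.trans (h12.trans h2))])
  have i2 : IntervalIntegrable (fun r => f.wt 0 r t * ‖zDen u f.a r t‖ ^ 2) volume b₁ b₂ :=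
    ContinuousOn.intervalIntegrable (by rw [uIcc_of_le h12]; exact c1.mono hsub)
  have i3 : IntervalIntegrable (fun r => Real.exp (f.a * q) / 2 * ‖zDen u f.a r t‖ ^ 2)
      volume b₁ b₂ :=
    ContinuousOn.intervalIntegrable (by
      rw [uIcc_of_le h12]
      exact continuousOn_const.mul ((cZ.mono hsub).norm.pow 2))
  calc Real.exp (f.a * q) / 2 * ∫ r in b₁..b₂, ‖zDen u f.a r t‖ ^ 2
      = ∫ r in b₁..b₂, Real.exp (f.a * q) / 2 * ‖zDen u f.a r t‖ ^ 2 :=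
        (intervalIntegral.integral_const_mul _ _).symm
    _ ≤ ∫ r in b₁..b₂, f.wt 0 r t * ‖zDen u f.a r t‖ ^ 2 := by
        refine intervalIntegral.integral_mono_on h12 i3 i2 fun r hr => ?_
        refine mul_le_mul_of_nonneg_right ?_ (sq_nonneg _)
        refine le_trans ?_ (Frame.half_exp_le_wt (by positivity) ?_)
        · have := mul_le_mul_of_nonneg_left (by linarith [hr.1] : q ≤ r - f.orig t) hfa
          have := Real.exp_le_exp.2 this
          linarith
        · unfold Frame.dist
          linarith [hr.2]
    _ ≤ ∫ r in ℓ..B, f.wt 0 r t * ‖zDen u f.a r t‖ ^ 2 :=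
        intervalIntegral.integral_mono_interval h1 h12 h2
          (Eventually.of_forall fun r => mul_nonneg (f.wt_pos 0 r t).le (sq_nonneg _)) i1

lemma D_nonneg (f : Frame) (u : ℝ → ℝ → Euc n) {ℓ B : ℝ} (hB : ℓ ≤ B) (t : ℝ) :
    0 ≤ f.D u ℓ B t :=
  intervalIntegral.integral_nonneg hB fun r _ => mul_nonneg (f.wt_pos 0 r t).le (sq_nonneg _)

end SolBound

namespace FrontTrack

variable {d : ℕ} {V : Euc n → ℝ} {D : EscData n V} {u : ℝ → ℝ → Euc n} {C Λ c : ℝ}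
  {R H : ℝ → ℝ}

/-- At a speed which is not the speed of a front, the escape point cannot remain for a long time
ahead of its initial position. -/
lemma exists_time_bound (F : FrontTrack D u R H c) (h : SolBound d V u C Λ)
    (h0 : (0 : Euc n) ∈ MinSet V) (hnd : HNonDeg V) (hbist : HOnlyBist V)
    {κ A γ a C₀ T₀ : ℝ} (hκ : 0 < κ) (hlam : (A + κ) * (κ + κ) ≤ D.lmin / 4)
    (hκa : κ ≤ a) (haA : a ≤ A) (hγ : 0 ≤ γ) (hγκ : (A + κ) * γ ≤ κ * κ / 2)
    (hempty : ¬ (PhiInv V a 0).Nonempty)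
    (hgrow : ∀ t ≥ T₀, ∀ s ≥ 0, R (t + s) - a * (t + s) ≤ R t - a * t + γ * s + C₀) :
    ∃ K > 0, ∀ T > 0, ∃ t', ∀ t₀ ≥ t', ∀ v₁ v₂ t₂ q, t₀ ≤ v₁ → v₁ ≤ v₂ → v₂ ≤ t₂ → t₂ ≤ t₀ + T →
      (∀ v ∈ Icc v₁ v₂, q ≤ R v - a * v - (R t₀ - a * t₀)) →
      (v₂ - v₁) * Real.exp (a * q) ≤
        K * (1 + Real.exp (a * (R t₂ - a * t₂ - (R t₀ - a * t₀)))) := by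
  have ha : 0 < a := hκ.trans_le hκa
  have hA : 0 < A := ha.trans_le haA
  obtain ⟨ε, hε, W, hW, T₁, hdiss⟩ := F.exists_dissip_ge h ha h0 hnd hbist hempty
  obtain ⟨K, hK, hrun⟩ := h.exists_run D h0 hA hκ hκ.le hlam
  obtain ⟨ω, hω⟩ : ∃ ω, ω = (a + κ) * γ - κ * κ := ⟨_, rfl⟩
  have hκκ : 0 < κ * κ := by positivity
  have hωneg : ω < 0 := by
    have := mul_le_mul_of_nonneg_right (by linarith : a + κ ≤ A + κ) hγ
    linarith
  have hγle : γ ≤ κ := by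
    have h1 := mul_le_mul_of_nonneg_right (by linarith : κ ≤ A + κ) hγ
    by_contra! h2
    have := mul_lt_mul_of_pos_left h2 hκ
    linarith
  obtain ⟨x, hx⟩ : ∃ x, x = |C₀| + W := ⟨_, rfl⟩
  have hx0 : 0 ≤ x := by rw [hx]; positivity
  have hCx : C₀ + W ≤ x := by rw [hx]; linarith [le_abs_self C₀]
  have hΛ := h.Λ_pos
  have hC := h.C_pos
  obtain ⟨K₁, hK₁⟩ : ∃ K₁, K₁ = 2 * ((1 + Λ) * C ^ 2 * (2 / κ) * Real.exp (a * x)) +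
    K * (2 * C ^ 2 * (2 / κ) * Real.exp (a * x) +
      Real.exp ((a + κ) * C₀ - κ * x) / |ω| + 1) + 2 * ((1 + Λ) * C ^ 2 / κ) := ⟨_, rfl⟩
  have hωp : 0 < |ω| := abs_pos.2 hωneg.ne
  obtain ⟨Q, hQ⟩ : ∃ Q, Q = Real.exp (-(a * W)) / 2 * ε := ⟨_, rfl⟩
  have hQp : 0 < Q := by rw [hQ]; positivity
  have hK₁p : 0 < K₁ := by rw [hK₁]; positivity
  refine ⟨K₁ / Q, by positivity, fun T hT => ?_⟩
  obtain ⟨N, hN, herr⟩ := exists_err_le (κ := κ) (A := A) (β₀ := κ) (S := T) (X := x)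
    (η := 1 / T) hκ hA hκ.le hT.le hx0 (by positivity)
  obtain ⟨Y, hY⟩ : ∃ Y, Y = max N (W + |C₀| + (A + κ) * T + 1) := ⟨_, rfl⟩
  have hev := ((F.eventually_window hT.le Y).and (eventually_ge_atTop (max T₀ T₁))).and
    (eventually_gt_atTop 0)
  obtain ⟨t', ht'⟩ := eventually_atTop.1 hev
  refine ⟨t', fun t₀ ht₀ v₁ v₂ t₂ q h1 h2 h3 h4 hq => ?_⟩
  obtain ⟨⟨win, hmax⟩, ht0⟩ := ht' t₀ ht₀
  have hT₀ := (le_max_left _ _).trans hmax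
  have hT₁ := (le_max_right _ _).trans hmax
  have winN := win.anti ((le_max_left _ _).trans hY.ge)
  have winW := win.anti ((le_max_right _ _).trans hY.ge)
  obtain ⟨f, hf⟩ : ∃ f : Frame, f = ⟨a, κ, κ, x, R t₀, t₀⟩ := ⟨_, rfl⟩
  have fa : f.a = a := by rw [hf]
  have fκ : f.κ = κ := by rw [hf]
  have fβ : f.β = κ := by rw [hf]
  have fx : f.x = x := by rw [hf]
  have fρ : f.ρ = R t₀ := by rw [hf]
  have fτ : f.τ = t₀ := by rw [hf]
  have hadm : f.Adm κ A κ := ⟨hκ, fκ, by rwa [fa], by rwa [fa], by rw [fβ]; exact hκ.le, fβ.le⟩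
  have hℓ : 0 < c * t₀ / 2 := hN.trans_le winN.le_ℓ
  have hℓB : c * t₀ / 2 ≤ H (t₀ - T) := by linarith [winN.left, winN.right]
  have ht₂ : t₀ ≤ t₂ := by linarith
  have forig : ∀ t, f.orig t = R t₀ + a * (t - t₀) := fun t => by
    unfold Frame.orig; rw [fρ, fa, fτ]
  have fcut : ∀ t, f.cut t = x + κ * (t - t₀) := fun t => by
    unfold Frame.cut; rw [fx, fβ, fτ]
  have hpos : ∀ t ≥ t₀, R t - f.orig t ≤ γ * (t - t₀) + C₀ := fun t ht => by
    have := hgrow t₀ hT₀ (t - t₀) (by linarith)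
    rw [add_sub_cancel] at this
    rw [forig]
    linarith
  have hposeq : ∀ t, R t - f.orig t = R t - a * t - (R t₀ - a * t₀) := fun t => by
    rw [forig]; ring
  have hesc : ∀ t ∈ Icc t₀ t₂, ∀ r ∈ Icc (c * t₀ / 2) (H (t₀ - T)), ∀ p, R t - f.orig t ≤ p →
      f.orig t + p < r → ‖u r t‖ ≤ D.dEsc := fun t ht r hr p hp hlt =>
    win.esc t ⟨by linarith [ht.1], by linarith [ht.2]⟩ r (by linarith) hr.2
  obtain ⟨-, hE⟩ := hrun f hadm (c * t₀ / 2) (H (t₀ - T)) t₀ t₂ (1 / T) C₀ γ ω hℓ hℓB ht0 ht₂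
    (fun t ht => herr f hadm (by rw [fx, abs_of_nonneg hx0]) _ _ winN.le_ℓ
      (by rw [fρ]; exact winN.left) (by rw [fρ]; exact winN.right) t
      (by rw [fτ, abs_of_nonneg (by linarith [ht.1])]; linarith [ht.2]))
    (by rw [fa, fβ]; exact hω) (Or.inl ⟨hωneg, fτ.le⟩)
    (fun t ht r hr hlt => hesc t ht r hr _ (by
      have := hpos t ht.1; rw [fτ]; linarith) hlt)
  have e1 := (le_abs_self _).trans (h.abs_E_le hadm hℓ hℓB ht0)
  have e2 := h.G_le hadm hℓ hℓB ht0
  have e3 := h.neg_E_le D h0 hadm hℓ hℓB (ht0.trans_le ht₂) (p := R t₂ - f.orig t₂)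
    (fun r hr hlt => hesc t₂ ⟨ht₂, le_rfl⟩ r hr _ le_rfl hlt)
  rw [fcut, fa, sub_self, mul_zero, add_zero] at e1 e2
  rw [fa, hposeq] at e3
  rw [fa, fx] at hE
  have hηT : 1 / T * (t₂ - t₀) ≤ 1 := by
    rw [one_div_mul_eq_div, div_le_one hT]
    linarith
  obtain ⟨X, hX⟩ : ∃ X, X = Real.exp (a * (R t₂ - a * t₂ - (R t₀ - a * t₀))) := ⟨_, rfl⟩
  rw [← hX] at e3 ⊢
  have hXp : 0 < X := by rw [hX]; positivity
  have hub : (∫ t in t₀..t₂, f.D u (c * t₀ / 2) (H (t₀ - T)) t) ≤ K₁ * (1 + X) := by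
    have m1 := mul_le_mul_of_nonneg_left (add_le_add (add_le_add e2
      (le_refl (Real.exp ((a + κ) * C₀ - κ * x) / |ω|))) hηT) hK.le
    have m2 : 0 ≤ (2 * ((1 + Λ) * C ^ 2 * (2 / κ) * Real.exp (a * x)) +
      K * (2 * C ^ 2 * (2 / κ) * Real.exp (a * x) +
        Real.exp ((a + κ) * C₀ - κ * x) / |ω| + 1)) * X := by positivity
    have m3 : 0 ≤ 2 * ((1 + Λ) * C ^ 2 / κ) := by positivity
    rw [hK₁]
    linarith
  have cD := h.continuousOn_D f hℓ hℓB
  have hlb : (v₂ - v₁) * (Real.exp (a * (q - W)) / 2 * ε) ≤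
      ∫ t in t₀..t₂, f.D u (c * t₀ / 2) (H (t₀ - T)) t := by
    have i1 : IntervalIntegrable (fun t => f.D u (c * t₀ / 2) (H (t₀ - T)) t) volume t₀ t₂ :=
      ContinuousOn.intervalIntegrable (by
        rw [uIcc_of_le ht₂]; exact cD.mono fun t ht => ht0.trans_le ht.1)
    have i2 : IntervalIntegrable (fun t => f.D u (c * t₀ / 2) (H (t₀ - T)) t) volume v₁ v₂ :=
      ContinuousOn.intervalIntegrable (by
        rw [uIcc_of_le h2]; exact cD.mono fun t ht => ht0.trans_le (h1.trans ht.1))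
    calc (v₂ - v₁) * (Real.exp (a * (q - W)) / 2 * ε)
        = ∫ t in v₁..v₂, Real.exp (a * (q - W)) / 2 * ε := by
          rw [intervalIntegral.integral_const, smul_eq_mul]
      _ ≤ ∫ t in v₁..v₂, f.D u (c * t₀ / 2) (H (t₀ - T)) t := by
          refine intervalIntegral.integral_mono_on h2
            (continuous_const.intervalIntegrable _ _) i2 fun t ht => ?_
          have htt : t₀ ≤ t := h1.trans ht.1
          have p1 := hpos t htt
          have p2 := mul_le_mul_of_nonneg_right hγle (by linarith : 0 ≤ t - t₀)
          have p3 : (A + κ) * (t - t₀) ≤ (A + κ) * T :=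
            mul_le_mul_of_nonneg_left (by linarith [ht.2]) (by positivity)
          have p4 := mul_le_mul_of_nonneg_right haA (by linarith : 0 ≤ t - t₀)
          have p5 := hq t ht
          rw [← hposeq] at p5
          have p6 := (ht' t (ht₀.trans htt)).1.1.left
          have p7 := le_max_right N (W + |C₀| + (A + κ) * T + 1)
          have p8 := mul_le_mul_of_nonneg_left htt F.c_pos.le
          have p9 : 0 ≤ (A + κ) * T := by positivity
          have p10 := abs_nonneg C₀
          have p11 := winW.right
          have p12 := le_abs_self C₀
          have p13 := forig t
          have key := h.exp_mul_le_D (f := f) (by rw [fκ]; exact hκ.le) (by rw [fa]; exact ha.le)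
            (b₁ := R t - W) (b₂ := R t + W) (B := H (t₀ - T)) (q := q - W)
            (ht0.trans_le htt) hℓ (by linarith) (by linarith) (by linarith) (by linarith)
            (by rw [fcut]; linarith)
          rw [fa] at key
          exact (mul_le_mul_of_nonneg_left (hdiss t (hT₁.trans htt)) (by positivity)).trans key
      _ ≤ ∫ t in t₀..t₂, f.D u (c * t₀ / 2) (H (t₀ - T)) t :=
          intervalIntegral.integral_mono_interval h1 h2 h3
            (Eventually.of_forall fun t => SolBound.D_nonneg f u hℓB t) i1
  have hexp : Real.exp (a * (q - W)) / 2 * ε = Q * Real.exp (a * q) := by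
    rw [hQ, mul_sub, Real.exp_sub, Real.exp_neg]
    field_simp
  rw [hexp] at hlb
  rw [div_mul_eq_mul_div, le_div_iff₀ hQp]
  linarith

end FrontTrack

namespace FrontTrack

variable {d : ℕ} {V : Euc n → ℝ} {D : EscData n V} {u : ℝ → ℝ → Euc n} {C Λ c : ℝ}
  {R H : ℝ → ℝ}

lemma tendsto_sub_mul (F : FrontTrack D u R H c) (a : ℝ) :
    (c < a → Tendsto (fun t => R t - a * t) atTop atBot) ∧
      (a < c → Tendsto (fun t => R t - a * t) atTop atTop) := by
  have h1 : Tendsto (fun t => R t / t - a) atTop (𝓝 (c - a)) := F.lim.sub_const a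
  have h2 : (fun t => (R t / t - a) * t) =ᶠ[atTop] fun t => R t - a * t := by
    filter_upwards [eventually_gt_atTop 0] with t ht
    field_simp
  exact ⟨fun h => (h1.neg_mul_atTop (by linarith) tendsto_id).congr' h2,
    fun h => (h1.pos_mul_atTop (by linarith) tendsto_id).congr' h2⟩

/-- Existence of admissible decay rates. -/
lemma exists_rate (F : FrontTrack D u R H c) {A : ℝ} (hA : 0 < A) :
    ∃ κ > 0, κ ≤ c / 2 ∧ (A + κ) * (κ + κ) ≤ D.lmin / 4 := by
  have hc := F.c_pos
  have hl := D.lmin_pos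
  refine ⟨min (c / 2) (D.lmin / (8 * (A + c))), lt_min (by positivity) (by positivity),
    min_le_left _ _, ?_⟩
  obtain ⟨κ, hκ⟩ : ∃ κ, κ = min (c / 2) (D.lmin / (8 * (A + c))) := ⟨_, rfl⟩
  have h1 : κ ≤ c / 2 := hκ ▸ min_le_left _ _
  have h2 : κ ≤ D.lmin / (8 * (A + c)) := hκ ▸ min_le_right _ _
  have h3 : 0 < κ := hκ ▸ lt_min (by positivity) (by positivity)
  rw [← hκ]
  rw [le_div_iff₀ (by positivity)] at h2
  have h4 := mul_le_mul_of_nonneg_right (by linarith : A + κ ≤ A + c) h3.le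
  linarith

lemma exists_upper (F : FrontTrack D u R H c) (h : SolBound d V u C Λ)
    (h0 : (0 : Euc n) ∈ MinSet V) (hnd : HNonDeg V) (hbist : HOnlyBist V) (hdisc : HDiscVel V)
    {η : ℝ} (hη : 0 < η) :
    ∃ C₀ T₀ : ℝ, ∀ t ≥ T₀, ∀ s ≥ 0, R (t + s) - R t ≤ (c + η) * s + C₀ := by
  obtain ⟨Y, hY, T, -, hg⟩ := F.growth
  have hc := F.c_pos
  obtain ⟨κ, hκ, hκc, hlam⟩ := F.exists_rate (A := Y + c) (by positivity)
  obtain ⟨γ, hγ⟩ : ∃ γ, γ = κ * κ / 2 / (Y + c + κ) := ⟨_, rfl⟩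
  have hγp : 0 < γ := by rw [hγ]; positivity
  have hγκ : (Y + c + κ) * γ ≤ κ * κ / 2 := by
    rw [hγ, mul_div_cancel₀ _ (by positivity)]
  obtain ⟨Sl, hSl⟩ : ∃ Sl : Set ℝ, Sl = {σ | c ≤ σ ∧ ∃ C₀ T₀ : ℝ, ∀ t ≥ T₀, ∀ s ≥ 0,
    R (t + s) - R t ≤ σ * s + C₀} := ⟨_, rfl⟩
  have hbdd : BddBelow Sl := ⟨c, fun σ hσ => by rw [hSl] at hσ; exact hσ.1⟩
  have hYm : Y + c ∈ Sl := by
    rw [hSl]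
    refine ⟨by linarith, Y, T, fun t ht s hs => ?_⟩
    have := hg t ht s hs
    have := mul_nonneg hc.le hs
    linarith
  have hup : ∀ y, sInf Sl < y → ∃ C₀ T₀ : ℝ, ∀ t ≥ T₀, ∀ s ≥ 0, R (t + s) - R t ≤ y * s + C₀ := by
    intro y hy
    obtain ⟨σ, hσ, hσy⟩ := exists_lt_of_csInf_lt ⟨_, hYm⟩ hy
    rw [hSl] at hσ
    obtain ⟨-, C₀, T₀, h1⟩ := hσ
    refine ⟨C₀, T₀, fun t ht s hs => ?_⟩
    have := h1 t ht s hs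
    have := mul_le_mul_of_nonneg_right hσy.le hs
    linarith
  have hle : sInf Sl ≤ c := by
    by_contra! hlt
    obtain ⟨a, ha1, ha2, hempty⟩ := exists_nonfront hdisc h0
      (x := max c (sInf Sl - γ / 2)) (y := sInf Sl) (hc.le.trans (le_max_left _ _))
      (max_lt hlt (by linarith))
    have hca : c < a := (le_max_left _ _).trans_lt ha1
    have hγa : sInf Sl - γ / 2 < a := (le_max_right _ _).trans_lt ha1
    obtain ⟨C₀, T₀, hC₀⟩ := hup (a + γ) (by linarith)
    have hgrow : ∀ t ≥ T₀, ∀ s ≥ 0, R (t + s) - a * (t + s) ≤ R t - a * t + γ * s + C₀ :=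
      fun t ht s hs => by linarith [hC₀ t ht s hs]
    have haA : a ≤ Y + c := ha2.le.trans (csInf_le hbdd hYm)
    obtain ⟨K, hK, hstar⟩ := F.exists_time_bound h h0 hnd hbist hκ hlam (by linarith) haA hγp.le
      hγκ hempty hgrow
    obtain ⟨M, hM, t', hpeak⟩ := exists_no_peak (g := fun t => R t - a * t) (hc.trans hca) hγp hK
      hgrow hstar
    have hmem : a ∈ Sl := by
      rw [hSl]
      refine ⟨hca.le, M, t', fun t ht s hs => ?_⟩
      by_contra! hcon
      have hs' : t < t + s := by
        rcases hs.eq_or_lt with h1 | h1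
        · rw [← h1, add_zero, sub_self] at hcon
          linarith
        · linarith
      obtain ⟨t₂, h2, h3⟩ := (((F.tendsto_sub_mul a).1 hca).eventually_le_atBot
        (R (t + s) - a * (t + s) - M)).and (eventually_gt_atTop (t + s)) |>.exists
      exact hpeak t (t + s) t₂ ht hs' h3 (by linarith) h2
    exact absurd (csInf_le hbdd hmem) (not_le.2 ha2)
  exact hup (c + η) (by linarith)

lemma exists_lower (F : FrontTrack D u R H c) (h : SolBound d V u C Λ)
    (h0 : (0 : Euc n) ∈ MinSet V) (hnd : HNonDeg V) (hbist : HOnlyBist V) (hdisc : HDiscVel V)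
    {η : ℝ} (hη : 0 < η) :
    ∃ C₀ T₀ : ℝ, ∀ t ≥ T₀, ∀ s ≥ 0, (c - η) * s - C₀ ≤ R (t + s) - R t := by
  have hc := F.c_pos
  obtain ⟨κ, hκ, hκc, hlam⟩ := F.exists_rate (A := c) hc
  obtain ⟨γ, hγ⟩ : ∃ γ, γ = κ * κ / 2 / (c + κ) := ⟨_, rfl⟩
  have hγp : 0 < γ := by rw [hγ]; positivity
  have hγκ : (c + κ) * γ ≤ κ * κ / 2 := by
    rw [hγ, mul_div_cancel₀ _ (by positivity)]
  obtain ⟨a, ha1, ha2, hempty⟩ := exists_nonfront hdisc h0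
      (x := max (c / 2) (max (c - η) (c - γ / 2))) (y := c)
      ((by positivity : 0 ≤ c / 2).trans (le_max_left _ _))
      (max_lt (by linarith) (max_lt (by linarith) (by linarith)))
  have hca : c / 2 < a := (le_max_left _ _).trans_lt ha1
  have hηa : c - η < a := ((le_max_left _ _).trans (le_max_right _ _)).trans_lt ha1
  have hγa : c - γ / 2 < a := ((le_max_right _ _).trans (le_max_right _ _)).trans_lt ha1
  obtain ⟨C₀, T₀, hC₀⟩ := F.exists_upper h h0 hnd hbist hdisc (half_pos hγp)
  have hgrow : ∀ t ≥ T₀, ∀ s ≥ 0, R (t + s) - a * (t + s) ≤ R t - a * t + γ * s + C₀ :=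
    fun t ht s hs => by
      have := mul_le_mul_of_nonneg_right (by linarith : c + γ / 2 ≤ a + γ) hs
      linarith [hC₀ t ht s hs]
  obtain ⟨K, hK, hstar⟩ := F.exists_time_bound h h0 hnd hbist hκ hlam (by linarith) ha2.le hγp.le
    hγκ hempty hgrow
  obtain ⟨M, hM, t', hpeak⟩ := exists_no_peak (g := fun t => R t - a * t) (by linarith) hγp hK
    hgrow hstar
  obtain ⟨T₁, hT₁⟩ := eventually_atTop.1 ((((F.tendsto_sub_mul a).2 ha2).eventually_ge_atTop
    (R t' - a * t' + M)).and (eventually_gt_atTop t'))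
  refine ⟨M, T₁, fun t ht s hs => ?_⟩
  by_contra! hcon
  have h1 := mul_le_mul_of_nonneg_right hηa.le hs
  have hs' : t < t + s := by
    rcases hs.eq_or_lt with h2 | h2
    · rw [← h2, add_zero, sub_self] at hcon
      linarith
    · linarith
  obtain ⟨h3, h4⟩ := hT₁ t ht
  exact hpeak t' t (t + s) le_rfl h4 hs' (by linarith) (by linarith)

/-- The escape point has a mean speed, uniformly in time. -/
lemma exists_mean_speed (F : FrontTrack D u R H c) (h : SolBound d V u C Λ)
    (h0 : (0 : Euc n) ∈ MinSet V) (hnd : HNonDeg V) (hbist : HOnlyBist V) (hdisc : HDiscVel V)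
    {η : ℝ} (hη : 0 < η) :
    ∃ C₀ ≥ (0:ℝ), ∃ T₀ : ℝ, ∀ t ≥ T₀, ∀ s ≥ 0, |R (t + s) - R t - c * s| ≤ η * s + C₀ := by
  obtain ⟨C₁, T₁, h1⟩ := F.exists_upper h h0 hnd hbist hdisc hη
  obtain ⟨C₂, T₂, h2⟩ := F.exists_lower h h0 hnd hbist hdisc hη
  refine ⟨|C₁| + |C₂|, by positivity, max T₁ T₂, fun t ht s hs => ?_⟩
  have h3 := h1 t ((le_max_left _ _).trans ht) s hs
  have h4 := h2 t ((le_max_right _ _).trans ht) s hs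
  rw [abs_le]
  constructor <;> linarith [le_abs_self C₁, le_abs_self C₂, abs_nonneg C₁, abs_nonneg C₂]

end FrontTrack

/-! ### Changing the speed of the frame -/

/-- The energy weight at the reference time of the frame. -/
def chi (κ x a y : ℝ) : ℝ := Real.exp (a * y) / (1 + Real.exp ((a + 2 * κ) * (y - x)))

lemma chi_pos (κ x a y : ℝ) : 0 < chi κ x a y := by unfold chi; positivity

lemma chi_le_exp (κ x a y : ℝ) : chi κ x a y ≤ Real.exp (a * y) := by
  unfold chi
  refine div_le_self (Real.exp_pos _).le ?_
  linarith [Real.exp_pos ((a + 2 * κ) * (y - x))]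

lemma Frame.wt_ref (f : Frame) (k r : ℝ) :
    f.wt k r f.τ = Real.exp (k * (r - f.ρ - f.x)) * chi f.κ f.x f.a (r - f.ρ) := by
  unfold Frame.wt chi Frame.dist Frame.orig Frame.cut
  rw [sub_self, mul_zero, mul_zero, add_zero, add_zero, Real.exp_add, mul_comm (Real.exp (k * _)),
    mul_div_right_comm]

lemma one_add_exp_le {p q z : ℝ} (hp : 0 ≤ p) (hpq : p ≤ q) :
    1 + Real.exp (p * z) ≤ 2 * (1 + Real.exp (q * z)) ∧
      1 + Real.exp (p * z) ≤ 2 * (Real.exp (-((q - p) * z)) * (1 + Real.exp (q * z))) := by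
  have e1 := Real.exp_pos (p * z)
  have e2 := Real.exp_pos (q * z)
  have e3 : Real.exp (-((q - p) * z)) * (1 + Real.exp (q * z)) =
      Real.exp (-((q - p) * z)) + Real.exp (p * z) := by
    rw [mul_add, mul_one, ← Real.exp_add]
    ring_nf
  rw [e3]
  have e4 := Real.exp_pos (-((q - p) * z))
  rcases le_total 0 z with hz | hz
  · have h1 : Real.exp (p * z) ≤ Real.exp (q * z) :=
      Real.exp_le_exp.2 (mul_le_mul_of_nonneg_right hpq hz)
    have h2 : 1 ≤ Real.exp (p * z) := Real.one_le_exp (mul_nonneg hp hz)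
    constructor <;> linarith
  · have h1 : Real.exp (p * z) ≤ 1 :=
      Real.exp_le_one_iff.2 (mul_nonpos_of_nonneg_of_nonpos hp hz)
    have h2 : 1 ≤ Real.exp (-((q - p) * z)) := Real.one_le_exp
      (neg_nonneg.2 (mul_nonpos_of_nonneg_of_nonpos (by linarith) hz))
    constructor <;> linarith

lemma chi_le_chi {κ x a b y : ℝ} (hκ : 0 ≤ κ) (ha : 0 ≤ a) (hab : a ≤ b) :
    chi κ x b y ≤ 2 * (Real.exp ((b - a) * y) * chi κ x a y) ∧
      chi κ x b y ≤ 2 * (Real.exp ((b - a) * x) * chi κ x a y) := by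
  obtain ⟨h1, h2⟩ := one_add_exp_le (z := y - x) (by positivity : 0 ≤ a + 2 * κ)
    (by linarith : a + 2 * κ ≤ b + 2 * κ)
  have e1 : Real.exp (b * y) = Real.exp ((b - a) * y) * Real.exp (a * y) := by
    rw [← Real.exp_add]; ring_nf
  have e2 : Real.exp (b * y) = Real.exp ((b - a) * x) * Real.exp (a * y) *
      Real.exp ((b - a) * (y - x)) := by
    rw [← Real.exp_add, ← Real.exp_add]; ring_nf
  have e3 : Real.exp ((b - a) * (y - x)) * Real.exp (-((b - a) * (y - x))) = 1 := by
    rw [← Real.exp_add, add_neg_cancel, Real.exp_zero]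
  unfold chi
  obtain ⟨P, hP⟩ : ∃ P, P = 1 + Real.exp ((a + 2 * κ) * (y - x)) := ⟨_, rfl⟩
  obtain ⟨Q, hQ⟩ : ∃ Q, Q = 1 + Real.exp ((b + 2 * κ) * (y - x)) := ⟨_, rfl⟩
  have hPp : 0 < P := by rw [hP]; positivity
  have hQp : 0 < Q := by rw [hQ]; positivity
  rw [← hP, ← hQ] at h1
  rw [← hP, ← hQ, add_sub_add_right_eq_sub] at h2
  rw [← hP, ← hQ, div_le_iff₀ hQp, div_le_iff₀ hQp, ← mul_div_assoc, ← mul_div_assoc,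
    ← mul_div_assoc, ← mul_div_assoc, div_mul_eq_mul_div, div_mul_eq_mul_div, le_div_iff₀ hPp,
    le_div_iff₀ hPp]
  constructor
  · rw [e1]
    have := mul_le_mul_of_nonneg_left h1
      (by positivity : 0 ≤ Real.exp ((b - a) * y) * Real.exp (a * y))
    linarith
  · have h3 := mul_le_mul_of_nonneg_left h2 (Real.exp_pos (b * y)).le
    refine h3.trans (le_of_eq ?_)
    rw [e2]
    linear_combination (2 * Real.exp ((b - a) * x) * Real.exp (a * y) * Q) * e3

lemma mul_exp_neg_le {κ z : ℝ} (hκ : 0 < κ) : z * Real.exp (-(κ * z)) ≤ 1 / κ := by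
  have h1 : κ * z ≤ Real.exp (κ * z) := by linarith [Real.add_one_le_exp (κ * z)]
  have h2 := mul_le_mul_of_nonneg_right h1 (Real.exp_pos (-(κ * z))).le
  rw [← Real.exp_add, add_neg_cancel, Real.exp_zero] at h2
  rw [le_div_iff₀ hκ]
  linarith

lemma hasDerivAt_chi (κ x y a : ℝ) : HasDerivAt (fun a => chi κ x a y)
    (chi κ x a y * (y - (y - x) * (Real.exp ((a + 2 * κ) * (y - x)) /
      (1 + Real.exp ((a + 2 * κ) * (y - x)))))) a := by
  have h1 : HasDerivAt (fun a => Real.exp (a * y)) (Real.exp (a * y) * (1 * y)) a :=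
    ((hasDerivAt_id a).mul_const y).exp
  have h2 : HasDerivAt (fun a => 1 + Real.exp ((a + 2 * κ) * (y - x)))
      (Real.exp ((a + 2 * κ) * (y - x)) * (1 * (y - x))) a :=
    ((((hasDerivAt_id a).add_const (2 * κ)).mul_const (y - x)).exp).const_add 1
  have hne : 1 + Real.exp ((a + 2 * κ) * (y - x)) ≠ 0 := by positivity
  refine (h1.div h2 hne).congr_deriv ?_
  unfold chi
  field_simp

lemma abs_deriv_chi_le {κ x a₀ a y : ℝ} (hκ : 0 < κ) (hx : 0 ≤ x) (h0 : κ ≤ a₀) (h1 : a₀ ≤ a)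
    (h2 : a - a₀ ≤ κ / 2) :
    |chi κ x a y * (y - (y - x) * (Real.exp ((a + 2 * κ) * (y - x)) /
      (1 + Real.exp ((a + 2 * κ) * (y - x)))))| ≤
      3 / κ * (Real.exp (-(κ / 2) * |y|) + 2 * (Real.exp (κ * y) * chi κ x a₀ y)) := by
  obtain ⟨s, hs⟩ : ∃ s, s = Real.exp ((a + 2 * κ) * (y - x)) /
      (1 + Real.exp ((a + 2 * κ) * (y - x))) := ⟨_, rfl⟩
  have hs0 : 0 ≤ s := by rw [hs]; positivity
  have hs1 : s ≤ 1 := by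
    rw [hs, div_le_one (by positivity)]
    linarith
  have hs2 : s ≤ Real.exp ((a + 2 * κ) * (y - x)) := by
    rw [hs]
    refine div_le_self (Real.exp_pos _).le ?_
    linarith [Real.exp_pos ((a + 2 * κ) * (y - x))]
  rw [← hs]
  have hκ1 : 0 < 1 / κ := by positivity
  have hfac : |y - (y - x) * s| ≤ |y| + 1 / κ := by
    rcases le_total 0 (y - x) with hz | hz
    · have m1 := mul_nonneg hz hs0
      have m2 := mul_le_mul_of_nonneg_left hs1 hz
      have m3 := le_abs_self y
      rw [abs_of_nonneg (by linarith)]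
      linarith
    · have m1 := mul_le_mul_of_nonneg_left hs2 (neg_nonneg.2 hz)
      have m2 := mul_exp_neg_le (z := -(y - x)) hκ
      have m3 : Real.exp ((a + 2 * κ) * (y - x)) ≤ Real.exp (-(κ * -(y - x))) := by
        refine Real.exp_le_exp.2 ?_
        have := mul_nonpos_of_nonneg_of_nonpos (by linarith : 0 ≤ a + κ) hz
        linarith
      have m4 := mul_le_mul_of_nonneg_left m3 (neg_nonneg.2 hz)
      have m5 := mul_nonneg (neg_nonneg.2 hz) hs0
      refine (abs_sub _ _).trans ?_
      rw [show |(y - x) * s| = -(y - x) * s by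
        rw [abs_mul, abs_of_nonpos hz, abs_of_nonneg hs0]]
      linarith
  have hchi := chi_pos κ x a y
  rw [abs_mul, abs_of_pos hchi]
  have hexp : (|y| + 1 / κ) * Real.exp (-(κ / 2 * |y|)) ≤ 3 / κ := by
    have m1 := mul_exp_neg_le (z := |y|) (half_pos hκ)
    have m2 : Real.exp (-(κ / 2 * |y|)) ≤ 1 :=
      Real.exp_le_one_iff.2 (neg_nonpos.2 (by positivity))
    have m3 := mul_le_mul_of_nonneg_left m2 hκ1.le
    have m4 : 1 / (κ / 2) + 1 / κ = 3 / κ := by field_simp; norm_num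
    linarith
  have hmain : chi κ x a y ≤ Real.exp (-(κ / 2 * |y|)) *
      (Real.exp (-(κ / 2) * |y|) + 2 * (Real.exp (κ * y) * chi κ x a₀ y)) := by
    have p1 := Real.exp_pos (-(κ / 2 * |y|))
    have p2 := Real.exp_pos (-(κ / 2) * |y|)
    have p3 := mul_pos (Real.exp_pos (κ * y)) (chi_pos κ x a₀ y)
    rw [mul_add]
    rcases le_total 0 y with hy | hy
    · have q1 := (chi_le_chi (x := x) (y := y) hκ.le (hκ.le.trans h0) h1).1
      have q2 : Real.exp ((a - a₀) * y) ≤ Real.exp (-(κ / 2 * |y|)) * Real.exp (κ * y) := by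
        rw [← Real.exp_add, abs_of_nonneg hy]
        refine Real.exp_le_exp.2 ?_
        have := mul_le_mul_of_nonneg_right h2 hy
        linarith
      have q3 := mul_le_mul_of_nonneg_right q2 (chi_pos κ x a₀ y).le
      have q4 := mul_pos p1 p2
      linarith
    · have q1 := chi_le_exp κ x a y
      have q2 : Real.exp (a * y) ≤ Real.exp (-(κ / 2 * |y|)) * Real.exp (-(κ / 2) * |y|) := by
        rw [← Real.exp_add, abs_of_nonpos hy]
        refine Real.exp_le_exp.2 ?_
        have := mul_nonpos_of_nonneg_of_nonpos (by linarith : 0 ≤ a - κ) hy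
        linarith
      have q4 := mul_pos p1 p3
      linarith
  obtain ⟨X, hX⟩ : ∃ X, X = Real.exp (-(κ / 2) * |y|) + 2 * (Real.exp (κ * y) * chi κ x a₀ y) :=
    ⟨_, rfl⟩
  have hXp : 0 ≤ X := by
    rw [hX]
    have := chi_pos κ x a₀ y
    positivity
  rw [← hX] at hmain ⊢
  have r1 := mul_le_mul hmain hfac (abs_nonneg _) (by positivity)
  have r2 := mul_le_mul_of_nonneg_right hexp hXp
  linarith

lemma abs_chi_sub_le {κ x a₀ a b y : ℝ} (hκ : 0 < κ) (hx : 0 ≤ x) (h0 : κ ≤ a₀) (h1 : a₀ ≤ a)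
    (hab : a ≤ b) (h2 : b - a₀ ≤ κ / 2) :
    |chi κ x b y - chi κ x a y| ≤ (b - a) *
      (3 / κ * (Real.exp (-(κ / 2) * |y|) + 2 * (Real.exp (κ * y) * chi κ x a₀ y))) := by
  have := (convex_Icc a b).norm_image_sub_le_of_norm_hasDerivWithin_le
    (f := fun a => chi κ x a y)
    (fun s _ => (hasDerivAt_chi κ x y s).hasDerivWithinAt)
    (fun s hs => by
      rw [Real.norm_eq_abs]
      exact abs_deriv_chi_le hκ hx h0 (h1.trans hs.1) (by linarith [hs.2]))
    (left_mem_Icc.2 hab) (right_mem_Icc.2 hab)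
  rw [Real.norm_eq_abs, Real.norm_eq_abs, abs_of_nonneg (sub_nonneg.2 hab)] at this
  linarith

namespace SolBound

variable {d : ℕ} {V : Euc n → ℝ} {u : ℝ → ℝ → Euc n} {C Λ : ℝ}

/-- At the reference time, the energy depends on the speed of the frame in a Lipschitz way. -/
lemma abs_E_sub_E_le (h : SolBound d V u C Λ) {κ x ρ τ a₀ a b β₀ β β' ℓ B : ℝ} (hκ : 0 < κ)
    (hx : 0 ≤ x) (h0 : κ ≤ a₀) (h1 : a₀ ≤ a) (hab : a ≤ b) (h2 : b - a₀ ≤ κ / 2) (hℓ : 0 < ℓ)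
    (hB : ℓ ≤ B) (ht : 0 < τ) :
    |(Frame.mk b κ β' x ρ τ).E V u ℓ B τ - (Frame.mk a κ β x ρ τ).E V u ℓ B τ| ≤
      (b - a) * (3 / κ * ((1 + Λ) * C ^ 2 * (4 / κ) +
        2 * (1 + Λ) * (Real.exp (κ * x) * (Frame.mk a₀ κ β₀ x ρ τ).G u ℓ B τ))) := by
  have hΛ := h.Λ_pos
  have hC := h.C_pos
  have w0 : ∀ (s γ r : ℝ), (Frame.mk s κ γ x ρ τ).wt 0 r τ = chi κ x s (r - ρ) := fun s γ r => by
    have := (Frame.mk s κ γ x ρ τ).wt_ref 0 r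
    rw [zero_mul, Real.exp_zero, one_mul] at this
    exact this
  have wκ : ∀ r : ℝ, Real.exp (κ * (r - ρ)) * chi κ x a₀ (r - ρ) =
      Real.exp (κ * x) * (Frame.mk a₀ κ β₀ x ρ τ).wt κ r τ := fun r => by
    have e := (Frame.mk a₀ κ β₀ x ρ τ).wt_ref κ r
    have e' : (Frame.mk a₀ κ β₀ x ρ τ).wt κ r τ =
      Real.exp (κ * (r - ρ - x)) * chi κ x a₀ (r - ρ) := e
    rw [e', ← mul_assoc, ← Real.exp_add]
    ring_nf
  have ce := h.continuous_eDen ht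
  have cq := h.continuous_qDen ht
  have cw : ∀ (s γ k : ℝ), Continuous fun r => (Frame.mk s κ γ x ρ τ).wt k r τ := fun s γ k =>
    ((Frame.mk s κ γ x ρ τ).isWeight_wt k).cont_left τ
  have i1 : IntervalIntegrable
      (fun r => (Frame.mk b κ β' x ρ τ).wt 0 r τ * eDen V u r τ) volume ℓ B :=
    ((cw b β' 0).mul ce).intervalIntegrable _ _
  have i2 : IntervalIntegrable
      (fun r => (Frame.mk a κ β x ρ τ).wt 0 r τ * eDen V u r τ) volume ℓ B :=
    ((cw a β 0).mul ce).intervalIntegrable _ _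
  have i3 : IntervalIntegrable
      (fun r => Real.exp (-(κ / 2) * |r - ρ|)) volume ℓ B :=
    Continuous.intervalIntegrable (by fun_prop) _ _
  have i4 : IntervalIntegrable
      (fun r => (Frame.mk a₀ κ β₀ x ρ τ).wt κ r τ * qDen u r τ) volume ℓ B :=
    ((cw a₀ β₀ κ).mul cq).intervalIntegrable _ _
  have hG : (Frame.mk a₀ κ β₀ x ρ τ).G u ℓ B τ =
      ∫ r in ℓ..B, (Frame.mk a₀ κ β₀ x ρ τ).wt κ r τ * qDen u r τ := rfl
  obtain ⟨p, hp⟩ : ∃ p, p = (b - a) * (3 / κ) * ((1 + Λ) * C ^ 2) := ⟨_, rfl⟩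
  obtain ⟨q, hq⟩ : ∃ q, q = (b - a) * (3 / κ) * (2 * (1 + Λ) * Real.exp (κ * x)) := ⟨_, rfl⟩
  have hba : 0 ≤ b - a := by linarith
  have hp0 : 0 ≤ p := by rw [hp]; positivity
  have key : ∀ r ∈ Icc ℓ B, ‖(Frame.mk b κ β' x ρ τ).wt 0 r τ * eDen V u r τ -
      (Frame.mk a κ β x ρ τ).wt 0 r τ * eDen V u r τ‖ ≤
      p * Real.exp (-(κ / 2) * |r - ρ|) +
        q * ((Frame.mk a₀ κ β₀ x ρ τ).wt κ r τ * qDen u r τ) := fun r hr => by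
    have hr0 : 0 ≤ r := hℓ.le.trans hr.1
    rw [← sub_mul, norm_mul, Real.norm_eq_abs, Real.norm_eq_abs, w0, w0]
    have k1 := abs_chi_sub_le (y := r - ρ) hκ hx h0 h1 hab h2
    rw [wκ] at k1
    have k2 := h.eDen_bdd hr0 ht
    have k3 : |eDen V u r τ| ≤ (1 + Λ) * qDen u r τ := by
      have := h.eDen_le hr0 ht
      have e : (1 + Λ) * qDen u r τ = ‖ur u r τ‖ ^ 2 / 2 + Λ * ‖u r τ‖ ^ 2 +
        (‖u r τ‖ ^ 2 + ‖ur u r τ‖ ^ 2 / 2 + Λ * ‖ur u r τ‖ ^ 2) := by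
        unfold qDen; ring
      have : 0 ≤ ‖u r τ‖ ^ 2 + ‖ur u r τ‖ ^ 2 / 2 + Λ * ‖ur u r τ‖ ^ 2 := by positivity
      linarith
    have m1 := mul_le_mul_of_nonneg_right k1 (abs_nonneg (eDen V u r τ))
    have hw := (Frame.mk a₀ κ β₀ x ρ τ).wt_pos κ r τ
    have m2 := mul_le_mul_of_nonneg_left k2
      (by positivity : 0 ≤ (b - a) * (3 / κ) * Real.exp (-(κ / 2) * |r - ρ|))
    have m3 := mul_le_mul_of_nonneg_left k3
      (by positivity : 0 ≤ (b - a) * (3 / κ) *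
        (2 * (Real.exp (κ * x) * (Frame.mk a₀ κ β₀ x ρ τ).wt κ r τ)))
    refine m1.trans ((le_of_eq ?_).trans ((add_le_add m2 m3).trans (le_of_eq ?_)))
    · ring
    · rw [hp, hq]; ring
  have e1 : (Frame.mk b κ β' x ρ τ).E V u ℓ B τ - (Frame.mk a κ β x ρ τ).E V u ℓ B τ =
      ∫ r in ℓ..B, ((Frame.mk b κ β' x ρ τ).wt 0 r τ * eDen V u r τ -
        (Frame.mk a κ β x ρ τ).wt 0 r τ * eDen V u r τ) :=
    (intervalIntegral.integral_sub i1 i2).symm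
  rw [e1, ← Real.norm_eq_abs]
  have n1 := intervalIntegral.norm_integral_le_integral_norm
    (f := fun r => (Frame.mk b κ β' x ρ τ).wt 0 r τ * eDen V u r τ -
        (Frame.mk a κ β x ρ τ).wt 0 r τ * eDen V u r τ) (μ := volume) hB
  have n2 := intervalIntegral.integral_mono_on hB (i1.sub i2).norm
    ((i3.const_mul p).add (i4.const_mul q)) key
  have n3 := integral_exp_neg_abs_le (κ := κ / 2) (by positivity) hB ρ
  rw [intervalIntegral.integral_add (i3.const_mul p) (i4.const_mul q),
    intervalIntegral.integral_const_mul, intervalIntegral.integral_const_mul, ← hG] at n2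
  have n4 := mul_le_mul_of_nonneg_left n3 hp0
  refine n1.trans (n2.trans ((add_le_add_left n4 _).trans (le_of_eq ?_)))
  rw [hp, hq]
  field_simp
  ring

/-- At the reference time, the mass in a faster frame is controlled by the mass in a slower one. -/
lemma G_le_G (h : SolBound d V u C Λ) {κ x ρ τ a b β β' ℓ B : ℝ} (hκ : 0 ≤ κ) (ha : 0 ≤ a)
    (hab : a ≤ b) (hB : ℓ ≤ B) (ht : 0 < τ) :
    (Frame.mk b κ β' x ρ τ).G u ℓ B τ ≤
      2 * Real.exp ((b - a) * x) * (Frame.mk a κ β x ρ τ).G u ℓ B τ := by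
  have cq := h.continuous_qDen ht
  have cw : ∀ (s γ k : ℝ), Continuous fun r => (Frame.mk s κ γ x ρ τ).wt k r τ := fun s γ k =>
    ((Frame.mk s κ γ x ρ τ).isWeight_wt k).cont_left τ
  have i1 : IntervalIntegrable
      (fun r => (Frame.mk b κ β' x ρ τ).wt κ r τ * qDen u r τ) volume ℓ B :=
    ((cw b β' κ).mul cq).intervalIntegrable _ _
  have i2 : IntervalIntegrable
      (fun r => (Frame.mk a κ β x ρ τ).wt κ r τ * qDen u r τ) volume ℓ B :=
    ((cw a β κ).mul cq).intervalIntegrable _ _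
  have w : ∀ (s γ r : ℝ), (Frame.mk s κ γ x ρ τ).wt κ r τ =
      Real.exp (κ * (r - ρ - x)) * chi κ x s (r - ρ) := fun s γ r =>
    (Frame.mk s κ γ x ρ τ).wt_ref κ r
  have n2 := intervalIntegral.integral_mono_on hB i1
    (i2.const_mul (2 * Real.exp ((b - a) * x))) (fun r _ => by
      have k1 := (chi_le_chi (x := x) (y := r - ρ) hκ ha hab).2
      have k2 := qDen_nonneg u r τ
      rw [w, w]
      have m1 := mul_le_mul_of_nonneg_right (mul_le_mul_of_nonneg_left k1
        (Real.exp_pos (κ * (r - ρ - x))).le) k2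
      exact m1.trans (le_of_eq (by ring)))
  rw [intervalIntegral.integral_const_mul] at n2
  exact n2

end SolBound

/-! ### Relaxation -/

namespace FrontTrack

variable {d : ℕ} {V : Euc n → ℝ} {D : EscData n V} {u : ℝ → ℝ → Euc n} {R H : ℝ → ℝ}
  {c C Λ : ℝ}

/-- In a frame slightly slower than the front, the mass and the energy beyond a far cut-off are
small. -/
lemma exists_slow_bound (F : FrontTrack D u R H c) (h : SolBound d V u C Λ)
    (h0 : (0 : Euc n) ∈ MinSet V) (hnd : HNonDeg V) (hbist : HOnlyBist V) (hdisc : HDiscVel V)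
    {κ θ : ℝ} (hκ : 0 < κ) (hlam : (2 * c + κ) * (κ + κ) ≤ D.lmin / 4) (hθ : 0 < θ)
    (hθκ : θ ≤ κ) (hκθ : κ ≤ c - θ) :
    ∃ K > 0, ∀ x ≥ (0:ℝ), ∀ᶠ S in atTop, ∀ᶠ τ in atTop,
      (Frame.mk (c - θ) κ (θ / 2) x (R τ) τ).G u (c * τ / 2) (H (τ - S)) τ ≤
          K * Real.exp (-(κ * x)) ∧
        (Frame.mk (c - θ) κ (θ / 2) x (R τ) τ).E V u (c * τ / 2) (H (τ - S)) τ ≤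
          K * Real.exp (-(κ * x)) := by
  have hc := F.c_pos
  have hΛ := h.Λ_pos
  have hC := h.C_pos
  obtain ⟨C₀, hC₀, T₀, hmean⟩ := F.exists_mean_speed h h0 hnd hbist hdisc (half_pos hθ)
  obtain ⟨K, hK, hrun⟩ := h.exists_run D h0 (by linarith : 0 < 2 * c) hκ hκ.le hlam
  obtain ⟨a, ha⟩ : ∃ a, a = c - θ := ⟨_, rfl⟩
  rw [← ha]
  have hap : 0 < a := by linarith
  obtain ⟨ω, hω⟩ : ∃ ω, ω = (a + κ) * (θ / 2) - κ * (θ / 2) := ⟨_, rfl⟩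
  have hωp : 0 < ω := by
    have : ω = a * θ / 2 := by rw [hω]; ring
    rw [this]; positivity
  obtain ⟨M, hM⟩ : ∃ M, M = C ^ 2 * (2 / κ) := ⟨_, rfl⟩
  have hMp : 0 < M := by rw [hM]; positivity
  obtain ⟨J, hJ⟩ : ∃ J, J = K * (2 * M + Real.exp ((a + κ) * C₀) / ω + 1) := ⟨_, rfl⟩
  have hJp : 0 < J := by rw [hJ]; positivity
  refine ⟨(1 + Λ) * M + J, by positivity, fun x hx => ?_⟩
  obtain ⟨X, hX⟩ : ∃ X, X = Real.exp (-(κ * x)) := ⟨_, rfl⟩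
  have hXp : 0 < X := by rw [hX]; positivity
  filter_upwards [eventually_gt_atTop 0,
    eventually_ge_atTop ((a + κ) * x / (a * (θ / 2)))] with S hS hS'
  rw [div_le_iff₀ (by positivity)] at hS'
  obtain ⟨N, hN, herr⟩ := exists_err_le (κ := κ) (A := 2 * c) (β₀ := κ) (S := S) (X := x)
    (η := X / S) hκ (by linarith) hκ.le hS.le hx (by positivity)
  filter_upwards [F.eventually_window hS.le N, eventually_ge_atTop (T₀ + S)] with τ win hτ
  obtain ⟨f, hf⟩ : ∃ f : Frame, f = ⟨a, κ, θ / 2, x, R τ, τ⟩ := ⟨_, rfl⟩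
  rw [← hf, ← hX]
  have fa : f.a = a := by rw [hf]
  have fκ : f.κ = κ := by rw [hf]
  have fβ : f.β = θ / 2 := by rw [hf]
  have fx : f.x = x := by rw [hf]
  have fρ : f.ρ = R τ := by rw [hf]
  have fτ : f.τ = τ := by rw [hf]
  have hadm : f.Adm κ (2 * c) κ :=
    ⟨hκ, fκ, by linarith, by linarith, by rw [fβ]; positivity, by linarith⟩
  have hℓ : 0 < c * τ / 2 := hN.trans_le win.le_ℓ
  have hℓB : c * τ / 2 ≤ H (τ - S) := by linarith [win.left, win.right]
  have forig : ∀ t, f.orig t = R τ + a * (t - τ) := fun t => by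
    unfold Frame.orig; rw [fρ, fa, fτ]
  have fcut : f.cut (τ - S) = x - θ / 2 * S := by
    unfold Frame.cut; rw [fx, fβ, fτ]; ring
  have hle : τ - S ≤ τ := by linarith
  obtain ⟨hG, hE⟩ := hrun f hadm (c * τ / 2) (H (τ - S)) (τ - S) τ (X / S) C₀ (θ / 2) ω hℓ hℓB
    win.pos hle
    (fun t ht => herr f hadm (by rw [fx, abs_of_nonneg hx]) _ _ win.le_ℓ
      (by rw [fρ]; exact win.left) (by rw [fρ]; exact win.right) t
      (by rw [fτ, abs_of_nonpos (by linarith [ht.2])]; linarith [ht.1]))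
    (by rw [fa, fβ]; exact hω) (Or.inr ⟨hωp, fτ.ge⟩)
    (fun t ht r hr hlt => win.esc t ⟨ht.1, by linarith [ht.2]⟩ r (by
      have p1 := hmean t (by linarith [ht.1]) (τ - t) (by linarith [ht.2])
      rw [add_sub_cancel] at p1
      have p2 := (abs_le.1 p1).1
      have p3 := forig t
      have p4 : a * (t - τ) = c * (t - τ) - θ * (t - τ) := by rw [ha]; ring
      rw [fτ] at hlt
      linarith) hr.2)
  have e1 := (le_abs_self _).trans (h.abs_E_le hadm hℓ hℓB win.pos)
  have e2 := h.G_le hadm hℓ hℓB win.pos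
  have e3 : Real.exp (f.a * f.cut (τ - S)) ≤ X := by
    rw [hX, fa, fcut]
    exact Real.exp_le_exp.2 (by linarith)
  have e4 : Real.exp ((f.a + κ) * C₀ - κ * f.x) / |ω| = Real.exp ((a + κ) * C₀) / ω * X := by
    rw [fa, fx, abs_of_pos hωp, sub_eq_add_neg, Real.exp_add, hX]
    ring
  have e5 : X / S * (τ - (τ - S)) = X := by
    rw [sub_sub_cancel, div_mul_cancel₀ _ hS.ne']
  have m1 : (1 + Λ) * C ^ 2 * (2 / κ) * Real.exp (f.a * f.cut (τ - S)) ≤ (1 + Λ) * M * X := by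
    have := mul_le_mul_of_nonneg_left e3 (by positivity : 0 ≤ (1 + Λ) * M)
    rw [hM] at this ⊢
    linarith
  have m2 : 2 * C ^ 2 * (2 / κ) * Real.exp (f.a * f.cut (τ - S)) ≤ 2 * M * X := by
    have := mul_le_mul_of_nonneg_left e3 (by positivity : 0 ≤ 2 * M)
    rw [hM] at this ⊢
    linarith
  rw [e4, e5] at hG hE
  have m3 : K * (f.G u (c * τ / 2) (H (τ - S)) (τ - S) +
      Real.exp ((a + κ) * C₀) / ω * X + X) ≤ J * X := by
    have := mul_le_mul_of_nonneg_left (add_le_add_left (add_le_add_left (e2.trans m2)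
      (Real.exp ((a + κ) * C₀) / ω * X)) X) hK.le
    refine this.trans (le_of_eq ?_)
    rw [hJ]; ring
  have m4 : 0 ≤ ∫ t in (τ - S)..τ, f.D u (c * τ / 2) (H (τ - S)) t :=
    intervalIntegral.integral_nonneg hle fun t _ => SolBound.D_nonneg f u hℓB t
  have m5 : 0 ≤ (1 + Λ) * M * X := by positivity
  have m6 : 0 ≤ J * X := by positivity
  rw [add_mul]
  constructor <;> linarith

/-- In a frame slightly faster than the front, the dissipation is controlled by the initial
energy and the initial mass. -/
lemma exists_fast_bound (F : FrontTrack D u R H c) (h : SolBound d V u C Λ)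
    (h0 : (0 : Euc n) ∈ MinSet V) (hnd : HNonDeg V) (hbist : HOnlyBist V) (hdisc : HDiscVel V)
    {κ θ : ℝ} (hκ : 0 < κ) (hlam : (2 * c + κ) * (κ + κ) ≤ D.lmin / 4) (hθ : 0 < θ)
    (hθc : θ ≤ c) (hκc : κ ≤ c) :
    ∃ K > 0, ∀ x ≥ (0:ℝ), ∀ᶠ S in atTop, ∀ᶠ τ in atTop,
      (∫ t in τ..(τ + 2),
          (Frame.mk (c + θ) κ 0 x (R τ) τ).D u (c * τ / 2) (H (τ - S)) t) ≤
        2 * (Frame.mk (c + θ) κ 0 x (R τ) τ).E V u (c * τ / 2) (H (τ - S)) τ +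
          K * ((Frame.mk (c + θ) κ 0 x (R τ) τ).G u (c * τ / 2) (H (τ - S)) τ +
            Real.exp (-(κ * x))) := by
  have hc := F.c_pos
  have hΛ := h.Λ_pos
  have hC := h.C_pos
  obtain ⟨C₀, hC₀, T₀, hmean⟩ := F.exists_mean_speed h h0 hnd hbist hdisc (half_pos hθ)
  obtain ⟨K, hK, hrun⟩ := h.exists_run D h0 (by linarith : 0 < 2 * c) hκ hκ.le hlam
  obtain ⟨a, ha⟩ : ∃ a, a = c + θ := ⟨_, rfl⟩
  rw [← ha]
  have hap : 0 < a := by linarith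
  obtain ⟨ω, hω⟩ : ∃ ω, ω = (a + κ) * (-(θ / 2)) - κ * 0 := ⟨_, rfl⟩
  have hωn : ω < 0 := by
    have : 0 < (a + κ) * (θ / 2) := by positivity
    rw [hω]; linarith
  have hωp : 0 < |ω| := abs_pos.2 hωn.ne
  obtain ⟨M, hM⟩ : ∃ M, M = (1 + Λ) * C ^ 2 / κ := ⟨_, rfl⟩
  have hMp : 0 < M := by rw [hM]; positivity
  obtain ⟨J, hJ⟩ : ∃ J, J = Real.exp ((a + κ) * C₀) / |ω| + 1 := ⟨_, rfl⟩
  have hJp : 1 ≤ J := by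
    have : 0 < Real.exp ((a + κ) * C₀) / |ω| := by positivity
    rw [hJ]; linarith
  refine ⟨K * J + 2 * M, by positivity, fun x hx => ?_⟩
  obtain ⟨X, hX⟩ : ∃ X, X = Real.exp (-(κ * x)) := ⟨_, rfl⟩
  have hXp : 0 < X := by rw [hX]; positivity
  filter_upwards [eventually_ge_atTop 2,
    eventually_ge_atTop ((a * C₀ + κ * x) / (a * (θ / 2)))] with S hS hS'
  rw [div_le_iff₀ (by positivity)] at hS'
  have hS0 : 0 < S := by linarith
  obtain ⟨N, hN, herr⟩ := exists_err_le (κ := κ) (A := 2 * c) (β₀ := κ) (S := S) (X := x)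
    (η := X / S) hκ (by linarith) hκ.le hS0.le hx (by positivity)
  filter_upwards [F.eventually_window hS0.le N, eventually_ge_atTop T₀] with τ win hτ
  obtain ⟨f, hf⟩ : ∃ f : Frame, f = ⟨a, κ, 0, x, R τ, τ⟩ := ⟨_, rfl⟩
  rw [← hf, ← hX]
  have fa : f.a = a := by rw [hf]
  have fκ : f.κ = κ := by rw [hf]
  have fβ : f.β = 0 := by rw [hf]
  have fx : f.x = x := by rw [hf]
  have fρ : f.ρ = R τ := by rw [hf]
  have fτ : f.τ = τ := by rw [hf]
  have hadm : f.Adm κ (2 * c) κ :=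
    ⟨hκ, fκ, by linarith, by linarith, fβ.ge, by linarith⟩
  have hℓ : 0 < c * τ / 2 := hN.trans_le win.le_ℓ
  have hℓB : c * τ / 2 ≤ H (τ - S) := by linarith [win.left, win.right]
  have forig : ∀ t, f.orig t = R τ + a * (t - τ) := fun t => by
    unfold Frame.orig; rw [fρ, fa, fτ]
  have hle : τ ≤ τ + S := by linarith
  have hτ0 : 0 < τ := by linarith [win.pos]
  have hpos : ∀ t ≥ τ, R t ≤ f.orig t + (C₀ + -(θ / 2) * (t - τ)) := fun t ht => by
    have p1 := hmean τ hτ (t - τ) (by linarith)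
    rw [add_sub_cancel] at p1
    have p2 := (abs_le.1 p1).2
    have p4 : a * (t - τ) = c * (t - τ) + θ * (t - τ) := by rw [ha]; ring
    rw [forig]
    linarith
  obtain ⟨-, hE⟩ := hrun f hadm (c * τ / 2) (H (τ - S)) τ (τ + S) (X / S) C₀ (-(θ / 2)) ω hℓ hℓB
    hτ0 hle
    (fun t ht => herr f hadm (by rw [fx, abs_of_nonneg hx]) _ _ win.le_ℓ
      (by rw [fρ]; exact win.left) (by rw [fρ]; exact win.right) t
      (by rw [fτ, abs_of_nonneg (by linarith [ht.1])]; linarith [ht.2]))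
    (by rw [fa, fβ]; exact hω) (Or.inl ⟨hωn, fτ.le⟩)
    (fun t ht r hr hlt => win.esc t ⟨by linarith [ht.1], ht.2⟩ r (by
      have := hpos t ht.1
      rw [fτ] at hlt
      linarith) hr.2)
  have e1 := h.neg_E_le D h0 hadm hℓ hℓB (hτ0.trans_le hle)
    (p := C₀ + -(θ / 2) * (τ + S - τ)) (fun r hr hlt =>
      win.esc (τ + S) ⟨by linarith, le_rfl⟩ r ((hpos _ hle).trans_lt hlt) hr.2)
  have e3 : Real.exp (f.a * (C₀ + -(θ / 2) * (τ + S - τ))) ≤ X := by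
    rw [hX, fa, add_sub_cancel_left]
    exact Real.exp_le_exp.2 (by linarith)
  have e4 : Real.exp ((f.a + κ) * C₀ - κ * f.x) / |ω| =
      Real.exp ((a + κ) * C₀) / |ω| * X := by
    rw [fa, fx, sub_eq_add_neg, Real.exp_add, hX]
    ring
  have e5 : X / S * (τ + S - τ) = X := by
    rw [add_sub_cancel_left, div_mul_cancel₀ _ hS0.ne']
  rw [← hM] at e1
  rw [e4, e5] at hE
  obtain ⟨G, hG⟩ : ∃ G, G = f.G u (c * τ / 2) (H (τ - S)) τ := ⟨_, rfl⟩
  have hG0 : 0 ≤ G := hG ▸ Frame.G_nonneg f u hℓB τ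
  rw [← hG] at hE ⊢
  have m1 := e1.trans (mul_le_mul_of_nonneg_left e3 hMp.le)
  have m2 : K * (G + Real.exp ((a + κ) * C₀) / |ω| * X + X) ≤ K * J * (G + X) := by
    have k1 : 0 ≤ K * ((J - 1) * G) :=
      mul_nonneg hK.le (mul_nonneg (by linarith) hG0)
    have k2 : K * J * (G + X) = K * (G + Real.exp ((a + κ) * C₀) / |ω| * X + X) +
        K * ((J - 1) * G) := by
      rw [hJ]; ring
    linarith
  have m3 : 0 ≤ 2 * M * G := by positivity
  have cD := h.continuousOn_D f hℓ hℓB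
  have i1 : IntervalIntegrable (fun t => f.D u (c * τ / 2) (H (τ - S)) t) volume τ (τ + S) :=
    ContinuousOn.intervalIntegrable (by
      rw [uIcc_of_le hle]; exact cD.mono fun t ht => hτ0.trans_le ht.1)
  have m4 : (∫ t in τ..(τ + 2), f.D u (c * τ / 2) (H (τ - S)) t) ≤
      ∫ t in τ..(τ + S), f.D u (c * τ / 2) (H (τ - S)) t :=
    intervalIntegral.integral_mono_interval le_rfl (by linarith) (by linarith)
      (Eventually.of_forall fun t => SolBound.D_nonneg f u hℓB t) i1
  have m5 : (K * J + 2 * M) * (G + X) = K * J * (G + X) + 2 * M * G + 2 * (M * X) := by ring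
  linarith

end FrontTrack

namespace FrontTrack

variable {d : ℕ} {V : Euc n → ℝ} {D : EscData n V} {u : ℝ → ℝ → Euc n} {R H : ℝ → ℝ}
  {c C Λ : ℝ}

/-- In a suitable frame slightly faster than the front, the dissipation is small. -/
lemma exists_small_dissip (F : FrontTrack D u R H c) (h : SolBound d V u C Λ)
    (h0 : (0 : Euc n) ∈ MinSet V) (hnd : HNonDeg V) (hbist : HOnlyBist V) (hdisc : HDiscVel V)
    {ε θ₁ : ℝ} (hε : 0 < ε) (hθ₁ : 0 < θ₁) :
    ∃ κ > 0, ∃ θ > 0, θ ≤ θ₁ ∧ ∀ᶠ x in atTop, ∀ᶠ S in atTop, ∀ᶠ τ in atTop,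
      (∫ t in τ..(τ + 2),
          (Frame.mk (c + θ) κ 0 x (R τ) τ).D u (c * τ / 2) (H (τ - S)) t) ≤ ε := by
  have hc := F.c_pos
  have hΛ := h.Λ_pos
  have hC := h.C_pos
  obtain ⟨κ, hκ, hκc, hlam⟩ := F.exists_rate (by linarith : 0 < 2 * c)
  obtain ⟨θ₀, hθ₀⟩ : ∃ θ₀, θ₀ = κ / 4 := ⟨_, rfl⟩
  have hθ₀p : 0 < θ₀ := by linarith
  obtain ⟨K₀, hK₀, hslow₀⟩ := F.exists_slow_bound h h0 hnd hbist hdisc hκ hlam hθ₀p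
    (by linarith) (by linarith)
  obtain ⟨J, hJ⟩ : ∃ J, J = 3 / κ * ((1 + Λ) * C ^ 2 * (4 / κ) + 2 * (1 + Λ) * K₀) := ⟨_, rfl⟩
  have hJp : 0 < J := by rw [hJ]; positivity
  obtain ⟨θ, hθ⟩ : ∃ θ, θ = min (min θ₀ θ₁) (ε / (8 * J)) := ⟨_, rfl⟩
  have hθp : 0 < θ := by rw [hθ]; exact lt_min (lt_min hθ₀p hθ₁) (by positivity)
  have hθ1 : θ ≤ θ₀ := hθ ▸ (min_le_left _ _).trans (min_le_left _ _)
  have hθ2 : θ ≤ θ₁ := hθ ▸ (min_le_left _ _).trans (min_le_right _ _)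
  have hθ3 : θ ≤ ε / (8 * J) := hθ ▸ min_le_right _ _
  rw [le_div_iff₀ (by positivity)] at hθ3
  obtain ⟨K₁, hK₁, hslow⟩ := F.exists_slow_bound h h0 hnd hbist hdisc hκ hlam hθp
    (by linarith) (by linarith)
  obtain ⟨K₂, hK₂, hfast⟩ := F.exists_fast_bound h h0 hnd hbist hdisc hκ hlam hθp
    (by linarith) (by linarith)
  refine ⟨κ, hκ, θ, hθp, hθ2, ?_⟩
  obtain ⟨L, hL⟩ : ∃ L, L = 2 * K₁ + 2 * K₂ * K₀ + K₂ := ⟨_, rfl⟩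
  have hlim : Tendsto (fun x : ℝ => L * Real.exp (-(κ / 2 * x))) atTop (𝓝 (L * 0)) :=
    (Real.tendsto_exp_neg_atTop_nhds_zero.comp
      (tendsto_id.const_mul_atTop (half_pos hκ))).const_mul L
  rw [mul_zero] at hlim
  filter_upwards [eventually_ge_atTop 0, hlim.eventually_le_const (half_pos hε)] with x hx hxL
  filter_upwards [hslow₀ x hx, hslow x hx, hfast x hx, eventually_ge_atTop 0] with S s1 s2 s3 hS
  filter_upwards [s1, s2, s3, F.eventually_window hS 1] with τ g₀ g₁ g₂ win
  obtain ⟨X, hX⟩ : ∃ X, X = Real.exp (-(κ * x)) := ⟨_, rfl⟩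
  obtain ⟨Y, hY⟩ : ∃ Y, Y = Real.exp (-(κ / 2 * x)) := ⟨_, rfl⟩
  have hℓ : 0 < c * τ / 2 := one_pos.trans_le win.le_ℓ
  have hℓB : c * τ / 2 ≤ H (τ - S) := by linarith [win.left, win.right]
  have hτ : 0 < τ := by linarith [win.pos]
  have k1 := h.abs_E_sub_E_le (ρ := R τ) (τ := τ) (a₀ := c - θ₀) (a := c - θ) (b := c + θ)
    (β₀ := θ₀ / 2) (β := θ / 2) (β' := 0) (B := H (τ - S)) hκ hx (by linarith) (by linarith)
    (by linarith) (by linarith) hℓ hℓB hτ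
  have k2 := h.G_le_G (x := x) (ρ := R τ) (a := c - θ₀) (b := c + θ) (β := θ₀ / 2) (β' := 0)
    hκ.le (by linarith) (by linarith) hℓB hτ
  have k3 := (abs_le.1 k1).2
  have hGp := Frame.G_nonneg (Frame.mk (c - θ₀) κ (θ₀ / 2) x (R τ) τ) u hℓB τ
  obtain ⟨G₀, hG₀⟩ : ∃ G₀, G₀ = (Frame.mk (c - θ₀) κ (θ₀ / 2) x (R τ) τ).G u (c * τ / 2)
    (H (τ - S)) τ := ⟨_, rfl⟩
  rw [← hG₀] at k2 k3 g₀ hGp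
  rw [← hX] at g₀ g₁ g₂
  rw [← hY] at hxL
  have y1 : Real.exp (κ * x) * X = 1 := by
    rw [hX, ← Real.exp_add, add_neg_cancel, Real.exp_zero]
  have y2 : X ≤ Y := by
    rw [hX, hY]
    exact Real.exp_le_exp.2 (by linarith [mul_nonneg hκ.le hx])
  have y3 : Real.exp ((c + θ - (c - θ₀)) * x) * X ≤ Y := by
    rw [hX, hY, ← Real.exp_add]
    have := mul_le_mul_of_nonneg_right (by linarith : c + θ - (c - θ₀) ≤ κ / 2) hx
    exact Real.exp_le_exp.2 (by linarith)
  have m1 : Real.exp (κ * x) * G₀ ≤ K₀ := by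
    have := mul_le_mul_of_nonneg_left g₀.1 (Real.exp_pos (κ * x)).le
    have e : Real.exp (κ * x) * (K₀ * X) = K₀ * (Real.exp (κ * x) * X) := by ring
    rw [e, y1] at this
    linarith
  have m2 : 3 / κ * ((1 + Λ) * C ^ 2 * (4 / κ) + 2 * (1 + Λ) * (Real.exp (κ * x) * G₀)) ≤ J := by
    rw [hJ]
    gcongr
  have m3 := mul_le_mul_of_nonneg_left m2 (by linarith : 0 ≤ c + θ - (c - θ))
  have m4 : (c + θ - (c - θ)) * J = 2 * (θ * J) := by ring
  have m5 : 2 * Real.exp ((c + θ - (c - θ₀)) * x) * G₀ ≤ 2 * K₀ * Y := by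
    have p1 := mul_le_mul_of_nonneg_left g₀.1
      (by positivity : 0 ≤ 2 * Real.exp ((c + θ - (c - θ₀)) * x))
    have p2 := mul_le_mul_of_nonneg_left y3 (by positivity : 0 ≤ 2 * K₀)
    have e : 2 * Real.exp ((c + θ - (c - θ₀)) * x) * (K₀ * X) =
      2 * K₀ * (Real.exp ((c + θ - (c - θ₀)) * x) * X) := by ring
    linarith
  have m6 := mul_le_mul_of_nonneg_left (add_le_add (k2.trans m5) y2) hK₂.le
  have m7 := mul_le_mul_of_nonneg_left y2 hK₁.le
  have m8 : L * Y = 2 * (K₁ * Y) + K₂ * (2 * K₀ * Y + Y) := by rw [hL]; ring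
  have m9 : θ * (8 * J) = 8 * (θ * J) := by ring
  have := g₁.2
  linarith

/-- The dissipation around the front, over bounded regions, goes to zero. -/
lemma eventually_dissip_le (F : FrontTrack D u R H c) (h : SolBound d V u C Λ)
    (h0 : (0 : Euc n) ∈ MinSet V) (hnd : HNonDeg V) (hbist : HOnlyBist V) (hdisc : HDiscVel V)
    {ε W : ℝ} (hε : 0 < ε) (hW : 0 < W) :
    ∀ᶠ τ in atTop, ∃ g : ℝ → ℝ, ContinuousOn g (Icc τ (τ + 2)) ∧ (∫ t in τ..(τ + 2), g t) ≤ ε ∧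
      ∀ t ∈ Icc τ (τ + 2), ∀ b₁ b₂, R τ - W ≤ b₁ → b₁ ≤ b₂ → b₂ ≤ R τ + W →
        (∫ r in b₁..b₂, ‖SolBound.zDen u c r t‖ ^ 2) ≤ g t := by
  have hc := F.c_pos
  have hC := h.C_pos
  obtain ⟨Q, hQ⟩ : ∃ Q, Q = 4 * Real.exp (2 * c * (W + 4 * c)) := ⟨_, rfl⟩
  have hQp : 0 < Q := by rw [hQ]; positivity
  obtain ⟨P, hP⟩ : ∃ P, P = 4 * C ^ 2 * W := ⟨_, rfl⟩
  have hPp : 0 < P := by rw [hP]; positivity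
  obtain ⟨κ, hκ, θ, hθ, hθ₁, hev⟩ := F.exists_small_dissip h h0 hnd hbist hdisc
    (ε := ε / (2 * Q)) (θ₁ := min (min c 1) (ε / (4 * P))) (by positivity)
    (lt_min (lt_min hc one_pos) (by positivity))
  have hθc : θ ≤ c := hθ₁.trans ((min_le_left _ _).trans (min_le_left _ _))
  have hθ1 : θ ≤ 1 := hθ₁.trans ((min_le_left _ _).trans (min_le_right _ _))
  have hθε : θ ≤ ε / (4 * P) := hθ₁.trans (min_le_right _ _)
  rw [le_div_iff₀ (by positivity)] at hθε
  obtain ⟨x, hevx, hx⟩ := (hev.and (eventually_ge_atTop (max W 0))).exists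
  obtain ⟨S, hevS, hS⟩ := (hevx.and (eventually_ge_atTop 0)).exists
  filter_upwards [hevS, F.eventually_window hS (max W 1)] with τ hD win'
  have win := win'.anti (le_max_left W 1)
  have hℓ : 0 < c * τ / 2 := one_pos.trans_le (win'.anti (le_max_right W 1)).le_ℓ
  have hℓB : c * τ / 2 ≤ H (τ - S) := by linarith [win.left, win.right]
  have hτ : 0 < τ := by linarith [win.pos]
  obtain ⟨f, hf⟩ : ∃ f : Frame, f = ⟨c + θ, κ, 0, x, R τ, τ⟩ := ⟨_, rfl⟩
  rw [← hf] at hD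
  have fa : f.a = c + θ := by rw [hf]
  have fκ : f.κ = κ := by rw [hf]
  have fcut : ∀ t, f.cut t = x := fun t => by unfold Frame.cut; rw [hf]; ring
  have forig : ∀ t, f.orig t = R τ + (c + θ) * (t - τ) := fun t => by
    unfold Frame.orig; rw [hf]
  have cD : ContinuousOn (fun t => f.D u (c * τ / 2) (H (τ - S)) t) (Icc τ (τ + 2)) :=
    (h.continuousOn_D f hℓ hℓB).mono fun t ht => hτ.trans_le ht.1
  have hτ2 : τ ≤ τ + 2 := by linarith
  have iD : IntervalIntegrable (fun t => f.D u (c * τ / 2) (H (τ - S)) t) volume τ (τ + 2) :=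
    ContinuousOn.intervalIntegrable (by rwa [uIcc_of_le hτ2])
  refine ⟨fun t => Q * f.D u (c * τ / 2) (H (τ - S)) t + θ * P,
    (cD.const_smul Q).add continuousOn_const, ?_, fun t ht b₁ b₂ h1 h12 h2 => ?_⟩
  · rw [intervalIntegral.integral_add (iD.const_mul Q) intervalIntegrable_const,
      intervalIntegral.integral_const_mul, intervalIntegral.integral_const, smul_eq_mul]
    have m1 := mul_le_mul_of_nonneg_left hD hQp.le
    have m2 : Q * (ε / (2 * Q)) = ε / 2 := by field_simp
    have m3 : (τ + 2 - τ) * (θ * P) = 2 * (θ * P) := by ring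
    linarith
  · have ht0 : 0 < t := hτ.trans_le ht.1
    have s0 : 0 ≤ t - τ := by linarith [ht.1]
    have s1 : (c + θ) * (t - τ) ≤ (2 * c) * 2 :=
      mul_le_mul (by linarith) (by linarith [ht.2]) s0 (by positivity)
    have s2 : 0 ≤ (c + θ) * (t - τ) := by positivity
    have hb₁ : c * τ / 2 ≤ b₁ := by linarith [win.left]
    have hb₂ : b₂ ≤ H (τ - S) := by linarith [win.right]
    have key := h.exp_mul_le_D (f := f) (by rw [fκ]; exact hκ.le) (by rw [fa]; positivity)
      (q := -(W + 4 * c)) ht0 hℓ hb₁ h12 hb₂ (by rw [forig]; linarith)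
      (by rw [fcut, forig]; linarith [le_max_left W 0])
    rw [fa] at key
    have cont : ∀ a : ℝ, IntervalIntegrable (fun r => ‖SolBound.zDen u a r t‖ ^ 2) volume b₁ b₂ :=
      fun a => ContinuousOn.intervalIntegrable (by
        rw [uIcc_of_le h12]
        exact ((h.continuousOn_zDen a ht0).mono fun r hr =>
          (hℓ.trans_le hb₁).trans_le hr.1).norm.pow 2)
    have pt : ∀ r ∈ Icc b₁ b₂, ‖SolBound.zDen u c r t‖ ^ 2 ≤
        2 * ‖SolBound.zDen u (c + θ) r t‖ ^ 2 + 2 * (θ * C ^ 2) := fun r hr => by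
      have hr0 : 0 ≤ r := (hℓ.le.trans hb₁).trans hr.1
      have e : SolBound.zDen u c r t = SolBound.zDen u (c + θ) r t - θ • ur u r t := by
        unfold SolBound.zDen; rw [add_smul]; abel
      have n1 : ‖SolBound.zDen u c r t‖ ≤ ‖SolBound.zDen u (c + θ) r t‖ + θ * C := by
        rw [e]
        refine (norm_sub_le _ _).trans ?_
        rw [norm_smul, Real.norm_eq_abs, abs_of_pos hθ]
        have := mul_le_mul_of_nonneg_left (h.bur r t hr0 ht0) hθ.le
        linarith
      have n2 := pow_le_pow_left₀ (norm_nonneg _) n1 2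
      have n3 := sq_nonneg (‖SolBound.zDen u (c + θ) r t‖ - θ * C)
      have n4 : (θ * C) ^ 2 ≤ θ * C ^ 2 := by
        have := mul_le_mul_of_nonneg_right hθ1 (by positivity : 0 ≤ θ * C ^ 2)
        have e' : (θ * C) ^ 2 = θ * (θ * C ^ 2) := by ring
        linarith
      have n5 : (‖SolBound.zDen u (c + θ) r t‖ + θ * C) ^ 2 +
          (‖SolBound.zDen u (c + θ) r t‖ - θ * C) ^ 2 =
          2 * ‖SolBound.zDen u (c + θ) r t‖ ^ 2 + 2 * (θ * C) ^ 2 := by ring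
      linarith
    have m1 := intervalIntegral.integral_mono_on h12 (cont c)
      (((cont (c + θ)).const_mul 2).add intervalIntegrable_const) pt
    rw [intervalIntegral.integral_add ((cont (c + θ)).const_mul 2) intervalIntegrable_const,
      intervalIntegral.integral_const_mul, intervalIntegral.integral_const, smul_eq_mul] at m1
    have m2 : (b₂ - b₁) * (2 * (θ * C ^ 2)) ≤ θ * P := by
      have := mul_le_mul_of_nonneg_right (by linarith : b₂ - b₁ ≤ 2 * W)
        (by positivity : 0 ≤ 2 * (θ * C ^ 2))
      have e : 2 * W * (2 * (θ * C ^ 2)) = θ * P := by rw [hP]; ring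
      linarith
    obtain ⟨I, hI⟩ : ∃ I, I = ∫ r in b₁..b₂, ‖SolBound.zDen u (c + θ) r t‖ ^ 2 := ⟨_, rfl⟩
    rw [← hI] at m1 key
    have hI0 : 0 ≤ I := by
      rw [hI]; exact intervalIntegral.integral_nonneg h12 fun r _ => by positivity
    have m3 : 2 * I ≤ Q * (Real.exp ((c + θ) * -(W + 4 * c)) / 2 * I) := by
      have p1 : 1 ≤ Real.exp (2 * c * (W + 4 * c)) * Real.exp ((c + θ) * -(W + 4 * c)) := by
        rw [← Real.exp_add]
        refine Real.one_le_exp ?_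
        have : 2 * c * (W + 4 * c) + (c + θ) * -(W + 4 * c) = (c - θ) * (W + 4 * c) := by ring
        rw [this]
        exact mul_nonneg (by linarith) (by linarith)
      have p2 := mul_le_mul_of_nonneg_right p1 (by positivity : 0 ≤ 2 * I)
      have e : Q * (Real.exp ((c + θ) * -(W + 4 * c)) / 2 * I) =
        Real.exp (2 * c * (W + 4 * c)) * Real.exp ((c + θ) * -(W + 4 * c)) * (2 * I) := by
        rw [hQ]; ring
      linarith
    have m4 := mul_le_mul_of_nonneg_left key hQp.le
    have : (∫ r in b₁..b₂, ‖SolBound.zDen u c r t‖ ^ 2) ≤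
      Q * f.D u (c * τ / 2) (H (τ - S)) t + θ * P := by linarith
    exact this

/-- The dissipation distance goes to zero. -/
lemma tendsto_deltaDissip (F : FrontTrack D u R H c) (h : SolBound d V u C Λ)
    (h0 : (0 : Euc n) ∈ MinSet V) (hnd : HNonDeg V) (hbist : HOnlyBist V) (hdisc : HDiscVel V) :
    Tendsto (fun t => deltaDissip u R c t) atTop (𝓝 0) := by
  have hc := F.c_pos
  obtain ⟨C₀, hC₀, T₀, hmean⟩ := F.exists_mean_speed h h0 hnd hbist hdisc one_pos
  have main : ∀ ε > (0:ℝ), ∀ᶠ t in atTop, deltaDissip u R c t ≤ ε := fun ε hε => by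
    have hev := (F.eventually_dissip_le h h0 hnd hbist hdisc hε
      (by positivity : 0 < 1 / ε + (2 * c + 2 + C₀))).and (eventually_ge_atTop T₀)
    filter_upwards [(tendsto_atTop_add_const_right atTop (-1 : ℝ) tendsto_id).eventually hev]
      with t ht
    obtain ⟨⟨g, cg, ig, hg⟩, hT⟩ := ht
    simp only [id] at cg ig hg hT
    refine csInf_le ⟨0, fun e he => he.1.le⟩ ⟨hε, ?_⟩
    have hε' : 0 < 1 / ε := by positivity
    have bound : ∀ τ ∈ Icc (-1:ℝ) 1, (∫ ρ in (-(1/ε))..(1/ε),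
        ‖ut u (R (t + τ) + ρ) (t + τ) + c • ur u (R (t + τ) + ρ) (t + τ)‖ ^ 2) ≤ g (t + τ) :=
      fun τ hτ => by
        have e := intervalIntegral.integral_comp_add_left (a := -(1/ε)) (b := 1/ε)
          (fun r => ‖SolBound.zDen u c r (t + τ)‖ ^ 2) (R (t + τ))
        have p1 := hmean (t + -1) hT (τ + 1) (by linarith [hτ.1])
        have e' : t + -1 + (τ + 1) = t + τ := by ring
        rw [e'] at p1
        obtain ⟨p2, p3⟩ := abs_le.1 p1
        have p4 := mul_le_mul_of_nonneg_left (by linarith [hτ.2] : τ + 1 ≤ 2) hc.le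
        have p5 := mul_nonneg hc.le (by linarith [hτ.1] : 0 ≤ τ + 1)
        have := hg (t + τ) ⟨by linarith [hτ.1], by linarith [hτ.2]⟩ (R (t + τ) + -(1/ε))
          (R (t + τ) + 1/ε) (by linarith [hτ.2]) (by linarith) (by linarith [hτ.2])
        exact e.le.trans this
    have cg' : ContinuousOn (fun τ => g (t + τ)) (Icc (-1) 1) :=
      cg.comp (continuous_const.add continuous_id).continuousOn fun τ hτ =>
        ⟨by linarith [hτ.1], by linarith [hτ.2]⟩
    have igg : IntegrableOn (fun τ => g (t + τ)) (Ioc (-1) 1) :=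
      (cg'.integrableOn_Icc).mono_set Ioc_subset_Icc_self
    have e1 : (∫ τ in (-1:ℝ)..1, g (t + τ)) = ∫ s in (t + -1)..(t + -1 + 2), g s := by
      rw [intervalIntegral.integral_comp_add_left (fun s => g s)]
      congr 1; ring
    refine le_trans ?_ (e1.le.trans ig)
    rw [intervalIntegral.integral_of_le (by norm_num), intervalIntegral.integral_of_le (by norm_num)]
    refine integral_mono_of_nonneg (Eventually.of_forall fun τ =>
      intervalIntegral.integral_nonneg (by linarith) fun r _ => by positivity) igg ?_
    exact (ae_restrict_iff' measurableSet_Ioc).2 (Eventually.of_forall fun τ hτ =>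
      bound τ (Ioc_subset_Icc_self hτ))
  refine tendsto_order.2 ⟨fun a ha => Eventually.of_forall fun t => ha.trans_le ?_,
    fun a ha => ?_⟩
  · exact Real.sInf_nonneg fun e he => he.1.le
  · filter_upwards [main (a / 2) (half_pos ha)] with t ht
    linarith

end FrontTrack

/-- relaxation. -/
theorem stmt17 {n d k : ℕ} (hn : 1 ≤ n) (hd : 2 ≤ d) (hk : 2 ≤ k)
    (V : Euc n → ℝ) (hV : ContDiff ℝ (k : ℕ∞) V) (hcoerc : HCoerc V)
    (D : EscData n V) (hgen : HGen V D.dEsc)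
    (h0 : (0 : Euc n) ∈ MinSet V) (hV0 : V 0 = 0)
    (u : ℝ → ℝ → Euc n) (hu : IsRadialSolution d V u)
    (cHom : ℝ) (rHom : ℝ → ℝ) (hhom : HHomWith u 0 cHom rHom)
    (hrHom' : ∀ t : ℝ, 0 ≤ deriv rHom t)
    (hinv : 0 < cEscV u 0 D.dEsc rHom)
    (ν K δ L₀ cno : ℝ) (hν : 0 < ν) (hK : 0 < K)
    (hδ : δ = deltaEsc D.dEsc (wV V) (kappa0 D.lmin))
    (hL : L₀ = L0c (kappa0 D.lmin) ν K δ)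
    (hcno : cno = cNoEsc (kappa0 D.lmin) K L₀ δ)
    (hfire : FireIneq V d D.lmin D.dEsc u ν K)
    (hhull : HullBound V d D.lmin u δ L₀ rHom)
    (cesc : ℝ)
    (hcesc₁ : liminf (fun t => rescF V d D.lmin u δ L₀ rHom t / t) atTop = cesc)
    (hcesc₂ : limsup (fun t => rescF V d D.lmin u δ L₀ rHom t / t) atTop = cesc) :
    Tendsto (fun t => deltaDissip u (rescF V d D.lmin u δ L₀ rHom) cesc t)
      atTop (𝓝 0) := by
  obtain ⟨hnd, hbist, hdisc, -⟩ := hgen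
  have hV2 : ContDiff ℝ 2 V := hV.of_le (WithTop.coe_le_coe.2 (Nat.cast_le.2 hk : ((2 : ℕ) : ℕ∞) ≤ k))
  obtain ⟨C, Λ, h⟩ := hu.exists_solBound (by omega) hV2 h0.1 hV0
  have S : EscSetup d V D u cHom rHom ν K δ L₀ :=
    ⟨hd, hcoerc, h0, hhom, hrHom', hν, hK, hδ, hfire, hhull⟩
  exact (S.frontTrack h hinv hcesc₁ hcesc₂).tendsto_deltaDissip h h0 hnd hbist hdisc
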